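/- arXiv:1509.04167 — 4 statements merged into one kernel-verified Lean document; each statement's English description precedes it below -/
import Mathlib

section
/- Let d, n ≥ 1 be integers. For j ∈ {1,…,n} and r ∈ {1,…,d}, let p_j, q_{j,r} ∈ [0,1] satisfy Σ_{r=1}^d q_{j,r} = 1 and λ_r := Σ_{j=1}^n p_j q_{j,r} > 0. In ℓ¹(ℕ^d), let F = ∏_{j=1}^n (δ₀ + p_j(Q_j − δ₀)) (convolution product), where Q_j = Σ_{r=1}^d q_{j,r} δ_{e_r}, and let G = exp(Σ_{r=1}^d λ_r(δ_{e_r} − δ₀)), i.e. G(m) = ∏_{r=1}^d e^{−λ_r} λ_r^{m_r}/m_r! . Set α₁ = Σ_{j=1}^n g(2p_j) p_j² Σ_{r=1}^d q_{j,r} · min{ q_{j,r}/(2^{3/2} λ_r), 2 }. If α₁ < 2^{−3/2}, then ‖F − G‖ ≤ 2α₁ / (1 − 2^{3/2} α₁). -/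
open scoped Classical BigOperators

noncomputable section

namespace PaperL1

variable {X : Type*} [AddCommMonoid X]

/-- Convolution of two summable functions on an additive commutative monoid:
`(f ⋆ g) x = Σ_{(y,z) : y + z = x} f y * g z`. -/
def conv (f g : X → ℝ) : X → ℝ :=
  fun x => ∑' p : {p : X × X // p.1 + p.2 = x}, f p.1.1 * g p.1.2

/-- The Dirac delta at a point: the unit of the convolution algebra is `delta 0`. -/
def delta (x₀ : X) : X → ℝ := fun x => if x = x₀ then 1 else 0

/-- Convolution powers, with `f^{*0} = δ₀`. -/
def convPow (f : X → ℝ) : ℕ → (X → ℝ)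
  | 0 => delta 0
  | n + 1 => conv f (convPow f n)

/-- The exponential in the convolution algebra: `exp f = Σ_m f^{*m}/m!`. -/
def convExp (f : X → ℝ) : X → ℝ :=
  fun x => ∑' m : ℕ, ((m.factorial : ℝ))⁻¹ * convPow f m x

/-- Convolution product over a finite (linearly ordered) index set; the empty
product is `δ₀`. -/
def convProd {ι : Type*} [LinearOrder ι] (s : Finset ι) (f : ι → X → ℝ) : X → ℝ :=
  (s.sort (· ≤ ·)).foldr (fun i acc => conv (f i) acc) (delta 0)

/-- The ℓ¹ norm: `‖f‖ = Σ_x |f x|`. -/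
def l1norm (f : X → ℝ) : ℝ := ∑' x, |f x|

/-- A probability mass function: nonnegative values summing to `1`. -/
def IsPmf (f : X → ℝ) : Prop := (∀ x, 0 ≤ f x) ∧ HasSum f 1

/-- The function `g(x) = 2 Σ_{m=2}^∞ (m-1) x^{m-2} / m!`. -/
def gfun (x : ℝ) : ℝ := ∑' m : ℕ, 2 * (m + 1) * x ^ m / ((m + 2).factorial : ℝ)

end PaperL1


namespace PaperAux

open PaperL1

/-- The underlying Banach space of `ℓ¹(ℕ^d)`. -/
def L1 (d : ℕ) : Type := lp (fun _ : Fin d → ℕ => ℝ) 1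

variable {d : ℕ}

instance : NormedAddCommGroup (L1 d) :=
  inferInstanceAs (NormedAddCommGroup (lp (fun _ : Fin d → ℕ => ℝ) 1))

instance : NormedSpace ℝ (L1 d) :=
  inferInstanceAs (NormedSpace ℝ (lp (fun _ : Fin d → ℕ => ℝ) 1))

instance : CompleteSpace (L1 d) :=
  inferInstanceAs (CompleteSpace (lp (fun _ : Fin d → ℕ => ℝ) 1))

/-- the function underlying an element of `L1` -/
def fn (f : L1 d) : (Fin d → ℕ) → ℝ := f.1

/-- build an element of `L1` -/
def mk (f : (Fin d → ℕ) → ℝ) (hf : Summable fun x => |f x|) : L1 d :=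
  ⟨f, memℓp_gen (by simpa using hf)⟩

theorem fn_mk (f : (Fin d → ℕ) → ℝ) (hf) : fn (mk f hf) = f := rfl

theorem fn_inj {f g : L1 d} (h : fn f = fn g) : f = g := Subtype.ext h

theorem fn_summable (f : L1 d) : Summable fun x => |fn f x| := by
  have := (memℓp_gen_iff (p := 1) (by simp)).1 f.2
  simp only [ENNReal.toReal_one, Real.rpow_one] at this
  exact this

theorem norm_eq (f : L1 d) : ‖f‖ = ∑' x, |fn f x| := by
  have := lp.norm_eq_tsum_rpow (p := 1) (by simp) (f : lp (fun _ : Fin d → ℕ => ℝ) 1)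
  simp at this
  exact this

theorem fn_add (f g : L1 d) : fn (f + g) = fn f + fn g := rfl
theorem fn_sub (f g : L1 d) : fn (f - g) = fn f - fn g := rfl
theorem fn_neg (f : L1 d) : fn (-f) = - fn f := rfl
theorem fn_zero : fn (0 : L1 d) = 0 := rfl
theorem fn_smul (c : ℝ) (f : L1 d) : fn (c • f) = c • fn f := rfl

theorem summable_prod (f g : L1 d) :
    Summable fun p : (Fin d → ℕ) × (Fin d → ℕ) => |fn f p.1 * fn g p.2| := by
  have := (fn_summable f).mul_of_nonneg (fn_summable g) (fun _ => abs_nonneg _)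
    (fun _ => abs_nonneg _)
  simpa [abs_mul] using this

theorem summable_sigma (f g : L1 d) :
    Summable fun s : (Σ x : Fin d → ℕ, {p : (Fin d → ℕ) × (Fin d → ℕ) // p.1 + p.2 = x}) =>
      |fn f s.2.1.1 * fn g s.2.1.2| := by
  have := (Equiv.sigmaFiberEquiv
    (fun p : (Fin d → ℕ) × (Fin d → ℕ) => p.1 + p.2)).summable_iff.2 (summable_prod f g)
  exact this

theorem abs_conv_le (f g : L1 d) (x : Fin d → ℕ) : |conv (fn f) (fn g) x| ≤
    ∑' p : {p : (Fin d → ℕ) × (Fin d → ℕ) // p.1 + p.2 = x}, |fn f p.1.1 * fn g p.1.2| := by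
  have h := (summable_sigma f g).sigma_factor x
  have := norm_tsum_le_tsum_norm (f := fun p : {p : (Fin d → ℕ) × (Fin d → ℕ) // p.1 + p.2 = x} =>
    fn f p.1.1 * fn g p.1.2) h
  exact this

theorem conv_summable (f g : L1 d) : Summable fun x => |conv (fn f) (fn g) x| :=
  Summable.of_nonneg_of_le (fun _ => abs_nonneg _) (abs_conv_le f g) (summable_sigma f g).sigma

instance : Mul (L1 d) := ⟨fun f g => mk (conv (fn f) (fn g)) (conv_summable f g)⟩

theorem fn_mul (f g : L1 d) : fn (f * g) = conv (fn f) (fn g) := rfl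

theorem delta_summable (x : Fin d → ℕ) : Summable fun y => |delta x y| := by
  apply summable_of_ne_finset_zero (s := {x})
  intro b hb
  simp at hb
  simp [delta, hb]

/-- Dirac mass in `L1` -/
def dl (x : Fin d → ℕ) : L1 d := mk (delta x) (delta_summable x)

theorem fn_dl (x : Fin d → ℕ) : fn (dl x) = delta x := rfl

instance : One (L1 d) := ⟨dl 0⟩

theorem fn_one : fn (1 : L1 d) = delta 0 := rfl

/-- embedding into power series -/
def ps (f : (Fin d → ℕ) → ℝ) : MvPowerSeries (Fin d) ℝ := fun m => f m

theorem ps_inj {f g : (Fin d → ℕ) → ℝ} (h : ps f = ps g) : f = g := by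
  funext x
  have := congrFun h (Finsupp.equivFunOnFinite.symm x)
  simpa [ps] using this

theorem ps_conv (f g : (Fin d → ℕ) → ℝ) : ps (conv f g) = ps f * ps g := by
  ext m
  rw [MvPowerSeries.coeff_mul]
  show conv f g m = _
  unfold conv
  let E : {p : (Fin d → ℕ) × (Fin d → ℕ) // p.1 + p.2 = m} ≃ Finset.HasAntidiagonal.antidiagonal m :=
    { toFun := fun p => ⟨(Finsupp.equivFunOnFinite.symm p.1.1, Finsupp.equivFunOnFinite.symm p.1.2),
        by
          rw [Finset.HasAntidiagonal.mem_antidiagonal]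
          ext i
          simpa using congrFun p.2 i⟩
      invFun := fun p => ⟨(p.1.1, p.1.2), by
          have := Finset.HasAntidiagonal.mem_antidiagonal.1 p.2
          exact congrArg (fun z : Fin d →₀ ℕ => (z : Fin d → ℕ)) this⟩
      left_inv := fun p => by
          apply Subtype.ext; rfl
      right_inv := fun p => by
          apply Subtype.ext
          apply Prod.ext <;> simp }
  rw [← E.symm.tsum_eq, tsum_fintype, Finset.sum_coe_sort_eq_attach, ← Finset.sum_attach
    (Finset.HasAntidiagonal.antidiagonal m)]
  rfl

theorem ps_add (f g : (Fin d → ℕ) → ℝ) : ps (f + g) = ps f + ps g := rfl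
theorem ps_smul (c : ℝ) (f : (Fin d → ℕ) → ℝ) : ps (c • f) = c • ps f := rfl
theorem ps_zero : ps (0 : (Fin d → ℕ) → ℝ) = 0 := rfl

theorem ps_delta_zero : ps (delta 0 : (Fin d → ℕ) → ℝ) = 1 := by
  ext m
  rw [MvPowerSeries.coeff_one]
  show delta 0 (m : Fin d → ℕ) = _
  unfold delta
  congr 1
  simp [← Finsupp.coe_zero]

theorem L1_ext {f g : L1 d} (h : ps (fn f) = ps (fn g)) : f = g := fn_inj (ps_inj h)

instance : CommRing (L1 d) :=
  { (inferInstance : AddCommGroup (L1 d)) with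
    mul := (· * ·)
    one := 1
    mul_assoc := fun a b c => L1_ext (by simp only [fn_mul, ps_conv, mul_assoc])
    one_mul := fun a => L1_ext (by simp only [fn_mul, ps_conv, fn_one, ps_delta_zero, one_mul])
    mul_one := fun a => L1_ext (by simp only [fn_mul, ps_conv, fn_one, ps_delta_zero, mul_one])
    left_distrib := fun a b c => L1_ext (by
      simp only [fn_mul, fn_add, ps_conv, ps_add, mul_add])
    right_distrib := fun a b c => L1_ext (by
      simp only [fn_mul, fn_add, ps_conv, ps_add, add_mul])
    zero_mul := fun a => L1_ext (by simp only [fn_mul, fn_zero, ps_zero, ps_conv, zero_mul])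
    mul_zero := fun a => L1_ext (by simp only [fn_mul, fn_zero, ps_zero, ps_conv, mul_zero])
    mul_comm := fun a b => L1_ext (by simp only [fn_mul, ps_conv, mul_comm]) }

theorem norm_mul_le' (f g : L1 d) : ‖f * g‖ ≤ ‖f‖ * ‖g‖ := by
  rw [norm_eq, norm_eq, norm_eq, fn_mul]
  have h1 : ∑' x, |conv (fn f) (fn g) x| ≤ ∑' x, ∑' p : {p : (Fin d → ℕ) × (Fin d → ℕ) //
      p.1 + p.2 = x}, |fn f p.1.1 * fn g p.1.2| :=
    (conv_summable f g).tsum_le_tsum (abs_conv_le f g) (summable_sigma f g).sigma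
  refine h1.trans (le_of_eq ?_)
  have h2 := (summable_sigma f g).tsum_sigma
  have h3 := (Equiv.sigmaFiberEquiv (fun p : (Fin d → ℕ) × (Fin d → ℕ) => p.1 + p.2)).tsum_eq
    (fun p => |fn f p.1 * fn g p.2|)
  have h4 := (fn_summable f).tsum_mul_tsum (fn_summable g) (by
    simpa [abs_mul] using summable_prod f g)
  rw [h4, ← h2]
  refine Eq.trans h3 ?_
  simp [abs_mul]

instance : NormedCommRing (L1 d) :=
  { (inferInstance : NormedAddCommGroup (L1 d)), (inferInstance : CommRing (L1 d)) with
    norm_mul_le := norm_mul_le' }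

instance : Algebra ℝ (L1 d) := Algebra.ofModule
  (fun c f g => L1_ext (by simp only [fn_mul, fn_smul, ps_conv, ps_smul, smul_mul_assoc]))
  (fun c f g => L1_ext (by simp only [fn_mul, fn_smul, ps_conv, ps_smul, mul_smul_comm]))

instance : NormedAlgebra ℝ (L1 d) :=
  { (inferInstance : Algebra ℝ (L1 d)) with
    norm_smul_le := norm_smul_le }

instance : NormedAlgebra ℚ (L1 d) := NormedAlgebra.restrictScalars ℚ ℝ (L1 d)

theorem norm_dl (x : Fin d → ℕ) : ‖dl x‖ = 1 := by
  rw [norm_eq, fn_dl, tsum_eq_single x]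
  · simp [delta]
  · intro b hb; simp [delta, hb]

instance : NormOneClass (L1 d) := ⟨norm_dl 0⟩

/-- evaluation at a point -/
def ev (x : Fin d → ℕ) : L1 d →L[ℝ] ℝ :=
  LinearMap.mkContinuous
    { toFun := fun f => fn f x
      map_add' := fun _ _ => rfl
      map_smul' := fun _ _ => rfl } 1 (fun f => by
        rw [one_mul, norm_eq]
        exact (fn_summable f).le_tsum x (fun _ _ => abs_nonneg _))

theorem ev_apply (x : Fin d → ℕ) (f : L1 d) : ev x f = fn f x := rfl

theorem fn_sum {ι : Type*} (s : Finset ι) (f : ι → L1 d) :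
    fn (∑ i ∈ s, f i) = ∑ i ∈ s, fn (f i) := by
  funext x
  rw [Finset.sum_apply]
  exact map_sum (ev x) f s

theorem fn_pow (f : L1 d) (k : ℕ) : fn (f ^ k) = convPow (fn f) k := by
  induction k with
  | zero => rfl
  | succ k ih => rw [pow_succ', fn_mul, ih]; rfl

theorem hasSum_exp (f : L1 d) :
    HasSum (fun k : ℕ => ((k.factorial : ℝ))⁻¹ • f ^ k) (NormedSpace.exp f) :=
  NormedSpace.exp_series_hasSum_exp' (𝕂 := ℝ) f

theorem hasSum_exp_fn (f : L1 d) (x : Fin d → ℕ) :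
    HasSum (fun k : ℕ => ((k.factorial : ℝ))⁻¹ * fn (f ^ k) x) (fn (NormedSpace.exp f) x) :=
  (ev x).hasSum (hasSum_exp f)

theorem fn_exp (f : L1 d) : fn (NormedSpace.exp f) = convExp (fn f) := by
  funext x
  rw [← (hasSum_exp_fn f x).tsum_eq]
  simp only [fn_pow, convExp]

theorem fn_prod {ι : Type*} [LinearOrder ι] (s : Finset ι) (f : ι → L1 d) :
    fn (∏ i ∈ s, f i) = convProd s (fun i => fn (f i)) := by
  have h : ∏ i ∈ s, f i = ((s.sort (· ≤ ·)).map f).prod := by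
    rw [← List.prod_toFinset _ (Finset.sort_nodup _ _), Finset.sort_toFinset]
  rw [h]
  unfold convProd
  generalize s.sort (· ≤ ·) = l
  induction l with
  | nil => rfl
  | cons a l ih => rw [List.map_cons, List.prod_cons, fn_mul, ih]; rfl

theorem l1norm_eq (f : L1 d) : l1norm (fn f) = ‖f‖ := (norm_eq f).symm

/-- conv with Dirac mass is shift -/
theorem fn_dl_mul_add (a : Fin d → ℕ) (f : L1 d) (x : Fin d → ℕ) :
    fn (dl a * f) (a + x) = fn f x := by
  rw [fn_mul, fn_dl]
  unfold conv
  rw [tsum_eq_single ⟨(a, x), rfl⟩]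
  · simp [delta]
  · rintro ⟨⟨y, z⟩, h⟩ hne
    have : y ≠ a := by
      rintro rfl
      apply hne
      have := add_left_cancel h
      simp_all
    simp [delta, this]

theorem fn_dl_mul_not_le (a : Fin d → ℕ) (f : L1 d) (x : Fin d → ℕ) (h : ¬ a ≤ x) :
    fn (dl a * f) x = 0 := by
  rw [fn_mul, fn_dl]
  unfold conv
  rw [← tsum_zero (α := ℝ)]
  congr 1
  funext p
  have : p.1.1 ≠ a := by
    intro h2
    apply h
    rw [← p.2, h2]
    exact le_self_add
  simp [delta, this]


/-- unit vector -/
def sv (r : Fin d) : Fin d → ℕ := Pi.single r 1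

theorem sv_same (r : Fin d) : sv r r = 1 := by simp [sv]

theorem sv_ne {r s : Fin d} (h : s ≠ r) : sv r s = 0 := by simp [sv, h]

theorem sv_apply (r s : Fin d) : sv r s = if s = r then 1 else 0 := by
  by_cases h : s = r
  · subst h; simp [sv_same]
  · simp [sv_ne h, h]

theorem sv_le {r : Fin d} {m : Fin d → ℕ} (h : m r ≠ 0) : sv r ≤ m := by
  intro s
  by_cases hs : s = r
  · subst hs; rw [sv_same]; exact Nat.pos_of_ne_zero h
  · rw [sv_ne hs]; exact Nat.zero_le _

theorem sub_add_sv {r : Fin d} {m : Fin d → ℕ} (h : m r ≠ 0) : m - sv r + sv r = m :=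
  tsub_add_cancel_of_le (sv_le h)

theorem add_sub_sv (r : Fin d) (m : Fin d → ℕ) : m + sv r - sv r = m := by
  funext i; simp

theorem ind_sv {P : (Fin d → ℕ) → Prop} (h0 : P 0) (h1 : ∀ m r, P m → P (m + sv r)) (m) : P m := by
  induction hk : ∑ i, m i using Nat.strong_induction_on generalizing m with
  | _ k ih =>
    by_cases hm : m = 0
    · rw [hm]; exact h0
    · obtain ⟨r, hr⟩ := Function.ne_iff.1 hm
      simp only [Pi.zero_apply] at hr
      rw [← sub_add_sv hr]
      refine h1 _ _ (ih (∑ i, (m - sv r) i) ?_ _ rfl)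
      rw [← hk]
      refine Finset.sum_lt_sum (fun i _ => by simp) ⟨r, Finset.mem_univ _, ?_⟩
      simp [sv_same]; omega

/-- shift of a function -/
def sh (r : Fin d) (f : (Fin d → ℕ) → ℝ) (m : Fin d → ℕ) : ℝ :=
  if m r = 0 then 0 else f (m - sv r)

theorem fn_sh (r : Fin d) (f : L1 d) (m : Fin d → ℕ) :
    fn (dl (sv r) * f) m = sh r (fn f) m := by
  unfold sh
  split_ifs with h
  · apply fn_dl_mul_not_le
    intro h2
    have := h2 r
    rw [sv_same, h] at this
    exact absurd this (by norm_num)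
  · conv_lhs => rw [← sub_add_sv h, add_comm]
    rw [fn_dl_mul_add]

/-- first-order differences -/
def W (w : Fin d → ℝ) : L1 d := ∑ r, w r • (dl (sv r) - 1)

theorem fn_W_mul (w : Fin d → ℝ) (f : L1 d) (m : Fin d → ℕ) :
    fn (W w * f) m = ∑ r, w r * (sh r (fn f) m - fn f m) := by
  unfold W
  rw [Finset.sum_mul, fn_sum, Finset.sum_apply]
  refine Finset.sum_congr rfl fun r _ => ?_
  rw [smul_mul_assoc, fn_smul, sub_mul, one_mul, fn_sub, Pi.smul_apply, Pi.sub_apply, fn_sh]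
  rfl

theorem mul_sh (r s : Fin d) (f : (Fin d → ℕ) → ℝ) (m : Fin d → ℕ) :
    (m r : ℝ) * sh s f m = sh s (fun m => (m r : ℝ) * f m) m + if s = r then sh s f m else 0 := by
  unfold sh
  by_cases h : m s = 0
  · simp [h]
  · rw [if_neg h, if_neg h]
    by_cases hs : s = r
    · subst hs
      simp only [Pi.sub_apply, sv_same, if_true]
      rw [Nat.cast_sub (by omega)]
      push_cast; ring
    · have : r ≠ s := fun h => hs h.symm
      simp only [Pi.sub_apply, sv_ne this, hs, if_false]
      simp

theorem rec_pow (lam : Fin d → ℝ) (r : Fin d) (k : ℕ) (m : Fin d → ℕ) :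
    (m r : ℝ) * fn (W lam ^ k) m = k * (lam r * fn (dl (sv r) * W lam ^ (k - 1)) m) := by
  induction k generalizing m with
  | zero =>
    simp only [pow_zero, fn_one, delta]
    by_cases h : m = 0
    · simp [h]
    · simp [h]
  | succ k ih =>
    have hf : (fun m : Fin d → ℕ => (m r : ℝ) * fn (W lam ^ k) m) =
        fn ((k * lam r : ℝ) • (dl (sv r) * W lam ^ (k - 1))) := by
      funext m; rw [ih, fn_smul, Pi.smul_apply, smul_eq_mul]; ring
    have hk : (m r : ℝ) * fn (W lam ^ k) m = fn ((k * lam r : ℝ) • (dl (sv r) * W lam ^ (k - 1))) m :=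
      congrFun hf m
    rw [pow_succ', fn_W_mul, Finset.mul_sum]
    have h1 : ∀ s ∈ (Finset.univ : Finset (Fin d)),
        (m r : ℝ) * (lam s * (sh s (fn (W lam ^ k)) m - fn (W lam ^ k) m)) =
        lam s * (sh s (fn ((k * lam r : ℝ) • (dl (sv r) * W lam ^ (k - 1)))) m
          - fn ((k * lam r : ℝ) • (dl (sv r) * W lam ^ (k - 1))) m) +
        if s = r then lam s * sh s (fn (W lam ^ k)) m else 0 := by
      intro s _
      have h2 := mul_sh r s (fn (W lam ^ k)) m
      rw [hf] at h2
      rw [← hk]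
      have : (m r : ℝ) * (lam s * (sh s (fn (W lam ^ k)) m - fn (W lam ^ k) m)) =
        lam s * ((m r : ℝ) * sh s (fn (W lam ^ k)) m) - lam s * ((m r : ℝ) * fn (W lam ^ k) m) := by
        ring
      rw [this, h2]
      split_ifs <;> ring
    rw [Finset.sum_congr rfl h1, Finset.sum_add_distrib, ← fn_W_mul, Finset.sum_ite_eq' ,
      if_pos (Finset.mem_univ _), Nat.add_sub_cancel, fn_sh r (W lam ^ k), mul_smul_comm, fn_smul,
      Pi.smul_apply, smul_eq_mul]
    cases k with
    | zero => simp
    | succ k =>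
      have : W lam * (dl (sv r) * W lam ^ (k + 1 - 1)) = dl (sv r) * W lam ^ (k + 1) := by
        rw [Nat.add_sub_cancel]; ring
      rw [this, fn_sh]
      push_cast; ring

/-- the Poisson distribution -/
def Gp (lam : Fin d → ℝ) : L1 d := NormedSpace.exp (W lam)

theorem rec_G (lam : Fin d → ℝ) (r : Fin d) (m : Fin d → ℕ) :
    (m r : ℝ) * fn (Gp lam) m = lam r * sh r (fn (Gp lam)) m := by
  have h1 := (hasSum_exp_fn (W lam) m).mul_left (m r : ℝ)
  have h2 := ((ev m).hasSum ((hasSum_exp (W lam)).mul_left (dl (sv r)))).mul_left (lam r)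
  have h3 := (hasSum_nat_add_iff' 1).2 h1
  rw [← fn_sh]
  have h0 : (m r : ℝ) * fn (W lam ^ 0) m = 0 := by rw [rec_pow]; simp
  have h4 : (m r : ℝ) * fn (NormedSpace.exp (W lam)) m - ∑ i ∈ Finset.range 1,
      (m r : ℝ) * ((Nat.factorial i : ℝ)⁻¹ * fn (W lam ^ i) m) =
      (m r : ℝ) * fn (NormedSpace.exp (W lam)) m := by
    simp only [Finset.sum_range_one, Nat.factorial_zero, Nat.cast_one, inv_one, one_mul, h0,
      sub_zero]
  rw [h4] at h3
  refine h3.unique (h2.congr_fun ?_)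
  intro k
  rw [ev_apply, mul_smul_comm, fn_smul, Pi.smul_apply, smul_eq_mul, mul_left_comm, rec_pow,
    Nat.add_sub_cancel, Nat.factorial_succ]
  push_cast
  field_simp

theorem rec_G_add (lam : Fin d → ℝ) (r : Fin d) (m : Fin d → ℕ) :
    ((m r : ℝ) + 1) * fn (Gp lam) (m + sv r) = lam r * fn (Gp lam) m := by
  have := rec_G lam r (m + sv r)
  unfold sh at this
  rw [add_sub_sv] at this
  simpa [sv_same] using this

theorem fn_pow_zero (lam : Fin d → ℝ) (k : ℕ) : fn (W lam ^ k) 0 = (- ∑ r, lam r) ^ k := by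
  induction k with
  | zero => simp [fn_one, delta]
  | succ k ih =>
    rw [pow_succ', fn_W_mul, pow_succ', ih]
    simp [sh, Finset.sum_mul]

theorem G_zero (lam : Fin d → ℝ) : 0 < fn (Gp lam) 0 := by
  have h := hasSum_exp_fn (W lam) 0
  simp only [fn_pow_zero] at h
  have h2 : HasSum (fun k : ℕ => ((k.factorial : ℝ))⁻¹ • (- ∑ r, lam r) ^ k)
    (NormedSpace.exp (- ∑ r, lam r)) := NormedSpace.exp_series_hasSum_exp' (𝕂 := ℝ) _
  rw [← Real.exp_eq_exp_ℝ] at h2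
  have := h.unique h2
  unfold Gp
  rw [this]
  exact Real.exp_pos _

theorem G_pos (lam : Fin d → ℝ) (hl : ∀ r, 0 < lam r) (m : Fin d → ℕ) : 0 < fn (Gp lam) m := by
  induction m using ind_sv with
  | h0 => exact G_zero lam
  | h1 m r ih =>
    have := rec_G_add lam r m
    have h2 : 0 < ((m r : ℝ) + 1) * fn (Gp lam) (m + sv r) := by
      rw [this]; exact mul_pos (hl r) ih
    exact pos_of_mul_pos_right h2 (by positivity)

theorem G_scale (lam : Fin d → ℝ) (c : ℝ) (m : Fin d → ℕ) :
    fn (Gp lam) 0 * fn (Gp (c • lam)) m = fn (Gp (c • lam)) 0 * (c ^ (∑ i, m i) * fn (Gp lam) m) := by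
  induction m using ind_sv with
  | h0 => simp; ring
  | h1 m r ih =>
    have h1 := rec_G_add lam r m
    have h2 := rec_G_add (c • lam) r m
    have h3 : (∑ i, (m + sv r) i) = (∑ i, m i) + 1 := by
      simp [Finset.sum_add_distrib, sv_apply]
    rw [h3, pow_succ]
    rw [Pi.smul_apply, smul_eq_mul] at h2
    have hne : ((m r : ℝ) + 1) ≠ 0 := by positivity
    apply mul_left_cancel₀ hne
    linear_combination (fn (Gp lam) 0) * h2 + c * lam r * ih
      - fn (Gp (c • lam)) 0 * c ^ (∑ i, m i) * c * h1

theorem norm_exp_le' (f : L1 d) : ‖NormedSpace.exp f‖ ≤ Real.exp ‖f‖ := by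
  have h2 : HasSum (fun k : ℕ => ((k.factorial : ℝ))⁻¹ • ‖f‖ ^ k)
    (NormedSpace.exp ‖f‖) := NormedSpace.exp_series_hasSum_exp' (𝕂 := ℝ) _
  rw [← Real.exp_eq_exp_ℝ] at h2
  rw [← (hasSum_exp f).tsum_eq]
  refine tsum_of_norm_bounded h2 fun k => ?_
  rw [norm_smul, smul_eq_mul, norm_inv, Real.norm_natCast]
  gcongr
  exact norm_pow_le f k

theorem norm_G (lam : Fin d → ℝ) (hl : ∀ r, 0 ≤ lam r) : ‖Gp lam‖ ≤ 1 := by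
  set B : L1 d := ∑ r, lam r • dl (sv r) with hB
  have hW : W lam = B + algebraMap ℝ (L1 d) (- ∑ r, lam r) := by
    rw [Algebra.algebraMap_eq_smul_one, neg_smul, Finset.sum_smul, hB, ← sub_eq_add_neg,
      ← Finset.sum_sub_distrib]
    simp only [W, smul_sub]
  have hBn : ‖B‖ ≤ ∑ r, lam r := by
    refine (norm_sum_le _ _).trans (Finset.sum_le_sum fun r _ => ?_)
    rw [norm_smul, norm_dl, mul_one, Real.norm_of_nonneg (hl r)]
  unfold Gp
  rw [hW, NormedSpace.exp_add, ← NormedSpace.algebraMap_exp_comm, ← Real.exp_eq_exp_ℝ]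
  calc _ ≤ _ := norm_mul_le _ _
    _ ≤ Real.exp (∑ r, lam r) * Real.exp (- ∑ r, lam r) := by
      gcongr
      · exact (norm_exp_le' B).trans (Real.exp_le_exp.2 hBn)
      · rw [norm_algebraMap', Real.norm_of_nonneg (Real.exp_pos _).le]
    _ = 1 := by rw [← Real.exp_add]; simp

/-- exponential growth -/
def Gr (φ : (Fin d → ℕ) → ℝ) : Prop :=
  ∃ C c : ℝ, 0 ≤ C ∧ 1 ≤ c ∧ ∀ m, |φ m| ≤ C * c ^ (∑ i, m i)

theorem Gr.const (a : ℝ) : Gr (fun _ : Fin d → ℕ => a) :=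
  ⟨|a|, 1, abs_nonneg _, le_rfl, fun m => by simp⟩

theorem Gr.mul {φ ψ : (Fin d → ℕ) → ℝ} (h1 : Gr φ) (h2 : Gr ψ) : Gr (fun m => φ m * ψ m) := by
  obtain ⟨C, c, hC, hc, h⟩ := h1
  obtain ⟨C', c', hC', hc', h'⟩ := h2
  refine ⟨C * C', c * c', by positivity, one_le_mul_of_one_le_of_one_le hc hc', fun m => ?_⟩
  rw [abs_mul, mul_pow]
  calc |φ m| * |ψ m| ≤ (C * c ^ (∑ i, m i)) * (C' * c' ^ (∑ i, m i)) := by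
        gcongr
        · exact h m
        · exact h' m
    _ = _ := by ring

theorem Gr.add {φ ψ : (Fin d → ℕ) → ℝ} (h1 : Gr φ) (h2 : Gr ψ) : Gr (fun m => φ m + ψ m) := by
  obtain ⟨C, c, hC, hc, h⟩ := h1
  obtain ⟨C', c', hC', hc', h'⟩ := h2
  refine ⟨C + C', max c c', by positivity, le_max_of_le_left hc, fun m => ?_⟩
  refine (abs_add_le _ _).trans ?_
  rw [add_mul]
  gcongr
  · refine (h m).trans ?_
    gcongr
    exact le_max_left _ _
  · refine (h' m).trans ?_
    gcongr
    exact le_max_right _ _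

theorem Gr.sub {φ ψ : (Fin d → ℕ) → ℝ} (h1 : Gr φ) (h2 : Gr ψ) : Gr (fun m => φ m - ψ m) := by
  have := h1.add ((Gr.const (-1)).mul h2)
  simpa [sub_eq_add_neg] using this

theorem Gr.sum {ι : Type*} (s : Finset ι) {φ : ι → (Fin d → ℕ) → ℝ} (h : ∀ i ∈ s, Gr (φ i)) :
    Gr (fun m => ∑ i ∈ s, φ i m) := by
  induction s using Finset.induction_on with
  | empty => simpa using Gr.const (d := d) 0
  | insert a s ha ih =>
    simp only [Finset.sum_insert ha]
    exact (h a (by simp)).add (ih fun i hi => h i (by simp [hi]))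

theorem Gr.up {φ : (Fin d → ℕ) → ℝ} (h1 : Gr φ) (r : Fin d) : Gr (fun m => φ (m + sv r)) := by
  obtain ⟨C, c, hC, hc, h⟩ := h1
  refine ⟨C * c, c, by positivity, hc, fun m => (h _).trans (le_of_eq ?_)⟩
  have h3 : (∑ i, (m + sv r) i) = (∑ i, m i) + 1 := by
    simp [Finset.sum_add_distrib, sv_apply]
  rw [h3]; ring

theorem Gr.down {φ : (Fin d → ℕ) → ℝ} (h1 : Gr φ) (r : Fin d) : Gr (fun m => φ (m - sv r)) := by
  obtain ⟨C, c, hC, hc, h⟩ := h1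
  refine ⟨C, c, hC, hc, fun m => (h _).trans ?_⟩
  gcongr
  simp

theorem Gr.coord (r : Fin d) : Gr (fun m : Fin d → ℕ => (m r : ℝ)) := by
  refine ⟨1, 2, by norm_num, by norm_num, fun m => ?_⟩
  rw [one_mul, Nat.abs_cast]
  have h1 : m r ≤ ∑ i, m i := Finset.single_le_sum (fun i _ => Nat.zero_le _) (Finset.mem_univ r)
  have h2 : m r ≤ 2 ^ (∑ i, m i) := h1.trans (Nat.lt_two_pow_self).le
  exact_mod_cast h2

theorem Gr.summable {φ : (Fin d → ℕ) → ℝ} (h1 : Gr φ) (lam : Fin d → ℝ) (hl : ∀ r, 0 < lam r) :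
    Summable fun m => fn (Gp lam) m * φ m := by
  obtain ⟨C, c, hC, hc, h⟩ := h1
  have hs := (fn_summable (Gp (c • lam))).mul_left (C * (fn (Gp lam) 0 / fn (Gp (c • lam)) 0))
  refine Summable.of_norm_bounded hs fun m => ?_
  have h0 := G_zero lam
  have h0' := G_zero (c • lam)
  have hcl : ∀ r, 0 < (c • lam) r := fun r => by
    rw [Pi.smul_apply, smul_eq_mul]; exact mul_pos (by linarith) (hl r)
  have hsc := G_scale lam c m
  rw [abs_of_pos (G_pos _ hcl m), Real.norm_eq_abs, abs_mul, abs_of_pos (G_pos lam hl m)]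
  have : C * (fn (Gp lam) 0 / fn (Gp (c • lam)) 0) * fn (Gp (c • lam)) m =
      fn (Gp lam) m * (C * c ^ (∑ i, m i)) := by
    field_simp
    linear_combination C * hsc
  rw [this]
  exact mul_le_mul_of_nonneg_left (h m) (G_pos lam hl m).le

/-- expectation under Poisson -/
def EE (lam : Fin d → ℝ) (φ : (Fin d → ℕ) → ℝ) : ℝ := ∑' m, fn (Gp lam) m * φ m

/-- creation operator -/
def T (lam w : Fin d → ℝ) (φ : (Fin d → ℕ) → ℝ) (m : Fin d → ℕ) : ℝ :=
  ∑ r, w r * ((m r / lam r) * φ (m - sv r) - φ m)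

/-- difference operator -/
def D (w : Fin d → ℝ) (φ : (Fin d → ℕ) → ℝ) (m : Fin d → ℕ) : ℝ :=
  ∑ r, w r * (φ (m + sv r) - φ m)

/-- inner product -/
def ip (lam u w : Fin d → ℝ) : ℝ := ∑ r, u r * w r / lam r

theorem Gr.T1 {lam : Fin d → ℝ} {φ : (Fin d → ℕ) → ℝ} (h : Gr φ) (r : Fin d) :
    Gr (fun m => (m r / lam r) * φ (m - sv r)) := by
  have := ((Gr.coord r).mul (Gr.const (lam r)⁻¹)).mul (h.down r)
  simpa [div_eq_mul_inv] using this

theorem Gr.T {lam w : Fin d → ℝ} {φ : (Fin d → ℕ) → ℝ} (h : Gr φ) : Gr (T lam w φ) :=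
  Gr.sum _ fun r _ => (Gr.const (w r)).mul ((h.T1 r).sub h)

theorem EE_sum (lam : Fin d → ℝ) (hl : ∀ r, 0 < lam r) {ι : Type*} (s : Finset ι)
    (a : ι → ℝ) (φ : ι → (Fin d → ℕ) → ℝ) (h : ∀ i ∈ s, Gr (φ i)) :
    EE lam (fun m => ∑ i ∈ s, a i * φ i m) = ∑ i ∈ s, a i * EE lam (φ i) := by
  unfold EE
  simp only [← tsum_mul_left]
  rw [← Summable.tsum_finsetSum (fun i hi => ((h i hi).summable lam hl).mul_left _)]
  congr 1
  funext m
  rw [Finset.mul_sum]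
  refine Finset.sum_congr rfl fun i _ => by ring

theorem EE_sub (lam : Fin d → ℝ) (hl : ∀ r, 0 < lam r) {φ ψ : (Fin d → ℕ) → ℝ} (h : Gr φ)
    (h' : Gr ψ) : EE lam (fun m => φ m - ψ m) = EE lam φ - EE lam ψ := by
  unfold EE
  rw [← (h.summable lam hl).tsum_sub (h'.summable lam hl)]
  congr 1
  funext m
  ring

theorem EE_shift (lam : Fin d → ℝ) (hl : ∀ r, 0 < lam r) (φ ψ : (Fin d → ℕ) → ℝ) (r : Fin d) :
    EE lam (fun m => (m r / lam r) * φ (m - sv r) * ψ m) =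
      EE lam (fun m => φ m * ψ (m + sv r)) := by
  unfold EE
  have hinj : Function.Injective (fun m : Fin d → ℕ => m + sv r) := add_left_injective _
  rw [← hinj.tsum_eq]
  · congr 1
    funext m
    have h1 := rec_G_add lam r m
    have h2 := (hl r).ne'
    simp only [add_sub_sv]
    have h3 : ((m + sv r) r : ℝ) = m r + 1 := by simp [sv_same]
    rw [h3]
    field_simp
    linear_combination φ m * ψ (m + sv r) * h1
  · intro m hm
    have : m r ≠ 0 := by
      intro h
      apply hm
      simp [h]
    exact ⟨m - sv r, sub_add_sv this⟩

theorem EE_adj (lam : Fin d → ℝ) (hl : ∀ r, 0 < lam r) (w : Fin d → ℝ) {φ ψ : (Fin d → ℕ) → ℝ}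
    (h : Gr φ) (h' : Gr ψ) :
    EE lam (fun m => T lam w φ m * ψ m) = EE lam (fun m => φ m * D w ψ m) := by
  have e1 : (fun m => T lam w φ m * ψ m) =
      fun m => ∑ r, w r * ((m r / lam r) * φ (m - sv r) * ψ m - φ m * ψ m) := by
    funext m
    simp only [T, Finset.sum_mul]
    exact Finset.sum_congr rfl fun r _ => by ring
  have e2 : (fun m => φ m * D w ψ m) =
      fun m => ∑ r, w r * (φ m * ψ (m + sv r) - φ m * ψ m) := by
    funext m
    simp only [D, Finset.mul_sum]
    exact Finset.sum_congr rfl fun r _ => by ring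
  rw [e1, e2, EE_sum lam hl, EE_sum lam hl]
  · refine Finset.sum_congr rfl fun r _ => ?_
    rw [EE_sub lam hl ((h.T1 r).mul h') (h.mul h'), EE_sub lam hl (h.mul (h'.up r)) (h.mul h'),
      EE_shift lam hl]
  · exact fun r _ => (h.mul (h'.up r)).sub (h.mul h')
  · exact fun r _ => ((h.T1 r).mul h').sub (h.mul h')

theorem commutator (lam : Fin d → ℝ) (u w : Fin d → ℝ)
    (φ : (Fin d → ℕ) → ℝ) (m : Fin d → ℕ) :
    D u (T lam w φ) m = T lam w (D u φ) m + ip lam u w * φ m := by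
  have key : ∀ r s : Fin d, u r * (w s * (((m + sv r) s / lam s : ℝ) * φ (m + sv r - sv s)
        - φ (m + sv r))) - u r * (w s * ((m s / lam s) * φ (m - sv s) - φ m)) =
      w s * ((m s / lam s) * (u r * (φ (m - sv s + sv r) - φ (m - sv s))) -
        u r * (φ (m + sv r) - φ m)) + if s = r then u r * w s / lam s * φ m else 0 := by
    intro r s
    by_cases hs : s = r
    · subst hs
      rw [add_sub_sv, if_pos rfl]
      have h3 : ((m + sv s) s : ℝ) = m s + 1 := by simp [sv_same]
      rw [h3]
      by_cases h0 : m s = 0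
      · simp [h0]; ring
      · rw [sub_add_sv h0]; ring
    · rw [if_neg hs]
      have h3 : ((m + sv r) s : ℝ) = m s := by simp [sv_ne hs]
      rw [h3]
      by_cases h0 : m s = 0
      · simp [h0]; ring
      · have : m + sv r - sv s = m - sv s + sv r := by
          rw [tsub_add_eq_add_tsub (sv_le h0)]
        rw [this]; ring
  have e1 : D u (T lam w φ) m = ∑ r, ∑ s, (u r * (w s * (((m + sv r) s / lam s : ℝ) *
      φ (m + sv r - sv s) - φ (m + sv r))) - u r * (w s * ((m s / lam s) * φ (m - sv s) - φ m))) := by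
    simp only [D, T, mul_sub, Finset.mul_sum, Finset.sum_sub_distrib, Pi.add_apply]
  have e2 : T lam w (D u φ) m = ∑ r, ∑ s, w s * ((m s / lam s) *
      (u r * (φ (m - sv s + sv r) - φ (m - sv s))) - u r * (φ (m + sv r) - φ m)) := by
    rw [Finset.sum_comm]
    simp only [D, T, mul_sub, Finset.mul_sum, Finset.sum_sub_distrib]
  rw [e1, e2]
  simp only [key, Finset.sum_add_distrib, Finset.sum_ite_eq', Finset.mem_univ, if_true]
  rw [ip, Finset.sum_mul]

/-- Charlier polynomials -/
def P (lam : Fin d → ℝ) : List (Fin d → ℝ) → (Fin d → ℕ) → ℝ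
  | [] => fun _ => 1
  | w :: l => T lam w (P lam l)

theorem Gr_P (lam : Fin d → ℝ) (l) : Gr (P lam l) := by
  induction l with
  | nil => exact Gr.const 1
  | cons w l ih => exact ih.T

theorem T_sum (lam w : Fin d → ℝ) {ι : Type*} (s : Finset ι) (a : ι → ℝ)
    (φ : ι → (Fin d → ℕ) → ℝ) (m : Fin d → ℕ) :
    T lam w (fun m => ∑ i ∈ s, a i * φ i m) m = ∑ i ∈ s, a i * T lam w (φ i) m := by
  simp only [T, Finset.mul_sum]
  rw [Finset.sum_comm]
  refine Finset.sum_congr rfl fun r _ => ?_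
  rw [← Finset.sum_sub_distrib, Finset.mul_sum]
  exact Finset.sum_congr rfl fun i _ => by ring

theorem D_P (lam u : Fin d → ℝ) (l : List (Fin d → ℝ)) :
    D u (P lam l) =
      fun m => ∑ i ∈ Finset.range l.length, ip lam u (l.getD i 0) * P lam (l.eraseIdx i) m := by
  induction l with
  | nil => funext m; simp [D, P]
  | cons w l ih =>
    funext m
    rw [P, commutator, ih, T_sum, List.length_cons, Finset.sum_range_succ']
    simp [P]

/-- norm -/
def nrm (lam u : Fin d → ℝ) : ℝ := Real.sqrt (ip lam u u)

theorem ip_le (lam : Fin d → ℝ) (hl : ∀ r, 0 < lam r) (u w : Fin d → ℝ) :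
    |ip lam u w| ≤ nrm lam u * nrm lam w := by
  have hnn : ∀ v, 0 ≤ ip lam v v := fun v =>
    Finset.sum_nonneg fun r _ => div_nonneg (mul_self_nonneg _) (hl r).le
  unfold nrm
  rw [← Real.sqrt_mul (hnn u)]
  apply Real.abs_le_sqrt
  have := Finset.sum_mul_sq_le_sq_mul_sq Finset.univ (fun r => u r / Real.sqrt (lam r))
    (fun r => w r / Real.sqrt (lam r))
  unfold ip
  have hs : ∀ r, Real.sqrt (lam r) * Real.sqrt (lam r) = lam r := fun r =>
    Real.mul_self_sqrt (hl r).le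
  simpa only [div_pow, div_mul_div_comm, hs, pow_two] using this

theorem nrm_erase (lam : Fin d → ℝ) (l : List (Fin d → ℝ)) (i : ℕ) (hi : i < l.length) :
    nrm lam (l.getD i 0) * ((l.eraseIdx i).map (nrm lam)).prod = (l.map (nrm lam)).prod := by
  induction l generalizing i with
  | nil => simp at hi
  | cons w l ih =>
    cases i with
    | zero => simp
    | succ i =>
      simp only [List.length_cons, Nat.add_lt_add_iff_right] at hi
      have := ih i hi
      simp only [List.getD_cons_succ, List.eraseIdx_cons_succ, List.map_cons, List.prod_cons]
      rw [← this]; ring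

theorem nrm_nonneg (lam u : Fin d → ℝ) : 0 ≤ nrm lam u := Real.sqrt_nonneg _

theorem prod_nrm_nonneg (lam : Fin d → ℝ) (l : List (Fin d → ℝ)) :
    0 ≤ (l.map (nrm lam)).prod := by
  apply List.prod_nonneg
  intro a ha
  obtain ⟨u, _, rfl⟩ := List.mem_map.1 ha
  exact nrm_nonneg _ _

theorem EE_one (lam : Fin d → ℝ) (hl : ∀ r, 0 < lam r) :
    ∑' m, fn (Gp lam) m ≤ 1 := by
  have := norm_G lam (fun r => (hl r).le)
  rw [norm_eq] at this
  simpa only [abs_of_pos (G_pos lam hl _)] using this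

theorem gram (lam : Fin d → ℝ) (hl : ∀ r, 0 < lam r) (l l' : List (Fin d → ℝ))
    (hlen : l.length = l'.length) :
    |EE lam (fun m => P lam l m * P lam l' m)| ≤
      l.length.factorial * (l.map (nrm lam)).prod * (l'.map (nrm lam)).prod := by
  induction l generalizing l' with
  | nil =>
    have : l' = [] := List.length_eq_zero_iff.1 hlen.symm
    subst this
    simp only [P, EE, mul_one]
    rw [abs_of_nonneg (tsum_nonneg fun m => (G_pos lam hl m).le)]
    simpa using EE_one lam hl
  | cons w l ih =>
    simp only [P]
    rw [EE_adj lam hl w (Gr_P lam l) (Gr_P lam l'), D_P]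
    have e : (fun m => P lam l m * ∑ i ∈ Finset.range l'.length,
        ip lam w (l'.getD i 0) * P lam (l'.eraseIdx i) m) =
      fun m => ∑ i ∈ Finset.range l'.length,
        ip lam w (l'.getD i 0) * (P lam l m * P lam (l'.eraseIdx i) m) := by
      funext m
      rw [Finset.mul_sum]
      exact Finset.sum_congr rfl fun i _ => by ring
    rw [e, EE_sum lam hl _ _ _ (fun i _ => (Gr_P lam l).mul (Gr_P lam _))]
    refine (Finset.abs_sum_le_sum_abs _ _).trans ?_
    have hb : ∀ i ∈ Finset.range l'.length, |ip lam w (l'.getD i 0) *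
        EE lam (fun m => P lam l m * P lam (l'.eraseIdx i) m)| ≤
        l.length.factorial * (nrm lam w * (l.map (nrm lam)).prod) * (l'.map (nrm lam)).prod := by
      intro i hi
      have hi := Finset.mem_range.1 hi
      have h1 := ih (l'.eraseIdx i) (by
        rw [List.length_eraseIdx_of_lt hi, ← hlen]; simp)
      rw [abs_mul, ← nrm_erase lam l' i hi]
      calc _ ≤ (nrm lam w * nrm lam (l'.getD i 0)) * (l.length.factorial * (l.map (nrm lam)).prod *
            ((l'.eraseIdx i).map (nrm lam)).prod) :=
            mul_le_mul (ip_le lam hl _ _) h1 (abs_nonneg _)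
              (mul_nonneg (nrm_nonneg _ _) (nrm_nonneg _ _))
        _ = _ := by ring
    refine (Finset.sum_le_sum hb).trans (le_of_eq ?_)
    rw [Finset.sum_const, Finset.card_range, ← hlen, List.length_cons, List.map_cons,
      List.prod_cons, Nat.factorial_succ, nsmul_eq_mul]
    push_cast; ring

theorem fn_G_mul (lam : Fin d → ℝ) (hl : ∀ r, 0 < lam r) (l : List (Fin d → ℝ)) (m : Fin d → ℕ) :
    fn (Gp lam * (l.map W).prod) m = fn (Gp lam) m * P lam l m := by
  induction l generalizing m with
  | nil => simp [P]
  | cons w l ih =>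
    rw [List.map_cons, List.prod_cons, mul_left_comm, fn_W_mul, P, T, Finset.mul_sum]
    refine Finset.sum_congr rfl fun r _ => ?_
    rw [ih]
    have h := rec_G lam r m
    unfold sh at h ⊢
    have h2 := (hl r).ne'
    by_cases h0 : m r = 0
    · simp [h0]; ring
    · rw [if_neg h0] at h ⊢
      rw [ih]
      field_simp
      linear_combination (-w r * P lam l (m - sv r)) * h

theorem norm_G_mul (lam : Fin d → ℝ) (hl : ∀ r, 0 < lam r) (l : List (Fin d → ℝ)) :
    ‖Gp lam * (l.map W).prod‖ ≤ Real.sqrt l.length.factorial * (l.map (nrm lam)).prod := by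
  set K := Real.sqrt l.length.factorial * (l.map (nrm lam)).prod with hK
  have hK0 : 0 ≤ K := mul_nonneg (Real.sqrt_nonneg _) (prod_nrm_nonneg lam l)
  have hK2 : EE lam (fun m => P lam l m * P lam l m) ≤ K ^ 2 := by
    refine (le_abs_self _).trans ((gram lam hl l l rfl).trans (le_of_eq ?_))
    rw [hK, mul_pow, Real.sq_sqrt (by positivity)]
    ring
  refine le_of_forall_pos_le_add fun ε hε => ?_
  set t := K + ε with ht
  have ht0 : 0 < t := by linarith
  have hG1 : Summable fun m => fn (Gp lam) m := by
    simpa using (Gr.const (d := d) 1).summable lam hl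
  have hP2 := ((Gr_P lam l).mul (Gr_P lam l)).summable lam hl
  have hle : ‖Gp lam * (l.map W).prod‖ ≤ ∑' m, ((t / 2) * fn (Gp lam) m +
      (1 / (2 * t)) * (fn (Gp lam) m * (P lam l m * P lam l m))) := by
    rw [norm_eq]
    refine (fn_summable _).tsum_le_tsum (fun m => ?_) ((hG1.mul_left _).add (hP2.mul_left _))
    rw [fn_G_mul lam hl, abs_mul, abs_of_pos (G_pos lam hl m)]
    have : |P lam l m| ≤ t / 2 + (1 / (2 * t)) * (P lam l m * P lam l m) := by
      rw [← abs_mul_abs_self (P lam l m)]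
      have h1 : 0 ≤ (t - |P lam l m|) ^ 2 / (2 * t) := by positivity
      have h2 : (t - |P lam l m|) ^ 2 / (2 * t) = t / 2 + (1 / (2 * t)) *
        (|P lam l m| * |P lam l m|) - |P lam l m| := by field_simp; ring
      linarith
    calc _ ≤ fn (Gp lam) m * (t / 2 + (1 / (2 * t)) * (P lam l m * P lam l m)) :=
          mul_le_mul_of_nonneg_left this (G_pos lam hl m).le
      _ = _ := by ring
  rw [(hG1.mul_left _).tsum_add (hP2.mul_left _), tsum_mul_left, tsum_mul_left] at hle
  refine hle.trans ?_
  have h1 : t / 2 * ∑' m, fn (Gp lam) m ≤ t / 2 * 1 := by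
    gcongr; exact EE_one lam hl
  have h2 : 1 / (2 * t) * ∑' m, fn (Gp lam) m * (P lam l m * P lam l m) ≤
      1 / (2 * t) * t ^ 2 := by
    gcongr
    refine hK2.trans ?_
    gcongr
    linarith
  have h3 : 1 / (2 * t) * t ^ 2 = t / 2 := by field_simp
  linarith


theorem fact_aux (t : ℕ) : 2 * (2 * (t + 1)).factorial ≤ 4 ^ (t + 1) * (t + 1).factorial ^ 2 := by
  induction t with
  | zero => decide
  | succ t ih =>
    have h1 : (2 * (t + 1 + 1)).factorial =
        (2 * (t + 1) + 2) * ((2 * (t + 1) + 1) * (2 * (t + 1)).factorial) := by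
      rw [← Nat.factorial_succ, ← Nat.factorial_succ]
      rfl
    have h2 : (t + 1 + 1).factorial = (t + 2) * (t + 1).factorial := Nat.factorial_succ _
    rw [h1, h2]
    calc 2 * ((2 * (t + 1) + 2) * ((2 * (t + 1) + 1) * (2 * (t + 1)).factorial))
        = ((2 * (t + 1) + 2) * (2 * (t + 1) + 1)) * (2 * (2 * (t + 1)).factorial) := by ring
      _ ≤ (4 * (t + 2) ^ 2) * (4 ^ (t + 1) * (t + 1).factorial ^ 2) :=
          Nat.mul_le_mul (by nlinarith) ih
      _ = _ := by ring

theorem fact_le (t k : ℕ) (htk : t ≤ k) (hk : 1 ≤ k) :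
    2 * (2 * t).factorial ≤ 2 ^ t * 2 ^ k * k.factorial ^ 2 := by
  rcases t with _ | t
  · have h1 : 2 ^ 1 ≤ 2 ^ k := Nat.pow_le_pow_right (by norm_num) hk
    have h2 : 1 ≤ k.factorial ^ 2 := Nat.one_le_pow _ _ (Nat.factorial_pos k)
    simpa using Nat.mul_le_mul h1 h2
  · refine (fact_aux t).trans ?_
    have h1 : 2 ^ (t + 1) ≤ 2 ^ k := Nat.pow_le_pow_right (by norm_num) htk
    have h2 : (t + 1).factorial ^ 2 ≤ k.factorial ^ 2 :=
      Nat.pow_le_pow_left (Nat.factorial_le htk) 2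
    have h3 : 4 ^ (t + 1) = 2 ^ (t + 1) * 2 ^ (t + 1) := by
      rw [← mul_pow]; norm_num
    rw [h3]
    gcongr

/-- constants -/
def ck (k : ℕ) : ℝ := k.factorial * Real.sqrt 2 ^ k / Real.sqrt 2

theorem sqrt_fact_le (t k : ℕ) (htk : t ≤ k) (hk : 1 ≤ k) :
    Real.sqrt (2 * t).factorial ≤ ck k * Real.sqrt 2 ^ t := by
  have h := fact_le t k htk hk
  have h' : 2 * ((2 * t).factorial : ℝ) ≤ 2 ^ t * 2 ^ k * (k.factorial : ℝ) ^ 2 := by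
    exact_mod_cast h
  have h2 : (Real.sqrt 2) ^ 2 = 2 := Real.sq_sqrt (by norm_num)
  apply Real.sqrt_le_iff.2
  refine ⟨by unfold ck; positivity, ?_⟩
  have : (ck k * Real.sqrt 2 ^ t) ^ 2 = 2 ^ t * 2 ^ k * (k.factorial : ℝ) ^ 2 / 2 := by
    unfold ck
    rw [mul_pow, div_pow, mul_pow, ← pow_mul, ← pow_mul, mul_comm k 2, mul_comm t 2, pow_mul,
      pow_mul, h2]
    ring
  rw [this]
  linarith

theorem norm_G_prod_sq (lam : Fin d → ℝ) (hl : ∀ r, 0 < lam r) {ι : Type*} (S : Finset ι)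
    (u : ι → Fin d → ℝ) :
    ‖Gp lam * ∏ i ∈ S, W (u i) ^ 2‖ ≤
      Real.sqrt (2 * S.card).factorial * ∏ i ∈ S, ip lam (u i) (u i) := by
  have hnn : ∀ v, 0 ≤ ip lam v v := fun v =>
    Finset.sum_nonneg fun r _ => div_nonneg (mul_self_nonneg _) (hl r).le
  have h := norm_G_mul lam hl (S.toList.map u ++ S.toList.map u)
  have e1 : ((S.toList.map u ++ S.toList.map u).map W).prod = ∏ i ∈ S, W (u i) ^ 2 := by
    rw [List.map_append, List.prod_append, List.map_map, Finset.prod_map_toList,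
      ← Finset.prod_mul_distrib]
    exact Finset.prod_congr rfl fun i _ => by simp [pow_two]
  have e2 : ((S.toList.map u ++ S.toList.map u).map (nrm lam)).prod =
      ∏ i ∈ S, ip lam (u i) (u i) := by
    rw [List.map_append, List.prod_append, List.map_map, Finset.prod_map_toList,
      ← Finset.prod_mul_distrib]
    exact Finset.prod_congr rfl fun i _ => by
      simp only [Function.comp, nrm]; exact Real.mul_self_sqrt (hnn _)
  have e3 : (S.toList.map u ++ S.toList.map u).length = 2 * S.card := by
    simp; ring
  rw [e1, e2, e3] at h
  exact h

theorem W_add (u v : Fin d → ℝ) : W (u + v) = W u + W v := by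
  simp only [W, Pi.add_apply, add_smul, Finset.sum_add_distrib]

theorem norm_W (v : Fin d → ℝ) (hv : ∀ r, 0 ≤ v r) : ‖W v‖ ≤ 2 * ∑ r, v r := by
  rw [Finset.mul_sum]
  refine (norm_sum_le _ _).trans (Finset.sum_le_sum fun r _ => ?_)
  rw [norm_smul, Real.norm_of_nonneg (hv r), mul_comm]
  refine mul_le_mul_of_nonneg_right ((norm_sub_le _ _).trans ?_) (hv r)
  rw [norm_dl, norm_one]; norm_num

/-- the quantities bounding the squares -/
def be (lam q : Fin d → ℝ) : ℝ := ∑ r, q r * min (Real.sqrt 2 * q r / lam r) 8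

theorem norm_G_prod (lam : Fin d → ℝ) (hl : ∀ r, 0 < lam r) {ι : Type*} (S : Finset ι)
    (hS : S.Nonempty) (q : ι → Fin d → ℝ) (hq : ∀ i r, 0 ≤ q i r) (hq1 : ∀ i, ∑ r, q i r = 1) :
    ‖Gp lam * ∏ i ∈ S, W (q i) ^ 2‖ ≤ ck S.card * ∏ i ∈ S, be lam (q i) := by
  set u : ι → Fin d → ℝ := fun i r => if Real.sqrt 2 * q i r / lam r ≤ 8 then q i r else 0 with hu
  set v : ι → Fin d → ℝ := fun i r => if Real.sqrt 2 * q i r / lam r ≤ 8 then 0 else q i r with hv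
  have huv : ∀ i, q i = u i + v i := by
    intro i; funext r
    simp only [hu, hv, Pi.add_apply]
    split_ifs <;> simp
  have hu0 : ∀ i r, 0 ≤ u i r := by
    intro i r; simp only [hu]; split_ifs
    · exact hq i r
    · exact le_rfl
  have hv0 : ∀ i r, 0 ≤ v i r := by
    intro i r; simp only [hv]; split_ifs
    · exact le_rfl
    · exact hq i r
  have hnn : ∀ w, 0 ≤ ip lam w w := fun w =>
    Finset.sum_nonneg fun r _ => div_nonneg (mul_self_nonneg _) (hl r).le
  have hbe : ∀ i, be lam (q i) = Real.sqrt 2 * ip lam (u i) (u i) + 8 * ∑ r, v i r := by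
    intro i
    unfold be ip
    rw [Finset.mul_sum, Finset.mul_sum, ← Finset.sum_add_distrib]
    refine Finset.sum_congr rfl fun r _ => ?_
    simp only [hu, hv]
    split_ifs with h
    · rw [min_eq_left h]; ring
    · rw [min_eq_right (not_le.1 h).le]; ring
  have hY : ∀ i, ‖W (v i) * (2 * W (u i) + W (v i))‖ ≤ 8 * ∑ r, v i r := by
    intro i
    have hs : ∑ r, u i r + ∑ r, v i r = 1 := by
      rw [← Finset.sum_add_distrib, ← hq1 i, huv i]; rfl
    have h0 : 0 ≤ ∑ r, v i r := Finset.sum_nonneg fun r _ => hv0 i r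
    have h1 := norm_W (u i) (hu0 i)
    have h2 := norm_W (v i) (hv0 i)
    have h3 : ‖2 * W (u i) + W (v i)‖ ≤ 4 := by
      rw [two_mul]
      have h4 := norm_add_le (W (u i) + W (u i)) (W (v i))
      have h5 := norm_add_le (W (u i)) (W (u i))
      linarith
    calc _ ≤ ‖W (v i)‖ * ‖2 * W (u i) + W (v i)‖ := norm_mul_le _ _
      _ ≤ (2 * ∑ r, v i r) * 4 := mul_le_mul h2 h3 (norm_nonneg _) (by linarith)
      _ = _ := by ring
  have hexp : ∀ i, W (q i) ^ 2 = W (u i) ^ 2 + W (v i) * (2 * W (u i) + W (v i)) := by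
    intro i
    rw [huv i, W_add]; ring
  simp only [hexp, hbe]
  rw [Finset.prod_add, Finset.prod_add, Finset.mul_sum, Finset.mul_sum]
  refine (norm_sum_le _ _).trans (Finset.sum_le_sum fun A hA => ?_)
  have hA := Finset.mem_powerset.1 hA
  rw [← mul_assoc]
  have hB : ‖∏ i ∈ S \ A, W (v i) * (2 * W (u i) + W (v i))‖ ≤ ∏ i ∈ S \ A, 8 * ∑ r, v i r :=
    (Finset.norm_prod_le _ _).trans
      (Finset.prod_le_prod (fun _ _ => norm_nonneg _) fun i _ => hY i)
  have hp0 : 0 ≤ ∏ i ∈ A, ip lam (u i) (u i) := Finset.prod_nonneg fun i _ => hnn _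
  have hX : ‖Gp lam * ∏ i ∈ A, W (u i) ^ 2‖ ≤
      ck S.card * ∏ i ∈ A, Real.sqrt 2 * ip lam (u i) (u i) := by
    refine (norm_G_prod_sq lam hl A u).trans ?_
    rw [Finset.prod_mul_distrib, Finset.prod_const, ← mul_assoc]
    exact mul_le_mul_of_nonneg_right
      (sqrt_fact_le _ _ (Finset.card_le_card hA) (Finset.card_pos.2 hS)) hp0
  rw [← mul_assoc]
  refine (norm_mul_le _ _).trans (mul_le_mul hX hB (norm_nonneg _) ?_)
  exact (norm_nonneg _).trans hX

theorem gsum_summable (b : ℝ) (hb : 0 ≤ b) :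
    Summable fun m : ℕ => 2 * (m + 1) * b ^ m / ((m + 2).factorial : ℝ) := by
  refine Summable.of_nonneg_of_le (fun m => by positivity) (fun m => ?_)
    ((Real.summable_pow_div_factorial b).mul_left 2)
  have h1 : ((m + 2).factorial : ℝ) = (m + 2) * ((m + 1) * m.factorial) := by
    rw [Nat.factorial_succ, Nat.factorial_succ]; push_cast; ring
  rw [h1]
  have hf : (0 : ℝ) < m.factorial := by exact_mod_cast Nat.factorial_pos m
  have hm : (0 : ℝ) ≤ m := Nat.cast_nonneg m
  have h2 : 2 * (m + 1) * b ^ m / (((m : ℝ) + 2) * ((m + 1) * m.factorial)) =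
      (2 * (b ^ m / m.factorial)) * (1 / (m + 2)) := by
    field_simp
  rw [h2]
  refine mul_le_of_le_one_right (by positivity) ?_
  rw [div_le_one (by positivity)]
  linarith

theorem exists_gamma (y : L1 d) (b : ℝ) (hy : ‖y‖ ≤ b) :
    ∃ Γ : L1 d, (1 - y) * NormedSpace.exp y = 1 - (1 / 2 : ℝ) • (y ^ 2 * Γ) ∧ ‖Γ‖ ≤ gfun b := by
  have hb : 0 ≤ b := (norm_nonneg y).trans hy
  have hg := gsum_summable b hb
  have hbd : ∀ m : ℕ, ‖(2 * (m + 1) / ((m + 2).factorial : ℝ)) • y ^ m‖ ≤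
      2 * (m + 1) * b ^ m / ((m + 2).factorial : ℝ) := by
    intro m
    have e : 2 * (m + 1) * b ^ m / ((m + 2).factorial : ℝ) =
        2 * (m + 1) / ((m + 2).factorial : ℝ) * b ^ m := by ring
    rw [norm_smul, Real.norm_of_nonneg (by positivity), e]
    exact mul_le_mul_of_nonneg_left
      ((norm_pow_le y m).trans (pow_le_pow_left₀ (norm_nonneg y) hy m)) (by positivity)
  have hs : Summable fun m : ℕ => (2 * (m + 1) / ((m + 2).factorial : ℝ)) • y ^ m :=
    Summable.of_norm_bounded hg hbd
  refine ⟨∑' m : ℕ, (2 * (m + 1) / ((m + 2).factorial : ℝ)) • y ^ m, ?_,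
    tsum_of_norm_bounded hg.hasSum hbd⟩
  have h1 := ((hs.hasSum.mul_left (y ^ 2)).const_smul (1 / 2 : ℝ))
  have h2 := (hasSum_nat_add_iff' 2).2 (hasSum_exp y)
  have h3 := ((hasSum_nat_add_iff' 1).2 (hasSum_exp y)).mul_left y
  have h4 := h3.sub h2
  have h5 := h1.unique (h4.congr_fun ?_)
  · rw [h5]
    simp [Finset.sum_range_succ]
    ring
  · intro m
    rw [mul_smul_comm, mul_smul_comm, smul_smul, ← pow_add, ← pow_succ', add_comm 2 m,
      ← sub_smul, Nat.factorial_succ (m + 1), Nat.factorial_succ m]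
    congr 1
    have hf : (m.factorial : ℝ) ≠ 0 := by exact_mod_cast Nat.factorial_ne_zero m
    push_cast
    field_simp
    ring

theorem esymm_le {ι : Type*} (s : Finset ι) (x : ι → ℝ) (hx : ∀ i, 0 ≤ x i) (k : ℕ) :
    (k.factorial : ℝ) * ∑ S ∈ s.powersetCard k, ∏ i ∈ S, x i ≤ (∑ i ∈ s, x i) ^ k := by
  induction s using Finset.induction_on generalizing k with
  | empty =>
    cases k with
    | zero => simp
    | succ k =>
      rw [Finset.powersetCard_eq_empty.2 (by simp)]
      simp
  | insert a s ha ih =>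
    cases k with
    | zero => simp
    | succ k =>
      rw [Finset.powersetCard_succ_insert ha, Finset.sum_union, Finset.sum_image, mul_add,
        Finset.sum_insert ha]
      · have e : ∑ S ∈ s.powersetCard k, ∏ i ∈ insert a S, x i =
            x a * ∑ S ∈ s.powersetCard k, ∏ i ∈ S, x i := by
          rw [Finset.mul_sum]
          refine Finset.sum_congr rfl fun S hS => ?_
          rw [Finset.prod_insert]
          exact fun h => ha ((Finset.mem_powersetCard.1 hS).1 h)
        rw [e]
        have h1 := ih (k + 1)
        have h2 := ih k
        set X := ∑ i ∈ s, x i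
        have hX : 0 ≤ X := Finset.sum_nonneg fun i _ => hx i
        have h3 : X ^ (k + 1) + (k + 1) * x a * X ^ k ≤ (x a + X) ^ (k + 1) := by
          have hxa := hx a
          clear h1 h2 e ih
          induction k with
          | zero => simp; linarith
          | succ k ih =>
            have := mul_le_mul_of_nonneg_right ih (add_nonneg hxa hX)
            rw [← pow_succ] at this
            refine le_trans ?_ this
            have h0 : 0 ≤ (k + 1) * x a * x a * X ^ k := by positivity
            push_cast
            ring_nf at h0 ⊢
            linarith
        have h4 := mul_le_mul_of_nonneg_left h2
          (show 0 ≤ ((k : ℝ) + 1) * x a from mul_nonneg (by positivity) (hx a))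
        have h5 : (((k + 1).factorial : ℕ) : ℝ) = (k + 1) * k.factorial := by
          rw [Nat.factorial_succ]; push_cast; ring
        rw [h5] at h1 ⊢
        linarith
      · intro S hS T hT hST
        have h1 : a ∉ S := fun h => ha ((Finset.mem_powersetCard.1 hS).1 h)
        have h2 : a ∉ T := fun h => ha ((Finset.mem_powersetCard.1 hT).1 h)
        rw [← Finset.erase_insert h1, ← Finset.erase_insert h2, hST]
      · rw [Finset.disjoint_left]
        intro S hS hS'
        obtain ⟨T, _, rfl⟩ := Finset.mem_image.1 hS'
        exact ha ((Finset.mem_powersetCard.1 hS).1 (Finset.mem_insert_self a T))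

theorem sum_bound {ι : Type*} (s : Finset ι) (x : ι → ℝ) (hx : ∀ i, 0 ≤ x i) (z : ℝ)
    (hz : z = Real.sqrt 2 * ∑ i ∈ s, x i) (hz1 : z < 1) :
    ∑ S ∈ s.powerset, ck S.card * ∏ i ∈ S, x i ≤ (1 / Real.sqrt 2) * (1 / (1 - z)) := by
  have hz0 : 0 ≤ z := by
    rw [hz]; exact mul_nonneg (Real.sqrt_nonneg _) (Finset.sum_nonneg fun i _ => hx i)
  rw [Finset.sum_powerset]
  have h1 : ∀ k ∈ Finset.range (s.card + 1), ∑ S ∈ s.powersetCard k, ck S.card * ∏ i ∈ S, x i ≤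
      (1 / Real.sqrt 2) * z ^ k := by
    intro k _
    have : ∑ S ∈ s.powersetCard k, ck S.card * ∏ i ∈ S, x i =
        ck k * ∑ S ∈ s.powersetCard k, ∏ i ∈ S, x i := by
      rw [Finset.mul_sum]
      refine Finset.sum_congr rfl fun S hS => ?_
      rw [(Finset.mem_powersetCard.1 hS).2]
    rw [this]
    have h2 := mul_le_mul_of_nonneg_left (esymm_le s x hx k)
      (show 0 ≤ Real.sqrt 2 ^ k / Real.sqrt 2 by positivity)
    calc _ = Real.sqrt 2 ^ k / Real.sqrt 2 * (k.factorial * ∑ S ∈ s.powersetCard k, ∏ i ∈ S, x i) := by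
          unfold ck; ring
      _ ≤ _ := h2
      _ = _ := by rw [hz, mul_pow]; ring
  refine (Finset.sum_le_sum h1).trans ?_
  rw [← Finset.mul_sum]
  gcongr
  rw [one_div, ← tsum_geometric_of_lt_one hz0 hz1]
  exact (summable_geometric_of_lt_one hz0 hz1).sum_le_tsum _ (fun _ _ => by positivity)

theorem main_bound {n : ℕ} (lam : Fin d → ℝ) (hl : ∀ r, 0 < lam r) (p : Fin n → ℝ)
    (q : Fin n → Fin d → ℝ) (hp : ∀ j, 0 ≤ p j) (hq : ∀ j r, 0 ≤ q j r)
    (hq1 : ∀ j, ∑ r, q j r = 1) (hlam : ∀ r, lam r = ∑ j, p j * q j r) (z : ℝ)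
    (hz : z = Real.sqrt 2 * ∑ j, p j ^ 2 / 2 * gfun (2 * p j) * be lam (q j)) (hz1 : z < 1) :
    ‖(∏ j, (1 + p j • W (q j))) - Gp lam‖ ≤ (1 / Real.sqrt 2) * (1 / (1 - z)) - 1 / Real.sqrt 2 := by
  have hR : ∀ j, ‖W (q j)‖ ≤ 2 := fun j => by
    have := norm_W (q j) (hq j); rwa [hq1 j, mul_one] at this
  have hy : ∀ j, ‖-(p j • W (q j))‖ ≤ 2 * p j := fun j => by
    rw [norm_neg, norm_smul, Real.norm_of_nonneg (hp j), mul_comm]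
    exact mul_le_mul_of_nonneg_right (hR j) (hp j)
  choose Γ hΓ hΓn using fun j => exists_gamma _ _ (hy j)
  have hWl : W lam = ∑ j, p j • W (q j) := by
    simp only [W, hlam, Finset.sum_smul, Finset.smul_sum, smul_smul]
    rw [Finset.sum_comm]
  have hG : Gp lam = ∏ j, NormedSpace.exp (p j • W (q j)) := by
    unfold Gp
    rw [hWl, NormedSpace.exp_sum]
  set M : Fin n → L1 d := fun j => (-(p j ^ 2 / 2)) • (W (q j) ^ 2 * Γ j) with hM
  have hF : ∏ j, (1 + p j • W (q j)) = Gp lam * ∏ j, (1 + M j) := by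
    rw [hG, ← Finset.prod_mul_distrib]
    refine Finset.prod_congr rfl fun j _ => ?_
    have h1 := hΓ j
    have h2 : NormedSpace.exp (p j • W (q j)) * NormedSpace.exp (-(p j • W (q j))) = 1 := by
      rw [← NormedSpace.exp_add, add_neg_cancel, NormedSpace.exp_zero]
    have h3 : 1 + M j = (1 - -(p j • W (q j))) * NormedSpace.exp (-(p j • W (q j))) := by
      rw [h1, hM]
      simp only
      rw [neg_sq, smul_pow, smul_mul_assoc, smul_smul, neg_smul, ← sub_eq_add_neg]
      congr 2
      ring
    rw [h3]
    linear_combination (-(1 + p j • W (q j))) * h2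
  have hgn : ∀ j, 0 ≤ gfun (2 * p j) := fun j => (norm_nonneg _).trans (hΓn j)
  have hben : ∀ j, 0 ≤ be lam (q j) := fun j => Finset.sum_nonneg fun r _ =>
    mul_nonneg (hq j r) (le_min (div_nonneg (mul_nonneg (Real.sqrt_nonneg _) (hq j r)) (hl r).le)
      (by norm_num))
  set x : Fin n → ℝ := fun j => p j ^ 2 / 2 * gfun (2 * p j) * be lam (q j) with hx
  have hx0 : ∀ j, 0 ≤ x j := fun j => by
    have := hgn j; have := hben j; positivity
  have hterm : ∀ S ∈ (Finset.univ : Finset (Fin n)).powerset.erase ∅,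
      ‖Gp lam * ∏ j ∈ S, M j‖ ≤ ck S.card * ∏ j ∈ S, x j := by
    intro S hS
    have hne : S.Nonempty := Finset.nonempty_iff_ne_empty.2 (Finset.mem_erase.1 hS).1
    have e : Gp lam * ∏ j ∈ S, M j = (∏ j ∈ S, (-(p j ^ 2 / 2))) •
        ((Gp lam * ∏ j ∈ S, W (q j) ^ 2) * ∏ j ∈ S, Γ j) := by
      simp only [hM]
      rw [Finset.prod_smul, Finset.prod_mul_distrib, mul_smul_comm, mul_assoc]
    rw [e, norm_smul]
    have h1 : ‖∏ j ∈ S, (-(p j ^ 2 / 2))‖ = ∏ j ∈ S, p j ^ 2 / 2 := by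
      rw [norm_prod]
      refine Finset.prod_congr rfl fun j _ => ?_
      rw [norm_neg, Real.norm_of_nonneg (by positivity)]
    have h2 : ‖∏ j ∈ S, Γ j‖ ≤ ∏ j ∈ S, gfun (2 * p j) :=
      (Finset.norm_prod_le _ _).trans
        (Finset.prod_le_prod (fun _ _ => norm_nonneg _) fun i _ => hΓn i)
    have h3 := norm_G_prod lam hl S hne q hq hq1
    rw [h1]
    have h4 : ‖(Gp lam * ∏ j ∈ S, W (q j) ^ 2) * ∏ j ∈ S, Γ j‖ ≤
        (ck S.card * ∏ i ∈ S, be lam (q i)) * ∏ j ∈ S, gfun (2 * p j) :=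
      (norm_mul_le _ _).trans (mul_le_mul h3 h2 (norm_nonneg _) ((norm_nonneg _).trans h3))
    refine (mul_le_mul_of_nonneg_left h4 (Finset.prod_nonneg fun j _ => by positivity)).trans
      (le_of_eq ?_)
    simp only [hx]
    rw [Finset.prod_mul_distrib, Finset.prod_mul_distrib]
    ring
  have hsum := sum_bound Finset.univ x hx0 z hz hz1
  rw [← Finset.add_sum_erase _ _ (Finset.empty_mem_powerset _)] at hsum
  have hc0 : ck (∅ : Finset (Fin n)).card * ∏ i ∈ (∅ : Finset (Fin n)), x i = 1 / Real.sqrt 2 := by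
    simp [ck]
  rw [hc0] at hsum
  have hdiff : (∏ j, (1 + p j • W (q j))) - Gp lam =
      ∑ S ∈ (Finset.univ : Finset (Fin n)).powerset.erase ∅, Gp lam * ∏ j ∈ S, M j := by
    rw [hF, Finset.prod_one_add, ← Finset.add_sum_erase _ _ (Finset.empty_mem_powerset _),
      Finset.prod_empty, mul_add, mul_one, add_sub_cancel_left, Finset.mul_sum]
  rw [hdiff]
  refine (norm_sum_le _ _).trans ((Finset.sum_le_sum hterm).trans ?_)
  linarith

end PaperAux

open PaperL1

/-- Theorem 1 (first part) of Roos, "Refined total variation bounds in the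
multivariate and compound Poisson approximation": if
`α₁ = Σ_j g(2p_j) p_j² Σ_r q_{j,r} min{q_{j,r}/(2^{3/2} λ_r), 2} < 2^{-3/2}`,
then `‖F - G‖ ≤ 2α₁/(1 - 2^{3/2} α₁)` where `F` is the generalized multinomial
distribution and `G` the multivariate Poisson distribution in ℓ¹(ℕ^d). -/
theorem multinomial_poisson_tv_bound_alpha
    (d n : ℕ) (hd : 1 ≤ d) (hn : 1 ≤ n)
    (p : Fin n → ℝ) (q : Fin n → Fin d → ℝ)
    (hp : ∀ j, p j ∈ Set.Icc (0:ℝ) 1)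
    (hq : ∀ j r, q j r ∈ Set.Icc (0:ℝ) 1)
    (hq1 : ∀ j, ∑ r, q j r = 1)
    (lam : Fin d → ℝ) (hlam : ∀ r, lam r = ∑ j, p j * q j r)
    (hlampos : ∀ r, 0 < lam r)
    (e : Fin d → (Fin d → ℕ)) (he : ∀ r, e r = fun i => if i = r then 1 else 0)
    (Q : Fin n → ((Fin d → ℕ) → ℝ)) (hQ : ∀ j, Q j = ∑ r, q j r • delta (e r))
    (F : (Fin d → ℕ) → ℝ)
    (hF : F = convProd Finset.univ (fun j => delta 0 + p j • (Q j - delta 0)))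
    (G : (Fin d → ℕ) → ℝ)
    (hG : G = convExp (∑ r, lam r • (delta (e r) - delta 0)))
    (α₁ : ℝ)
    (hα₁ : α₁ = ∑ j, gfun (2 * p j) * (p j) ^ 2 *
      ∑ r, q j r * min (q j r / ((2:ℝ) ^ ((3:ℝ)/2) * lam r)) 2)
    (hsmall : α₁ < (2:ℝ) ^ (-(3:ℝ)/2)) :
    l1norm (F - G) ≤ 2 * α₁ / (1 - (2:ℝ) ^ ((3:ℝ)/2) * α₁) := by
  have he' : ∀ r, e r = PaperAux.sv r := by
    intro r
    rw [he]
    funext i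
    rw [PaperAux.sv_apply]
  have h2 : (Real.sqrt 2) ^ 2 = 2 := Real.sq_sqrt (by norm_num)
  have hs0 : 0 < Real.sqrt 2 := by positivity
  have hrho : (2:ℝ) ^ ((3:ℝ)/2) = 2 * Real.sqrt 2 := by
    rw [Real.sqrt_eq_rpow, show (3:ℝ)/2 = 1 + 1/2 by norm_num, Real.rpow_add (by norm_num),
      Real.rpow_one]
  have hrho' : (2:ℝ) ^ (-(3:ℝ)/2) = (2 * Real.sqrt 2)⁻¹ := by
    rw [← hrho, ← Real.rpow_neg (by norm_num)]
    congr 1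
    norm_num
  rw [hrho] at hα₁ ⊢
  rw [hrho'] at hsmall
  have hz1 : 2 * Real.sqrt 2 * α₁ < 1 := by
    have := mul_lt_mul_of_pos_left hsmall (show 0 < 2 * Real.sqrt 2 by positivity)
    rwa [mul_inv_cancel₀ (by positivity)] at this
  have hbe : ∀ j, PaperAux.be lam (q j) =
      4 * ∑ r, q j r * min (q j r / (2 * Real.sqrt 2 * lam r)) 2 := by
    intro j
    unfold PaperAux.be
    rw [Finset.mul_sum]
    refine Finset.sum_congr rfl fun r _ => ?_
    rw [mul_left_comm, mul_min_of_nonneg _ _ (by norm_num : (0:ℝ) ≤ 4)]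
    have hr := (hlampos r).ne'
    congr 2
    · field_simp
      rw [h2]; ring
    · norm_num
  have hz : 2 * Real.sqrt 2 * α₁ =
      Real.sqrt 2 * ∑ j, p j ^ 2 / 2 * gfun (2 * p j) * PaperAux.be lam (q j) := by
    rw [hα₁, Finset.mul_sum, Finset.mul_sum]
    refine Finset.sum_congr rfl fun j _ => ?_
    rw [hbe]; ring
  have hmain := PaperAux.main_bound lam hlampos p q (fun j => (hp j).1) (fun j r => (hq j r).1)
    hq1 hlam _ hz hz1
  have hFe : F = PaperAux.fn (∏ j, (1 + p j • PaperAux.W (q j))) := by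
    rw [PaperAux.fn_prod, hF]
    congr 1
    funext j
    rw [PaperAux.fn_add, PaperAux.fn_smul, PaperAux.fn_one, hQ]
    congr 2
    unfold PaperAux.W
    rw [PaperAux.fn_sum]
    simp only [PaperAux.fn_smul, PaperAux.fn_sub, PaperAux.fn_dl, PaperAux.fn_one, smul_sub,
      Finset.sum_sub_distrib, ← Finset.sum_smul, hq1 j, one_smul, he']
  have hGe : G = PaperAux.fn (PaperAux.Gp lam) := by
    unfold PaperAux.Gp
    rw [PaperAux.fn_exp, hG]
    congr 1
    unfold PaperAux.W
    rw [PaperAux.fn_sum]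
    simp only [PaperAux.fn_smul, PaperAux.fn_sub, PaperAux.fn_dl, PaperAux.fn_one, he']
  rw [hFe, hGe, ← PaperAux.fn_sub, PaperAux.l1norm_eq]
  refine hmain.trans (le_of_eq ?_)
  have hne : 1 - 2 * Real.sqrt 2 * α₁ ≠ 0 := by linarith
  have h1 : 1 / Real.sqrt 2 * (2 * Real.sqrt 2 * α₁) = 2 * α₁ := by field_simp
  rw [eq_div_iff hne, sub_mul, mul_assoc, one_div_mul_cancel hne, mul_sub, h1]
  ring
end
end

section
/- Let d, n ≥ 1 be integers. For j ∈ {1,…,n} and r ∈ {1,…,d}, let p_j, q_{j,r} ∈ [0,1] satisfy Σ_{r=1}^d q_{j,r} = 1 and λ_r := Σ_{j=1}^n p_j q_{j,r} > 0. In ℓ¹(ℕ^d), let F = ∏_{j=1}^n (δ₀ + p_j(Q_j − δ₀)) with Q_j = Σ_{r=1}^d q_{j,r} δ_{e_r}, and let G = exp(Σ_{r=1}^d λ_r(δ_{e_r} − δ₀)). Set β₁ = Σ_{j=1}^n p_j² Σ_{r=1}^d q_{j,r} · min{ q_{j,r}/λ_r, 1 }. Then, without any further restriction, ‖F − G‖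 ≤ 15.6 · β₁. -/
open scoped Classical BigOperators

noncomputable section

open PaperL1


namespace PaperL1

/-! ### The Banach algebra `ℓ¹(ℕ^d)` -/

/-- The space `ℓ¹(ℕ^d)`. -/
def L1 (d : ℕ) : Type := lp (fun _ : Fin d → ℕ => ℝ) 1

instance (d : ℕ) : NormedAddCommGroup (L1 d) :=
  inferInstanceAs (NormedAddCommGroup (lp (fun _ : Fin d → ℕ => ℝ) 1))
instance (d : ℕ) : NormedSpace ℝ (L1 d) :=
  inferInstanceAs (NormedSpace ℝ (lp (fun _ : Fin d → ℕ => ℝ) 1))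
instance (d : ℕ) : CompleteSpace (L1 d) :=
  inferInstanceAs (CompleteSpace (lp (fun _ : Fin d → ℕ => ℝ) 1))

/-- Evaluation at a point, a continuous linear map. -/
def ev {d : ℕ} (x : Fin d → ℕ) : L1 d →L[ℝ] ℝ :=
  lp.evalCLM (𝕜 := ℝ) (p := 1) (fun _ : Fin d → ℕ => ℝ) x

lemma ev_ext {d : ℕ} {f g : L1 d} (h : ∀ x, ev x f = ev x g) : f = g :=
  lp.ext (funext h)

lemma summable_abs_ev {d : ℕ} (f : L1 d) : Summable (fun x => |ev x f|) := by
  have := lp.hasSum_norm (p := 1) (by simp) f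
  have h2 := this.summable
  simp only [ENNReal.toReal_one, Real.rpow_one] at h2
  exact h2

lemma norm_L1 {d : ℕ} (f : L1 d) : ‖f‖ = ∑' x, |ev x f| := by
  have := lp.norm_eq_tsum_rpow (p := 1) (by simp) f
  simp only [ENNReal.toReal_one, Real.rpow_one, div_one] at this
  exact this

/-- Build an element from an absolutely summable function. -/
def mkL {d : ℕ} (f : (Fin d → ℕ) → ℝ) (hf : Summable (fun x => |f x|)) : L1 d :=
  (⟨f, by
    have : Memℓp f 1 := by
      rw [memℓp_gen_iff (by simp)]
      simpa using hf
    exact this⟩ : lp (fun _ : Fin d → ℕ => ℝ) 1)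

@[simp] lemma ev_mkL {d : ℕ} (f : (Fin d → ℕ) → ℝ) (hf) (x) : ev x (mkL f hf) = f x := rfl

lemma hasSum_conv {X : Type*} [AddCommMonoid X] {f g : X → ℝ}
    (hf : Summable (fun x => |f x|)) (hg : Summable (fun x => |g x|)) :
    HasSum (conv f g) ((∑' x, f x) * (∑' x, g x)) := by
  have hs := summable_mul_of_summable_norm (f := f) (g := g) hf hg
  rw [tsum_mul_tsum_of_summable_norm (f := f) (g := g) hf hg]
  have h1 := ((Equiv.sigmaFiberEquiv (fun p : X × X => p.1 + p.2)).hasSum_iff).2 hs.hasSum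
  have h2 := ((Equiv.sigmaFiberEquiv (fun p : X × X => p.1 + p.2)).summable_iff).2 hs
  refine h1.sigma (fun x => ?_)
  exact (h2.sigma_factor x).hasSum

lemma abs_conv_le {X : Type*} [AddCommMonoid X] {f g : X → ℝ}
    (hf : Summable (fun x => |f x|)) (hg : Summable (fun x => |g x|)) (x : X) :
    |conv f g x| ≤ conv (fun x => |f x|) (fun x => |g x|) x := by
  have hs := summable_mul_of_summable_norm (f := fun x => |f x|) (g := fun x => |g x|)
    (by simpa using hf) (by simpa using hg)
  have h2 := ((Equiv.sigmaFiberEquiv (fun p : X × X => p.1 + p.2)).summable_iff).2 hs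
  have h3 := h2.sigma_factor x
  have := norm_tsum_le_tsum_norm (f := fun p : {p : X × X // p.1 + p.2 = x} => f p.1.1 * g p.1.2)
    (by simpa [abs_mul] using h3)
  simpa [conv, abs_mul] using this

lemma summable_abs_conv {X : Type*} [AddCommMonoid X] {f g : X → ℝ}
    (hf : Summable (fun x => |f x|)) (hg : Summable (fun x => |g x|)) :
    Summable (fun x => |conv f g x|) := by
  refine Summable.of_nonneg_of_le (fun _ => abs_nonneg _) (abs_conv_le hf hg)
    (hasSum_conv (by simpa using hf) (by simpa using hg)).summable

lemma summable_abs_delta {X : Type*} [AddCommMonoid X] (a : X) :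
    Summable (fun x => |delta a x|) := by
  apply summable_of_hasFiniteSupport
  apply (Set.finite_singleton a).subset
  intro x hx
  by_contra h
  simp at h
  simp [delta, h] at hx

/-- The embedding in the ring of power series. -/
def toMv {d : ℕ} (f : L1 d) : MvPowerSeries (Fin d) ℝ := fun n => ev (⇑n) f

lemma toMv_injective {d : ℕ} : Function.Injective (toMv (d := d)) := by
  intro f g h
  refine ev_ext (fun x => ?_)
  have := congrFun h (Finsupp.equivFunOnFinite.symm x)
  simpa [toMv] using this

instance (d : ℕ) : Mul (L1 d) :=
  ⟨fun f g => mkL (conv (fun x => ev x f) (fun x => ev x g))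
    (summable_abs_conv (summable_abs_ev f) (summable_abs_ev g))⟩

instance (d : ℕ) : One (L1 d) := ⟨mkL (delta 0) (summable_abs_delta 0)⟩

lemma ev_mul {d : ℕ} (f g : L1 d) (x) :
    ev x (f * g) = conv (fun x => ev x f) (fun x => ev x g) x := rfl
lemma ev_one {d : ℕ} (x) : ev x (1 : L1 d) = delta 0 x := rfl

lemma toMv_one {d : ℕ} : toMv (1 : L1 d) = 1 := by
  ext n
  rw [MvPowerSeries.coeff_one]
  change ev (⇑n) 1 = _
  rw [ev_one, delta]
  simp

lemma toMv_mul {d : ℕ} (f g : L1 d) : toMv (f * g) = toMv f * toMv g := by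
  ext n
  rw [MvPowerSeries.coeff_mul]
  change ev (⇑n) (f * g) = _
  rw [ev_mul, conv]
  let e : {p : (Fin d → ℕ) × (Fin d → ℕ) // p.1 + p.2 = ⇑n} ≃
      {p // p ∈ Finset.HasAntidiagonal.antidiagonal n} :=
    { toFun := fun p => ⟨(Finsupp.equivFunOnFinite.symm p.1.1, Finsupp.equivFunOnFinite.symm p.1.2), by
        rw [Finset.HasAntidiagonal.mem_antidiagonal]
        ext i
        simpa using congrFun p.2 i⟩
      invFun := fun p => ⟨(⇑p.1.1, ⇑p.1.2), by
        have := Finset.HasAntidiagonal.mem_antidiagonal.1 p.2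
        exact congrArg (fun m : Fin d →₀ ℕ => ⇑m) this⟩
      left_inv := fun p => by simp
      right_inv := fun p => by
        ext <;> simp }
  rw [← Finset.sum_coe_sort, ← tsum_fintype (L := SummationFilter.unconditional _), ← e.tsum_eq]
  refine tsum_congr (fun p => ?_)
  rfl

lemma toMv_add {d : ℕ} (f g : L1 d) : toMv (f + g) = toMv f + toMv g := by
  ext n; exact map_add (ev (⇑n)) f g

lemma toMv_zero {d : ℕ} : toMv (0 : L1 d) = 0 := by
  ext n; exact map_zero (ev (⇑n))

lemma toMv_smul {d : ℕ} (c : ℝ) (f : L1 d) : toMv (c • f) = c • toMv f := by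
  ext n; exact map_smul (ev (⇑n)) c f

instance (d : ℕ) : CommRing (L1 d) :=
  { (inferInstance : AddCommGroup (L1 d)) with
    mul := (· * ·)
    one := 1
    mul_assoc := fun a b c => toMv_injective (by simp only [toMv_mul, mul_assoc])
    mul_comm := fun a b => toMv_injective (by simp only [toMv_mul, mul_comm])
    one_mul := fun a => toMv_injective (by simp only [toMv_mul, toMv_one, one_mul])
    mul_one := fun a => toMv_injective (by simp only [toMv_mul, toMv_one, mul_one])
    zero_mul := fun a => toMv_injective (by simp only [toMv_mul, toMv_zero, zero_mul])
    mul_zero := fun a => toMv_injective (by simp only [toMv_mul, toMv_zero, mul_zero])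
    left_distrib := fun a b c => toMv_injective (by simp only [toMv_mul, toMv_add, mul_add])
    right_distrib := fun a b c => toMv_injective (by simp only [toMv_mul, toMv_add, add_mul]) }

instance (d : ℕ) : NormedCommRing (L1 d) :=
  { (inferInstance : NormedAddCommGroup (L1 d)), (inferInstance : CommRing (L1 d)) with
    norm_mul_le := fun f g => by
      rw [norm_L1, norm_L1 f, norm_L1 g]
      have h := hasSum_conv (f := fun x => |ev x f|) (g := fun x => |ev x g|)
        (by simpa using summable_abs_ev f) (by simpa using summable_abs_ev g)
      rw [← h.tsum_eq]
      exact (summable_abs_ev (f * g)).tsum_le_tsum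
        (fun x => abs_conv_le (summable_abs_ev f) (summable_abs_ev g) x) h.summable }

instance (d : ℕ) : NormedAlgebra ℝ (L1 d) :=
  { Algebra.ofModule (R := ℝ) (A := L1 d)
      (fun r x y => toMv_injective (by simp only [toMv_mul, toMv_smul, smul_mul_assoc]))
      (fun r x y => toMv_injective (by simp only [toMv_mul, toMv_smul, mul_smul_comm])) with
    norm_smul_le := fun c f => norm_smul_le c f }

instance (d : ℕ) : NormedAlgebra ℚ (L1 d) := NormedAlgebra.restrictScalars ℚ ℝ (L1 d)

/-- The point mass as an element of the algebra. -/
def dl {d : ℕ} (a : Fin d → ℕ) : L1 d := mkL (delta a) (summable_abs_delta a)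

lemma norm_dl {d : ℕ} (a : Fin d → ℕ) : ‖dl a‖ = 1 := by
  rw [norm_L1, tsum_eq_single a]
  · simp [dl, delta]
  · intro b hb; simp [dl, delta, hb]

lemma norm_one_L1 {d : ℕ} : ‖(1 : L1 d)‖ = 1 := norm_dl 0

instance (d : ℕ) : NormOneClass (L1 d) := ⟨norm_one_L1⟩

/-- Total mass. -/
def mass {d : ℕ} (f : L1 d) : ℝ := ∑' x, ev x f

lemma summable_ev {d : ℕ} (f : L1 d) : Summable (fun x => ev x f) := (summable_abs_ev f).of_abs

lemma mass_mul {d : ℕ} (f g : L1 d) : mass (f * g) = mass f * mass g :=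
  (hasSum_conv (summable_abs_ev f) (summable_abs_ev g)).tsum_eq

lemma mass_dl {d : ℕ} (a : Fin d → ℕ) : mass (dl a) = 1 := by
  rw [mass, tsum_eq_single a]
  · simp [dl, delta]
  · intro b hb; simp [dl, delta, hb]

/-- Total mass as a ring homomorphism. -/
def massHom (d : ℕ) : L1 d →+* ℝ where
  toFun := mass
  map_one' := mass_dl 0
  map_mul' := mass_mul
  map_zero' := by simp [mass]
  map_add' f g := by
    simp only [mass, map_add]
    exact (summable_ev f).tsum_add (summable_ev g)

lemma abs_mass_le {d : ℕ} (f : L1 d) : |mass f| ≤ ‖f‖ := by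
  rw [norm_L1]
  exact norm_tsum_le_tsum_norm (f := fun x => ev x f) (summable_abs_ev f)

lemma mass_smul {d : ℕ} (c : ℝ) (f : L1 d) : mass (c • f) = c * mass f := by
  simp only [mass, map_smul, smul_eq_mul]
  exact tsum_mul_left

lemma continuous_massHom (d : ℕ) : Continuous (massHom d) :=
  AddMonoidHomClass.continuous_of_bound (massHom d) 1
    (fun f => by rw [one_mul]; exact abs_mass_le f)

/-! ### Smoothness of the multivariate Poisson law -/

lemma norm_exp_le_exp {𝔸 : Type*} [NormedCommRing 𝔸] [NormedAlgebra ℝ 𝔸] [NormOneClass 𝔸]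
    [CompleteSpace 𝔸] (x : 𝔸) : ‖NormedSpace.exp x‖ ≤ Real.exp ‖x‖ := by
  have h1 := NormedSpace.exp_series_hasSum_exp' (𝕂 := ℝ) x
  have h2 := NormedSpace.exp_series_hasSum_exp' (𝕂 := ℝ) ‖x‖
  rw [← Real.exp_eq_exp_ℝ] at h2
  rw [← h1.tsum_eq]
  refine tsum_of_norm_bounded h2 (fun m => ?_)
  rw [norm_smul, smul_eq_mul, Real.norm_eq_abs, abs_of_nonneg (by positivity)]
  gcongr
  exact norm_pow_le x m

/-- The unit vectors. -/
def er {d : ℕ} (r : Fin d) : Fin d → ℕ := fun i => if i = r then 1 else 0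

/-- The generator `Σ_r a_r (δ_{e_r} - δ_0)`. -/
def gen {d : ℕ} (a : Fin d → ℝ) : L1 d := ∑ r, a r • (dl (er r) - 1)

lemma gen_add {d : ℕ} (a b : Fin d → ℝ) : gen (a + b) = gen a + gen b := by
  simp [gen, add_smul, Finset.sum_add_distrib]

lemma gen_smul {d : ℕ} (c : ℝ) (a : Fin d → ℝ) : gen (c • a) = c • gen a := by
  simp [gen, Finset.smul_sum, mul_smul]

lemma norm_gen_le {d : ℕ} (a : Fin d → ℝ) : ‖gen a‖ ≤ 2 * ∑ r, |a r| := by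
  rw [Finset.mul_sum]
  refine (norm_sum_le _ _).trans (Finset.sum_le_sum fun r _ => ?_)
  rw [norm_smul, Real.norm_eq_abs, mul_comm]
  gcongr
  refine (norm_sub_le _ _).trans ?_
  rw [norm_dl, norm_one_L1]
  norm_num

lemma norm_exp_gen_le {d : ℕ} {a : Fin d → ℝ} (ha : ∀ r, 0 ≤ a r) :
    ‖NormedSpace.exp (gen a)‖ ≤ 1 := by
  have h : gen a = (∑ r, a r • dl (er r)) + algebraMap ℝ (L1 d) (-∑ r, a r) := by
    simp only [gen, smul_sub, Finset.sum_sub_distrib, ← Finset.sum_smul]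
    rw [Algebra.algebraMap_eq_smul_one, neg_smul, sub_eq_add_neg]
  rw [h, NormedSpace.exp_add, ← NormedSpace.algebraMap_exp_comm, ← Real.exp_eq_exp_ℝ]
  refine (norm_mul_le _ _).trans ?_
  rw [norm_algebraMap', Real.norm_eq_abs, abs_of_pos (Real.exp_pos _)]
  have h2 : ‖∑ r, a r • dl (er r)‖ ≤ ∑ r, a r := by
    refine (norm_sum_le _ _).trans (Finset.sum_le_sum fun r _ => ?_)
    rw [norm_smul, norm_dl, Real.norm_eq_abs, abs_of_nonneg (ha r), mul_one]
  calc _ ≤ Real.exp (∑ r, a r) * Real.exp (-∑ r, a r) := by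
        gcongr
        exact (norm_exp_le_exp _).trans (Real.exp_le_exp.2 h2)
    _ = 1 := by rw [← Real.exp_add]; simp

/-- `f'` is obtained from `f` by multiplication with the `s`-th coordinate. -/
def IsN {d : ℕ} (s : Fin d) (f f' : L1 d) : Prop := ∀ x, (x s : ℝ) * ev x f = ev x f'

lemma IsN.mul {d : ℕ} {s : Fin d} {f f' g g' : L1 d} (hf : IsN s f f') (hg : IsN s g g') :
    IsN s (f * g) (f' * g + f * g') := by
  intro x
  obtain ⟨n, rfl⟩ : ∃ n : Fin d →₀ ℕ, ⇑n = x :=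
    ⟨Finsupp.equivFunOnFinite.symm x, by simp⟩
  rw [map_add]
  have key : ∀ u v : L1 d, ev (⇑n) (u * v) =
      ∑ p ∈ Finset.HasAntidiagonal.antidiagonal n, ev (⇑p.1) u * ev (⇑p.2) v := by
    intro u v
    have := congrArg (MvPowerSeries.coeff n) (toMv_mul u v)
    rw [MvPowerSeries.coeff_mul] at this
    exact this
  rw [key, key, key, ← Finset.sum_add_distrib, Finset.mul_sum]
  refine Finset.sum_congr rfl (fun p hp => ?_)
  rw [← hf, ← hg]
  have := Finset.HasAntidiagonal.mem_antidiagonal.1 hp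
  have h3 : (n s : ℝ) = p.1 s + p.2 s := by
    rw [← this]; simp
  rw [h3]; ring

lemma IsN.add {d : ℕ} {s : Fin d} {f f' g g' : L1 d} (hf : IsN s f f') (hg : IsN s g g') :
    IsN s (f + g) (f' + g') := by
  intro x
  rw [map_add, map_add, mul_add, hf, hg]

lemma IsN.smul {d : ℕ} {s : Fin d} {f f' : L1 d} (c : ℝ) (hf : IsN s f f') :
    IsN s (c • f) (c • f') := by
  intro x
  rw [map_smul, map_smul, ← hf, smul_eq_mul, smul_eq_mul]; ring

lemma IsN.one {d : ℕ} (s : Fin d) : IsN s (1 : L1 d) 0 := by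
  intro x
  rw [ev_one, map_zero, delta]
  split_ifs with h <;> simp [h]

lemma IsN.dl {d : ℕ} (s r : Fin d) : IsN s (dl (er r) : L1 d) (if r = s then dl (er r) else 0) := by
  intro x
  by_cases h : x = er r
  · subst h
    by_cases hr : r = s
    · subst hr; simp [er]
    · have : ¬ s = r := fun h => hr h.symm
      simp [er, hr, this]
  · have : ev x (PaperL1.dl (er r) : L1 d) = 0 := by simp [PaperL1.dl, delta, h]
    split_ifs <;> simp [this]

lemma IsN.gen {d : ℕ} (s : Fin d) (a : Fin d → ℝ) : IsN s (gen a) (a s • PaperL1.dl (er s)) := by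
  have h1 : ∀ r, IsN s (a r • (PaperL1.dl (er r) - 1)) (if r = s then a r • PaperL1.dl (er r) else 0) := by
    intro r
    have := ((IsN.dl s r).add ((IsN.one s).smul (-1))).smul (a r)
    convert this using 1
    · simp [sub_eq_add_neg]
    · split_ifs <;> simp
  have h2 : ∀ t : Finset (Fin d), IsN s (∑ r ∈ t, a r • (PaperL1.dl (er r) - 1))
      (∑ r ∈ t, if r = s then a r • PaperL1.dl (er r) else 0) := by
    intro t
    induction t using Finset.induction_on with
    | empty => intro x; simp
    | insert r t hr ih =>
      rw [Finset.sum_insert hr, Finset.sum_insert hr]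
      exact (h1 r).add ih
  have := h2 Finset.univ
  simpa [PaperL1.gen] using this

lemma IsN.pow {d : ℕ} {s : Fin d} {f f' : L1 d} (hf : IsN s f f') (m : ℕ) :
    IsN s (f ^ (m + 1)) (((m : ℝ) + 1) • (f ^ m * f')) := by
  induction m with
  | zero => simpa using hf
  | succ m ih =>
    have := ih.mul hf
    rw [← pow_succ] at this
    convert this using 1
    rw [pow_succ f m, smul_mul_assoc, Nat.cast_succ, add_smul ((m : ℝ) + 1), one_smul]
    congr 1
    congr 1
    ring

lemma IsN.exp {d : ℕ} {s : Fin d} {f f' : L1 d} (hf : IsN s f f') :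
    IsN s (NormedSpace.exp f) (NormedSpace.exp f * f') := by
  intro x
  have h1 := NormedSpace.exp_series_hasSum_exp' (𝕂 := ℝ) f
  have h2 := ((h1.mul_right f').mapL (ev x))
  have h3 := ((h1.mapL (ev x)).mul_left (x s : ℝ))
  rw [← hasSum_nat_add_iff' 1] at h3
  have h4 : (∑ i ∈ Finset.range 1, (x s : ℝ) * (ev x) ((i.factorial : ℝ)⁻¹ • f ^ i)) = 0 := by
    have := IsN.one s x
    simpa using this
  rw [h4, sub_zero] at h3
  have h5 : ∀ m : ℕ, (x s : ℝ) * ev x (((m + 1).factorial : ℝ)⁻¹ • f ^ (m + 1)) =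
      ev x ((m.factorial : ℝ)⁻¹ • f ^ m * f') := by
   intro m
   rw [map_smul, smul_mul_assoc, map_smul, smul_eq_mul, smul_eq_mul, mul_left_comm,
    IsN.pow hf m x, map_smul, smul_eq_mul, Nat.factorial_succ]
   push_cast
   have : (m : ℝ) + 1 ≠ 0 := by positivity
   field_simp
  simp only [h5] at h3
  exact h3.unique h2

lemma mass_gen {d : ℕ} (a : Fin d → ℝ) : massHom d (gen a) = 0 := by
  rw [gen, map_sum]
  refine Finset.sum_eq_zero fun r _ => ?_
  have : massHom d (a r • (dl (er r) - 1)) = a r * massHom d (dl (er r) - 1) := mass_smul _ _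
  rw [this, map_sub, map_one]
  have : massHom d (dl (er r)) = 1 := mass_dl _
  rw [this]; simp

lemma mass_exp_gen {d : ℕ} (a : Fin d → ℝ) : massHom d (NormedSpace.exp (gen a)) = 1 := by
  rw [NormedSpace.map_exp (massHom d) (continuous_massHom d), mass_gen, NormedSpace.exp_zero]

lemma exp_gen_nonneg {d : ℕ} {a : Fin d → ℝ} (ha : ∀ r, 0 ≤ a r) (x) :
    0 ≤ ev x (NormedSpace.exp (gen a)) := by
  set G := NormedSpace.exp (gen a)
  have h1 : ‖G‖ ≤ 1 := norm_exp_gen_le ha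
  have h2 : ∑' x, ev x G = 1 := mass_exp_gen a
  rw [norm_L1] at h1
  have hs := (summable_abs_ev G).sub (summable_ev G)
  have h3 : ∑' x, (|ev x G| - ev x G) ≤ 0 := by
    rw [(summable_abs_ev G).tsum_sub (summable_ev G), h2]; linarith
  have h4 := hs.le_tsum x (fun y _ => sub_nonneg.2 (le_abs_self (ev y G)))
  have := abs_nonneg (ev x G)
  linarith

lemma smooth {d : ℕ} {μ a : Fin d → ℝ} (hμ : ∀ r, 0 < μ r) {θ : ℝ} (hθ : 0 < θ)
    (h : ∑ r, a r ^ 2 / μ r ≤ θ ^ 2) : ‖gen a * NormedSpace.exp (gen μ)‖ ≤ θ := by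
  set G := NormedSpace.exp (gen μ) with hG
  have hN : ∀ s, IsN s G (G * (μ s • dl (er s))) := fun s => (IsN.gen s μ).exp
  have hTN : ∀ s, IsN s (gen a * G) (a s • dl (er s) * G + gen a * (G * (μ s • dl (er s)))) :=
    fun s => (IsN.gen s a).mul (hN s)
  have hGn : ∀ x, 0 ≤ ev x G := exp_gen_nonneg (fun r => (hμ r).le)
  let hh : (Fin d → ℕ) → ℝ := fun x => ∑ r, a r * (x r / μ r - 1)
  have hev : ∀ x, ev x (gen a * G) = hh x * ev x G := by
    intro x
    rw [gen, Finset.sum_mul, map_sum, Finset.sum_mul]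
    refine Finset.sum_congr rfl fun r _ => ?_
    have h1 := hN r x
    rw [mul_smul_comm, map_smul, smul_eq_mul] at h1
    rw [smul_mul_assoc, map_smul, sub_mul, one_mul, map_sub, smul_eq_mul, mul_comm (dl (er r)) G]
    have := hμ r
    have h2 : ev x (G * dl (er r)) = x r / μ r * ev x G := by
      field_simp
      linarith
    rw [h2]; ring
  let W : L1 d := ∑ s, a s • ((μ s)⁻¹ • (a s • dl (er s) * G + gen a * (G * (μ s • dl (er s))))
    - gen a * G)
  have hW : ∀ x, ev x W = hh x ^ 2 * ev x G := by
    intro x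
    rw [pow_two, mul_assoc, ← hev, Finset.sum_mul, map_sum]
    refine Finset.sum_congr rfl fun s _ => ?_
    rw [map_smul, map_sub, map_smul, ← hTN s x, smul_eq_mul, smul_eq_mul]
    ring
  have hmW : mass W = ∑ s, a s ^ 2 / μ s := by
    have hms : ∀ (c : ℝ) (f : L1 d), massHom d (c • f) = c * massHom d f := mass_smul
    have hmd : ∀ b, massHom d (dl b) = 1 := mass_dl
    change massHom d W = _
    rw [map_sum]
    refine Finset.sum_congr rfl fun s _ => ?_
    simp only [hms, map_sub, map_add, map_mul, hmd, mass_gen, hG, mass_exp_gen]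
    ring
  rw [norm_L1]
  have hs1 : Summable fun x => (θ ^ 2 * ev x G + ev x W) / (2 * θ) :=
    (((summable_ev G).mul_left _).add (summable_ev W)).div_const _
  have hm : ∑' x, ev x G = 1 := mass_exp_gen μ
  calc ∑' x, |ev x (gen a * G)| ≤ ∑' x, (θ ^ 2 * ev x G + ev x W) / (2 * θ) := by
        refine (summable_abs_ev _).tsum_le_tsum (fun x => ?_) hs1
        rw [hev, hW, abs_mul, abs_of_nonneg (hGn x), le_div_iff₀ (by positivity)]
        have h1 := sq_nonneg (|hh x| - θ)
        rw [← sq_abs (hh x)]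
        nlinarith [mul_nonneg h1 (hGn x)]
    _ = (θ ^ 2 * 1 + mass W) / (2 * θ) := by
        rw [tsum_div_const, ((summable_ev G).mul_left _).tsum_add (summable_ev W), tsum_mul_left, hm]
        rfl
    _ ≤ θ := by
        rw [hmW, div_le_iff₀ (by positivity)]
        nlinarith

/-! ### The majorant method -/

open Polynomial in
/-- Coefficientwise domination of a polynomial over the algebra by a real polynomial, where the
`m`-th coefficient may use the smoothing of the semigroup `G`. -/
def Maj {𝔸 : Type*} [NormedCommRing 𝔸] (G : ℝ → 𝔸) (P : 𝔸[X]) (p : ℝ[X]) : Prop :=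
  ∀ (m : ℕ) (t w : ℝ), 0 ≤ t → 0 ≤ w → (m : ℝ) ≤ t * w ^ 2 →
    ‖P.coeff m * G t‖ ≤ p.coeff m * w ^ m

section MajSection
open Polynomial
variable {𝔸 : Type*} [NormedCommRing 𝔸] {G : ℝ → 𝔸}

lemma Maj.add {P Q : 𝔸[X]} {p q : ℝ[X]} (hP : Maj G P p) (hQ : Maj G Q q) :
    Maj G (P + Q) (p + q) := by
  intro m t w ht hw hm
  rw [coeff_add, coeff_add, add_mul, add_mul]
  exact (norm_add_le _ _).trans (add_le_add (hP m t w ht hw hm) (hQ m t w ht hw hm))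

lemma Maj.zero : Maj G (0 : 𝔸[X]) 0 := by
  intro m t w ht hw hm
  simp

lemma Maj.one (hG : ∀ t, 0 ≤ t → ‖G t‖ ≤ 1) : Maj G (1 : 𝔸[X]) 1 := by
  intro m t w ht hw hm
  rw [coeff_one, coeff_one]
  split_ifs with h
  · subst h; simpa using hG t ht
  · simp

lemma Maj.smul [NormedAlgebra ℝ 𝔸] {P : 𝔸[X]} {p : ℝ[X]} (c : ℝ) (hP : Maj G P p) :
    Maj G (c • P) (|c| • p) := by
  intro m t w ht hw hm
  rw [coeff_smul, coeff_smul, smul_mul_assoc, norm_smul, smul_eq_mul, mul_assoc, Real.norm_eq_abs]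
  exact mul_le_mul_of_nonneg_left (hP m t w ht hw hm) (abs_nonneg c)

lemma Maj.mul (hadd : ∀ s t, 0 ≤ s → 0 ≤ t → G (s + t) = G s * G t)
    {P Q : 𝔸[X]} {p q : ℝ[X]} (hP : Maj G P p) (hQ : Maj G Q q) :
    Maj G (P * Q) (p * q) := by
  intro m t w ht hw hm
  rw [coeff_mul, coeff_mul, Finset.sum_mul, Finset.sum_mul]
  refine (norm_sum_le _ _).trans (Finset.sum_le_sum fun ij hij => ?_)
  obtain ⟨i, j⟩ := ij
  have hij' : i + j = m := by simpa using hij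
  have hij2 : (i : ℝ) + j = m := by exact_mod_cast hij'
  simp only
  have key : ∃ s s' : ℝ, 0 ≤ s ∧ 0 ≤ s' ∧ s + s' = t ∧ (i : ℝ) ≤ s * w ^ 2 ∧
      (j : ℝ) ≤ s' * w ^ 2 := by
    rcases hw.eq_or_lt with h0 | h0
    · subst h0
      have : (0 : ℝ) ≤ i := by positivity
      have : (0 : ℝ) ≤ j := by positivity
      refine ⟨0, t, le_rfl, ht, by simp, ?_, ?_⟩ <;> norm_num at hm ⊢ <;> linarith
    · have h1 : (i : ℝ) / w ^ 2 * w ^ 2 = i := by field_simp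
      refine ⟨i / w ^ 2, t - i / w ^ 2, by positivity, ?_, by ring, h1.ge, ?_⟩
      · rw [sub_nonneg, div_le_iff₀ (by positivity)]
        have : (0 : ℝ) ≤ j := by positivity
        linarith
      · rw [sub_mul, h1]; linarith
  obtain ⟨s, s', hs, hs', hss, hi, hj⟩ := key
  rw [← hss, hadd s s' hs hs', mul_mul_mul_comm, ← hij', pow_add, mul_mul_mul_comm (p.coeff i)]
  have h1 := hP i s w hs hw hi
  have h2 := hQ j s' w hs' hw hj
  exact (norm_mul_le _ _).trans
    (mul_le_mul h1 h2 (norm_nonneg _) ((norm_nonneg _).trans h1))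

lemma Maj.pow (hG : ∀ t, 0 ≤ t → ‖G t‖ ≤ 1)
    (hadd : ∀ s t, 0 ≤ s → 0 ≤ t → G (s + t) = G s * G t)
    {P : 𝔸[X]} {p : ℝ[X]} (hP : Maj G P p) (k : ℕ) :
    Maj G (P ^ k) (p ^ k) := by
  induction k with
  | zero => simpa using Maj.one hG
  | succ k ih => rw [pow_succ, pow_succ]; exact ih.mul hadd hP

lemma Maj.sum {ι : Type*} (s : Finset ι) {P : ι → 𝔸[X]} {p : ι → ℝ[X]}
    (h : ∀ i ∈ s, Maj G (P i) (p i)) : Maj G (∑ i ∈ s, P i) (∑ i ∈ s, p i) := by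
  induction s using Finset.induction_on with
  | empty => simpa using Maj.zero
  | insert r t hr ih =>
    rw [Finset.sum_insert hr, Finset.sum_insert hr]
    exact (h r (by simp)).add (ih fun i hi => h i (by simp [hi]))

lemma Maj.prod_sub_one (hG : ∀ t, 0 ≤ t → ‖G t‖ ≤ 1)
    (hadd : ∀ s t, 0 ≤ s → 0 ≤ t → G (s + t) = G s * G t)
    {ι : Type*} (s : Finset ι) {P : ι → 𝔸[X]} {p : ι → ℝ[X]}
    (h : ∀ i ∈ s, Maj G (P i) (p i)) :
    Maj G (∏ i ∈ s, (1 + P i)) (∏ i ∈ s, (1 + p i)) ∧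
    Maj G (∏ i ∈ s, (1 + P i) - 1) (∏ i ∈ s, (1 + p i) - 1) := by
  induction s using Finset.induction_on with
  | empty => simpa using ⟨Maj.one hG, Maj.zero⟩
  | insert r t hr ih =>
    obtain ⟨h1, h2⟩ := ih fun i hi => h i (by simp [hi])
    have hr' := h r (by simp)
    rw [Finset.prod_insert hr, Finset.prod_insert hr]
    refine ⟨((Maj.one hG).add hr').mul hadd h1, ?_⟩
    have := (hr'.mul hadd h1).add h2
    convert this using 1 <;> ring

lemma Maj.linear {A B : 𝔸} {u v : ℝ} (hG : ∀ t, 0 ≤ t → ‖G t‖ ≤ 1)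
    (hA : ∀ t w, 0 ≤ t → 0 ≤ w → 1 ≤ t * w ^ 2 → ‖A * G t‖ ≤ u * w)
    (hB : ‖B‖ ≤ v) : Maj G (C A * X + C B) (C u * X + C v) := by
  intro m t w ht hw hm
  rcases m with _ | _ | m
  · simp only [coeff_add, coeff_C_mul, coeff_X_zero, mul_zero, zero_add, coeff_C_zero, pow_zero,
      mul_one]
    refine (norm_mul_le _ _).trans ?_
    have := mul_le_mul hB (hG t ht) (norm_nonneg _) ((norm_nonneg _).trans hB)
    simpa using this
  · simpa [coeff_X, coeff_C] using hA t w ht hw (by simpa using hm)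
  · simp

end MajSection

section Integrals
open MeasureTheory Set

lemma integrableOn_sqrt_pow (m : ℕ) {c : ℝ} (hc : 0 ≤ c) :
    IntegrableOn (fun τ : ℝ => Real.sqrt (c * τ) ^ m * Real.exp (-τ)) (Ioi 0) := by
  have h := (Real.GammaIntegral_convergent (s := (m : ℝ) / 2 + 1) (by positivity)).const_mul
    (Real.sqrt c ^ m)
  refine IntegrableOn.congr_fun h (fun τ hτ => ?_) measurableSet_Ioi
  have hτ' : (0 : ℝ) < τ := hτ
  rw [Real.sqrt_mul hc, mul_pow]
  have : Real.sqrt τ ^ m = τ ^ ((m : ℝ) / 2 + 1 - 1) := by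
    rw [Real.sqrt_eq_rpow, ← Real.rpow_natCast, ← Real.rpow_mul hτ'.le]
    congr 1; ring
  rw [this]; ring

lemma sqrt_pow_le_integral (m : ℕ) :
    Real.sqrt m ^ m ≤ ∫ τ in Ioi (0 : ℝ), Real.sqrt (2 * Real.exp 1 * τ) ^ m * Real.exp (-τ) := by
  have hIntg := integrableOn_sqrt_pow m (c := 2 * Real.exp 1) (by positivity)
  have hm0 : (0 : ℝ) ≤ (m : ℝ) / 2 := by positivity
  have hsub : Ioi ((m : ℝ) / 2) ⊆ Ioi 0 := Ioi_subset_Ioi hm0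
  have h1 : ∫ τ in Ioi ((m : ℝ) / 2), Real.sqrt m ^ m * Real.exp (m / 2) * Real.exp (-τ) =
      Real.sqrt m ^ m := by
    rw [integral_const_mul, integral_exp_neg_Ioi, mul_assoc, ← Real.exp_add]
    simp
  rw [← h1]
  refine le_trans ?_ (setIntegral_mono_set hIntg ?_ hsub.eventuallyLE)
  · refine setIntegral_mono_on ?_ (hIntg.mono_set hsub) measurableSet_Ioi (fun τ hτ => ?_)
    · exact (integrableOn_exp_neg_Ioi _).const_mul _
    · gcongr
      have hτ' : (m : ℝ) / 2 < τ := hτ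
      have h2 : Real.exp ((m : ℝ) / 2) = Real.sqrt (Real.exp 1) ^ m := by
        rw [Real.sqrt_eq_rpow, ← Real.exp_mul, ← Real.exp_nat_mul]
        congr 1; ring
      rw [h2, ← mul_pow, ← Real.sqrt_mul (by positivity)]
      refine pow_le_pow_left₀ (Real.sqrt_nonneg _) (Real.sqrt_le_sqrt ?_) _
      have := Real.exp_pos 1
      nlinarith
  · exact (ae_restrict_iff' measurableSet_Ioi).2 (Filter.Eventually.of_forall fun τ _ => by
      simp only [Pi.zero_apply]; positivity)

open Polynomial in
lemma Maj.norm_eval_le {𝔸 : Type*} [NormedCommRing 𝔸] {G : ℝ → 𝔸} {P : 𝔸[X]} {p : ℝ[X]}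
    (h : Maj G P p) :
    ‖P.eval 1 * G 1‖ ≤
      ∫ τ in Ioi (0 : ℝ), p.eval (Real.sqrt (2 * Real.exp 1 * τ)) * Real.exp (-τ) := by
  set N := max P.natDegree p.natDegree + 1
  have hP : P.natDegree < N := by omega
  have hp : p.natDegree < N := by omega
  have e1 : P.eval 1 * G 1 = ∑ m ∈ Finset.range N, P.coeff m * G 1 := by
    rw [eval_eq_sum_range' hP, Finset.sum_mul]; simp
  have e2 : ∀ τ : ℝ, p.eval (Real.sqrt (2 * Real.exp 1 * τ)) * Real.exp (-τ) =
      ∑ m ∈ Finset.range N,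
        p.coeff m * (Real.sqrt (2 * Real.exp 1 * τ) ^ m * Real.exp (-τ)) := by
    intro τ
    rw [eval_eq_sum_range' hp, Finset.sum_mul]
    simp only [mul_assoc]
  simp only [e1, e2]
  rw [integral_finsetSum _ (fun m _ =>
    (integrableOn_sqrt_pow m (c := 2 * Real.exp 1) (by positivity)).const_mul _)]
  refine (norm_sum_le _ _).trans (Finset.sum_le_sum fun m _ => ?_)
  rw [integral_const_mul]
  have h1 := h m 1 (Real.sqrt m) zero_le_one (Real.sqrt_nonneg _)
    (by rw [Real.sq_sqrt (by positivity)]; simp)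
  have h0 := h m m 1 (by positivity) zero_le_one (by simp)
  have h3 : 0 ≤ p.coeff m := by
    simpa using (norm_nonneg _).trans h0
  exact h1.trans (mul_le_mul_of_nonneg_left (sqrt_pow_le_integral m) h3)

open Polynomial in
lemma integrable_poly (p : ℝ[X]) : IntegrableOn (fun τ : ℝ =>
    p.eval (Real.sqrt (2 * Real.exp 1 * τ)) * Real.exp (-τ)) (Ioi 0) := by
  have e2 : ∀ τ : ℝ, p.eval (Real.sqrt (2 * Real.exp 1 * τ)) * Real.exp (-τ) =
      ∑ m ∈ Finset.range (p.natDegree + 1),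
        p.coeff m * (Real.sqrt (2 * Real.exp 1 * τ) ^ m * Real.exp (-τ)) := by
    intro τ
    rw [eval_eq_sum_range, Finset.sum_mul]
    simp only [mul_assoc]
  simp only [e2]
  exact integrable_finsetSum _ (fun m _ =>
    (integrableOn_sqrt_pow m (c := 2 * Real.exp 1) (by positivity)).const_mul _)

end Integrals

section Series

/-- The coefficients of `(1 + x) exp (-x) - 1`. -/
def cf (m : ℕ) : ℝ := (-1) ^ m * (m / ((m + 1).factorial : ℝ))

lemma abs_cf (m : ℕ) : |cf m| = m / ((m + 1).factorial : ℝ) := by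
  rw [cf, abs_mul, abs_pow, abs_neg, abs_one, one_pow, one_mul, abs_of_nonneg (by positivity)]

lemma hasSum_cf {𝔸 : Type*} [NormedCommRing 𝔸] [NormedAlgebra ℝ 𝔸] [CompleteSpace 𝔸] (H : 𝔸) :
    HasSum (fun m : ℕ => cf m • H ^ (m + 1)) ((1 + H) * NormedSpace.exp (-H) - 1) := by
  have h1 := NormedSpace.exp_series_hasSum_exp' (𝕂 := ℝ) (-H)
  have h2 := h1.mul_left H
  rw [← hasSum_nat_add_iff' 1] at h1
  have h3 := h1.add h2
  have e1 : NormedSpace.exp (-H) - ∑ i ∈ Finset.range 1, ((i.factorial : ℝ)⁻¹ • (-H) ^ i) +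
      H * NormedSpace.exp (-H) = (1 + H) * NormedSpace.exp (-H) - 1 := by
    simp; ring
  rw [e1] at h3
  have e2 : ∀ m : ℕ, (((m + 1).factorial : ℝ)⁻¹ • (-H) ^ (m + 1) +
      H * ((m.factorial : ℝ)⁻¹ • (-H) ^ m)) = cf m • H ^ (m + 1) := by
    intro m
    have h4 : ∀ k : ℕ, (-H) ^ k = ((-1 : ℝ) ^ k) • H ^ k := by
      intro k
      rw [neg_pow, Algebra.smul_def]; simp
    rw [h4, h4, mul_smul_comm, mul_smul_comm, ← pow_succ', smul_smul, smul_smul, ← add_smul]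
    congr 1
    rw [cf, Nat.factorial_succ]
    push_cast
    have : (m : ℝ) + 1 ≠ 0 := by positivity
    field_simp
    ring
  simp only [e2] at h3
  exact h3

lemma two_add_le {x : ℝ} (hx : 0 ≤ x) :
    2 + (x - 1) * Real.exp x ≤ Real.exp (18 / 25 * x ^ 2) := by
  let f : ℝ → ℝ := fun x => Real.exp (18 / 25 * x ^ 2) - (2 + (x - 1) * Real.exp x)
  have hd : ∀ y : ℝ, HasDerivAt f
      (Real.exp (18 / 25 * y ^ 2) * (18 / 25 * (2 * y)) - (1 * Real.exp y + (y - 1) * Real.exp y)) y := by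
    intro y
    have h1 : HasDerivAt (fun y : ℝ => 18 / 25 * y ^ 2) (18 / 25 * (2 * y)) y := by
      simpa using (hasDerivAt_pow 2 y).const_mul (18 / 25 : ℝ)
    have h2 := (((hasDerivAt_id y).sub_const 1).mul (Real.hasDerivAt_exp y)).const_add 2
    exact h1.exp.sub h2
  have hmono : MonotoneOn f (Set.Ici 0) := by
    refine monotoneOn_of_deriv_nonneg (convex_Ici 0)
      (fun y _ => (hd y).continuousAt.continuousWithinAt)
      (fun y _ => (hd y).differentiableAt.differentiableWithinAt) (fun y hy => ?_)
    rw [interior_Ici] at hy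
    have hy0 : (0 : ℝ) < y := hy
    rw [(hd y).deriv]
    have h1 : Real.exp y ≤ Real.exp (18 / 25 * y ^ 2) * (36 / 25) := by
      have h2 : y ≤ 18 / 25 * y ^ 2 + 25 / 72 := by nlinarith [sq_nonneg (y - 25 / 36)]
      have h3 : Real.exp (25 / 72) ≤ 36 / 25 := by
        have := Real.exp_bound' (x := 25 / 72) (by norm_num) (by norm_num) (n := 4) (by norm_num)
        refine this.trans ?_
        norm_num [Finset.sum_range_succ, Nat.factorial]
      calc Real.exp y ≤ Real.exp (18 / 25 * y ^ 2 + 25 / 72) := Real.exp_le_exp.2 h2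
        _ = Real.exp (18 / 25 * y ^ 2) * Real.exp (25 / 72) := Real.exp_add _ _
        _ ≤ _ := by gcongr
    nlinarith [mul_le_mul_of_nonneg_left h1 hy0.le]
  have := hmono (Set.mem_Ici.2 le_rfl) (Set.mem_Ici.2 hx) hx
  simp only [f] at this
  norm_num at this
  linarith

lemma sum_cf_le {x : ℝ} (hx : 0 ≤ x) (N : ℕ) :
    1 + ∑ m ∈ Finset.range N, |cf m| * x ^ (m + 1) ≤ Real.exp (18 / 25 * x ^ 2) := by
  have h := (hasSum_cf (-x)).neg
  rw [neg_neg, ← Real.exp_eq_exp_ℝ] at h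
  have e : ∀ m : ℕ, -(cf m • (-x) ^ (m + 1)) = |cf m| * x ^ (m + 1) := by
    intro m
    have h1 : ((-1 : ℝ) ^ m) * (-1) ^ m = 1 := by rw [← mul_pow]; simp
    rw [abs_cf, cf, smul_eq_mul, neg_pow x, pow_succ (-1 : ℝ)]
    linear_combination (m / ((m + 1).factorial : ℝ)) * x ^ (m + 1) * h1
  simp only [e] at h
  have := sum_le_hasSum (Finset.range N) (fun m _ => by positivity) h
  have h2 := two_add_le hx
  linarith

end Series

section Main
open MeasureTheory Set Polynomial

lemma integral_final {y : ℝ} (hy : 2 * Real.exp 1 * y < 1) :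
    IntegrableOn (fun τ : ℝ => (Real.exp (y * (2 * Real.exp 1 * τ + 4)) - 1) * Real.exp (-τ))
      (Ioi 0) ∧
    ∫ τ in Ioi (0 : ℝ), (Real.exp (y * (2 * Real.exp 1 * τ + 4)) - 1) * Real.exp (-τ) =
      Real.exp (4 * y) / (1 - 2 * Real.exp 1 * y) - 1 := by
  have e : ∀ τ : ℝ, (Real.exp (y * (2 * Real.exp 1 * τ + 4)) - 1) * Real.exp (-τ) =
      Real.exp (4 * y) * Real.exp ((2 * Real.exp 1 * y - 1) * τ) - Real.exp (-τ) := by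
    intro τ
    rw [sub_mul, one_mul, ← Real.exp_add, ← Real.exp_add]
    congr 2; ring
  simp only [e]
  have hb : 2 * Real.exp 1 * y - 1 < 0 := by linarith
  have h1 := (integrableOn_exp_mul_Ioi hb 0).const_mul (Real.exp (4 * y))
  have h2 := integrableOn_exp_neg_Ioi 0
  refine ⟨h1.sub h2, ?_⟩
  rw [integral_sub h1 h2, integral_const_mul, integral_exp_mul_Ioi hb, integral_exp_neg_Ioi]
  have : 1 - 2 * Real.exp 1 * y ≠ 0 := by linarith
  simp
  rw [neg_div, ← div_neg, mul_one_div, neg_sub] 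

lemma main_bound {𝔸 : Type*} [NormedCommRing 𝔸] [NormedAlgebra ℝ 𝔸] [CompleteSpace 𝔸]
    {G : ℝ → 𝔸} (hG : ∀ t, 0 ≤ t → ‖G t‖ ≤ 1)
    (hadd : ∀ s t, 0 ≤ s → 0 ≤ t → G (s + t) = G s * G t)
    {n : ℕ} (A B : Fin n → 𝔸) (u v : Fin n → ℝ) (hu : ∀ j, 0 ≤ u j) (hv : ∀ j, 0 ≤ v j)
    (hA : ∀ j t w, 0 ≤ t → 0 ≤ w → 1 ≤ t * w ^ 2 → ‖A j * G t‖ ≤ u j * w)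
    (hB : ∀ j, ‖B j‖ ≤ 2 * v j) (β : ℝ) (hβ : ∑ j, (u j ^ 2 + v j ^ 2) ≤ β)
    (hβ1 : 2 * Real.exp 1 * (18 / 25 * β) < 1) :
    ‖(∏ j, ((1 + (A j + B j)) * NormedSpace.exp (-(A j + B j))) - 1) * G 1‖ ≤
      Real.exp (4 * (18 / 25 * β)) / (1 - 2 * Real.exp 1 * (18 / 25 * β)) - 1 := by
  let P : ℕ → Fin n → 𝔸[X] := fun N j =>
    ∑ m ∈ Finset.range N, cf m • (C (A j) * X + C (B j)) ^ (m + 1)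
  let p : ℕ → Fin n → ℝ[X] := fun N j =>
    ∑ m ∈ Finset.range N, |cf m| • (C (u j) * X + C (2 * v j)) ^ (m + 1)
  have hM : ∀ N, Maj G (∏ j, (1 + P N j) - 1) (∏ j, (1 + p N j) - 1) := by
    intro N
    refine (Maj.prod_sub_one hG hadd _ fun j _ => ?_).2
    refine Maj.sum _ fun m _ => ?_
    exact ((Maj.linear hG (hA j) (hB j)).pow hG hadd _).smul _
  have hbound : ∀ N, ‖(∏ j, ((1 : 𝔸[X]) + P N j) - 1).eval 1 * G 1‖ ≤
      Real.exp (4 * (18 / 25 * β)) / (1 - 2 * Real.exp 1 * (18 / 25 * β)) - 1 := by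
    intro N
    obtain ⟨hi, he⟩ := integral_final hβ1
    rw [← he]
    refine (hM N).norm_eval_le.trans ?_
    refine setIntegral_mono_on (integrable_poly _) hi measurableSet_Ioi (fun τ hτ => ?_)
    have hτ' : (0 : ℝ) < τ := hτ
    refine mul_le_mul_of_nonneg_right ?_ (Real.exp_pos _).le
    set z := Real.sqrt (2 * Real.exp 1 * τ) with hz
    have hz0 : 0 ≤ z := Real.sqrt_nonneg _
    have hz2 : z ^ 2 = 2 * Real.exp 1 * τ := Real.sq_sqrt (by positivity)
    rw [← hz2, eval_sub, eval_prod, eval_one]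
    refine sub_le_sub_right ?_ 1
    calc ∏ j, eval z (1 + p N j) ≤ ∏ j, Real.exp (18 / 25 * ((u j ^ 2 + v j ^ 2) * (z ^ 2 + 4))) := by
          refine Finset.prod_le_prod (fun j _ => ?_) (fun j _ => ?_)
          · simp only [p, eval_add, eval_one, eval_finsetSum, eval_smul, eval_pow, eval_mul, eval_C,
              eval_X, smul_eq_mul]
            have := hu j
            have := hv j
            positivity
          · simp only [p, eval_add, eval_one, eval_finsetSum, eval_smul, eval_pow, eval_mul, eval_C,
              eval_X, smul_eq_mul]
            have h1 := hu j
            have h2 := hv j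
            refine (sum_cf_le (by positivity) N).trans (Real.exp_le_exp.2 ?_)
            nlinarith [sq_nonneg (v j * z - 2 * u j)]
      _ = Real.exp (18 / 25 * ((∑ j, (u j ^ 2 + v j ^ 2)) * (z ^ 2 + 4))) := by
          rw [← Real.exp_sum, Finset.sum_mul, Finset.mul_sum]
      _ ≤ _ := by
          refine Real.exp_le_exp.2 ?_
          have := mul_le_mul_of_nonneg_right hβ (by positivity : 0 ≤ z ^ 2 + 4)
          linarith
  have hlim : Filter.Tendsto (fun N => (∏ j, ((1 : 𝔸[X]) + P N j) - 1).eval 1 * G 1) Filter.atTop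
      (nhds ((∏ j, ((1 + (A j + B j)) * NormedSpace.exp (-(A j + B j))) - 1) * G 1)) := by
    refine Filter.Tendsto.mul_const _ ?_
    simp only [eval_sub, eval_prod, eval_one]
    refine Filter.Tendsto.sub_const (tendsto_finsetProd _ fun j _ => ?_) 1
    have h := ((hasSum_cf (A j + B j)).tendsto_sum_nat).const_add 1
    have e1 : (1 : 𝔸) + ((1 + (A j + B j)) * NormedSpace.exp (-(A j + B j)) - 1) =
      (1 + (A j + B j)) * NormedSpace.exp (-(A j + B j)) := by ring
    rw [e1] at h
    refine h.congr (fun N => ?_)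
    simp [P, eval_finsetSum]
  exact le_of_tendsto hlim.norm (Filter.Eventually.of_forall hbound)

end Main

section Final

lemma ev_list_prod {d : ℕ} {ι : Type*} (l : List ι) (f : ι → (Fin d → ℕ) → ℝ) (g : ι → L1 d)
    (h : ∀ i, (fun x => ev x (g i)) = f i) :
    l.foldr (fun i acc => conv (f i) acc) (delta 0) = fun x => ev x (l.map g).prod := by
  induction l with
  | nil => rfl
  | cons i l ih =>
    rw [List.foldr_cons, ih, ← h i, List.map_cons, List.prod_cons]
    rfl

lemma convProd_eq {d n : ℕ} (f : Fin n → (Fin d → ℕ) → ℝ) (g : Fin n → L1 d)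
    (h : ∀ i, (fun x => ev x (g i)) = f i) :
    convProd Finset.univ f = fun x => ev x (∏ i, g i) := by
  unfold convProd
  rw [ev_list_prod _ f g h]
  funext x
  congr 1
  rw [← Multiset.prod_coe, ← Multiset.map_coe, Finset.sort_eq]
  rfl

lemma convPow_eq {d : ℕ} (f : L1 d) (m : ℕ) :
    convPow (fun x => ev x f) m = fun x => ev x (f ^ m) := by
  induction m with
  | zero => rw [pow_zero]; rfl
  | succ m ih =>
    rw [pow_succ', convPow, ih]
    rfl

lemma convExp_eq {d : ℕ} (f : L1 d) :
    convExp (fun x => ev x f) = fun x => ev x (NormedSpace.exp f) := by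
  funext x
  have h := (NormedSpace.exp_series_hasSum_exp' (𝕂 := ℝ) f).mapL (ev x)
  rw [← h.tsum_eq, convExp]
  refine tsum_congr (fun m => ?_)
  rw [convPow_eq, map_smul, smul_eq_mul]

lemma ev_gen {d : ℕ} (a : Fin d → ℝ) :
    (fun x => ev x (gen a)) = ∑ r, a r • (delta (er r) - delta 0) := by
  funext x
  rw [gen, map_sum, Finset.sum_apply]
  refine Finset.sum_congr rfl (fun r _ => ?_)
  rw [map_smul, map_sub]
  rfl

lemma exp_numeric : Real.exp (24 / 65) ≤ 1.447 := by
  have h := Real.exp_bound' (x := 24/65) (by norm_num) (by norm_num) (n := 6) (by norm_num)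
  refine h.trans ?_
  norm_num [Finset.sum_range_succ, Nat.factorial]

lemma numeric {β : ℝ} (h0 : 0 ≤ β) (h1 : β < 5 / 39) :
    2 * Real.exp 1 * (18 / 25 * β) < 1 ∧
    Real.exp (4 * (18 / 25 * β)) / (1 - 2 * Real.exp 1 * (18 / 25 * β)) - 1 ≤ 15.6 * β := by
  have he := Real.exp_one_lt_d9
  have hpos := Real.exp_pos 1
  have hw : 2 * Real.exp 1 * (18 / 25 * β) ≤ 3.9144 * β := by nlinarith
  have hc : Real.exp (4 * (18 / 25 * β)) ≤ 1 + 3.4866 * β := by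
    have hcv := convexOn_exp.2
    have := hcv (Set.mem_univ 0) (Set.mem_univ (24/65 : ℝ))
      (show 0 ≤ 1 - 39/5*β by linarith) (show 0 ≤ 39/5*β by linarith) (by ring)
    simp only [smul_eq_mul, Real.exp_zero] at this
    have e1 : (1 - 39/5*β) * 0 + 39/5*β * (24/65) = 4 * (18 / 25 * β) := by ring
    rw [e1] at this
    nlinarith [exp_numeric]
  refine ⟨by linarith, ?_⟩
  rw [sub_le_iff_le_add, div_le_iff₀ (by linarith)]
  refine hc.trans ?_
  have : (15.6 * β + 1) * (1 - 3.9144 * β) ≤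
      (15.6 * β + 1) * (1 - 2 * Real.exp 1 * (18 / 25 * β)) := by
    apply mul_le_mul_of_nonneg_left <;> linarith
  refine le_trans ?_ this
  nlinarith

lemma smooth' {d : ℕ} {μ a : Fin d → ℝ} (hμ : ∀ r, 0 < μ r) {θ : ℝ} (hθ : 0 ≤ θ)
    (h : ∑ r, a r ^ 2 / μ r ≤ θ ^ 2) : ‖gen a * NormedSpace.exp (gen μ)‖ ≤ θ := by
  refine le_of_forall_pos_le_add (fun ε hε => ?_)
  refine smooth hμ (by linarith) (h.trans ?_)
  exact pow_le_pow_left₀ hθ (by linarith) 2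

lemma norm_factor_le {d : ℕ} {p : ℝ} (hp : p ∈ Set.Icc (0:ℝ) 1) {q : Fin d → ℝ}
    (hq : ∀ r, q r ∈ Set.Icc (0:ℝ) 1) (hq1 : ∑ r, q r = 1) :
    ‖(1 : L1 d) + gen (fun r => p * q r)‖ ≤ 1 := by
  have e : (1 : L1 d) + gen (fun r => p * q r) =
      (1 - p) • (1 : L1 d) + ∑ r, (p * q r) • dl (er r) := by
    simp only [gen, smul_sub, Finset.sum_sub_distrib, ← Finset.sum_smul, ← Finset.mul_sum, hq1,
      mul_one, sub_smul, one_smul]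
    abel
  rw [e]
  refine (norm_add_le _ _).trans ?_
  have h1 : ‖(1 - p) • (1 : L1 d)‖ = 1 - p := by
    rw [norm_smul, norm_one_L1, mul_one, Real.norm_of_nonneg (by linarith [hp.2])]
  have h2 : ‖∑ r, (p * q r) • (dl (er r) : L1 d)‖ ≤ p := by
    refine (norm_sum_le _ _).trans ?_
    have : ∀ r, ‖(p * q r) • (dl (er r) : L1 d)‖ = p * q r := fun r => by
      rw [norm_smul, norm_dl, mul_one, Real.norm_of_nonneg (mul_nonneg hp.1 (hq r).1)]
    simp only [this, ← Finset.mul_sum, hq1, mul_one, le_refl]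
  linarith

lemma gen_sum {d n : ℕ} (f : Fin n → Fin d → ℝ) :
    gen (fun r => ∑ j, f j r) = ∑ j, gen (f j) := by
  simp only [gen, Finset.sum_smul]
  exact Finset.sum_comm

lemma algebra_bound {d n : ℕ}
    (p : Fin n → ℝ) (q : Fin n → Fin d → ℝ)
    (hp : ∀ j, p j ∈ Set.Icc (0:ℝ) 1)
    (hq : ∀ j r, q j r ∈ Set.Icc (0:ℝ) 1)
    (hq1 : ∀ j, ∑ r, q j r = 1)
    (lam : Fin d → ℝ) (hlam : ∀ r, lam r = ∑ j, p j * q j r)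
    (hlampos : ∀ r, 0 < lam r)
    (β₁ : ℝ)
    (hβ₁ : β₁ = ∑ j, (p j) ^ 2 * ∑ r, q j r * min (q j r / lam r) 1) :
    ‖(∏ j, ((1 : L1 d) + gen (fun r => p j * q j r))) - NormedSpace.exp (gen lam)‖
      ≤ 15.6 * β₁ := by
  have hβ0 : 0 ≤ β₁ := by
    rw [hβ₁]
    refine Finset.sum_nonneg (fun j _ => mul_nonneg (sq_nonneg _)
      (Finset.sum_nonneg (fun r _ => mul_nonneg (hq j r).1
        (le_min (div_nonneg (hq j r).1 (hlampos r).le) zero_le_one))))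
  rcases le_or_gt (5 / 39) β₁ with hbig | hsmall
  · refine (norm_sub_le _ _).trans ?_
    have h1 : ‖∏ j, ((1 : L1 d) + gen (fun r => p j * q j r))‖ ≤ 1 := by
      refine (Finset.norm_prod_le _ _).trans ?_
      exact Finset.prod_le_one (fun _ _ => norm_nonneg _)
        (fun j _ => norm_factor_le (hp j) (hq j) (hq1 j))
    have h2 := norm_exp_gen_le (fun r => (hlampos r).le)
    linarith
  obtain ⟨hn1, hn2⟩ := numeric hβ0 hsmall
  refine le_trans ?_ hn2
  let a : Fin n → Fin d → ℝ := fun j r => if q j r ≤ lam r then p j * q j r else 0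
  let b : Fin n → Fin d → ℝ := fun j r => if q j r ≤ lam r then 0 else p j * q j r
  have hab : ∀ j, gen (a j) + gen (b j) = gen (fun r => p j * q j r) := fun j => by
    rw [← gen_add]
    congr 1
    funext r
    simp only [a, b, Pi.add_apply]
    split_ifs <;> simp
  have hb0 : ∀ j r, 0 ≤ b j r := fun j r => by
    simp only [b]
    split_ifs
    · exact le_rfl
    · exact mul_nonneg (hp j).1 (hq j r).1
  have hu0 : ∀ j, 0 ≤ ∑ r, a j r ^ 2 / lam r := fun j =>
    Finset.sum_nonneg (fun r _ => div_nonneg (sq_nonneg _) (hlampos r).le)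
  have key := main_bound (G := fun t => NormedSpace.exp (t • gen lam : L1 d))
    (by
      intro t ht
      rw [← gen_smul]
      exact norm_exp_gen_le (fun r => mul_nonneg ht (hlampos r).le))
    (by
      intro s t _ _
      simp only [add_smul]
      exact NormedSpace.exp_add)
    (fun j => gen (a j)) (fun j => gen (b j))
    (fun j => √(∑ r, a j r ^ 2 / lam r)) (fun j => ∑ r, b j r)
    (fun j => Real.sqrt_nonneg _) (fun j => Finset.sum_nonneg (fun r _ => hb0 j r))
    (by
      intro j t w ht hw htw
      have ht0 : 0 < t := by
        rcases ht.eq_or_lt with h | h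
        · rw [← h] at htw; norm_num at htw
        · exact h
      rw [← gen_smul]
      refine smooth' (fun r => mul_pos ht0 (hlampos r)) (mul_nonneg (Real.sqrt_nonneg _) hw) ?_
      rw [mul_pow, Real.sq_sqrt (hu0 j)]
      have e : ∑ r, a j r ^ 2 / (t * lam r) = (∑ r, a j r ^ 2 / lam r) * t⁻¹ := by
        rw [Finset.sum_mul]
        refine Finset.sum_congr rfl (fun r _ => ?_)
        have := (hlampos r).ne'
        field_simp
      rw [e]
      refine mul_le_mul_of_nonneg_left ?_ (hu0 j)
      rw [inv_le_iff_one_le_mul₀ ht0]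
      linarith)
    (by
      intro j
      refine (norm_gen_le _).trans (le_of_eq ?_)
      simp only [abs_of_nonneg (hb0 j _)])
    β₁
    (by
      rw [hβ₁]
      refine Finset.sum_le_sum (fun j _ => ?_)
      rw [Real.sq_sqrt (hu0 j)]
      have hbs : ∑ r, b j r = p j * ∑ r, (if q j r ≤ lam r then 0 else q j r) := by
        rw [Finset.mul_sum]
        refine Finset.sum_congr rfl (fun r _ => ?_)
        simp only [b]
        split_ifs <;> simp
      have hS0 : 0 ≤ ∑ r, (if q j r ≤ lam r then 0 else q j r) :=
        Finset.sum_nonneg (fun r _ => by split_ifs; exacts [le_rfl, (hq j r).1])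
      have hS1 : ∑ r, (if q j r ≤ lam r then 0 else q j r) ≤ 1 := by
        rw [← hq1 j]
        exact Finset.sum_le_sum (fun r _ => by split_ifs; exacts [(hq j r).1, le_rfl])
      have h1 : (∑ r, b j r) ^ 2 ≤ p j ^ 2 * ∑ r, (if q j r ≤ lam r then 0 else q j r) := by
        rw [hbs, mul_pow]
        exact mul_le_mul_of_nonneg_left (by nlinarith) (sq_nonneg _)
      refine (add_le_add_right h1 _).trans (le_of_eq ?_)
      rw [Finset.mul_sum, Finset.mul_sum, ← Finset.sum_add_distrib]
      refine Finset.sum_congr rfl (fun r _ => ?_)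
      simp only [a]
      split_ifs with h
      · rw [min_eq_left ((div_le_one (hlampos r)).2 h)]
        ring
      · rw [min_eq_right ((one_le_div (hlampos r)).2 (le_of_not_ge h))]
        ring)
    hn1
  refine le_trans (le_of_eq ?_) key
  congr 1
  simp only [hab, one_smul]
  have hl : gen lam = ∑ j, (gen (fun r => p j * q j r) : L1 d) := by
    rw [← gen_sum]
    congr 1
    funext r
    exact hlam r
  rw [sub_mul, one_mul, Finset.prod_mul_distrib, ← NormedSpace.exp_sum, Finset.sum_neg_distrib,
    ← hl, mul_assoc, ← NormedSpace.exp_add, neg_add_cancel, NormedSpace.exp_zero, mul_one]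

end Final

end PaperL1

/-- Theorem 1 (second part) of Roos: without any restrictions,
`‖F - G‖ ≤ 15.6 β₁` with `β₁ = Σ_j p_j² Σ_r q_{j,r} min{q_{j,r}/λ_r, 1}`,
where `F` is the generalized multinomial distribution and `G` the
multivariate Poisson distribution in ℓ¹(ℕ^d). -/
theorem multinomial_poisson_tv_bound_beta
    (d n : ℕ) (hd : 1 ≤ d) (hn : 1 ≤ n)
    (p : Fin n → ℝ) (q : Fin n → Fin d → ℝ)
    (hp : ∀ j, p j ∈ Set.Icc (0:ℝ) 1)
    (hq : ∀ j r, q j r ∈ Set.Icc (0:ℝ) 1)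
    (hq1 : ∀ j, ∑ r, q j r = 1)
    (lam : Fin d → ℝ) (hlam : ∀ r, lam r = ∑ j, p j * q j r)
    (hlampos : ∀ r, 0 < lam r)
    (e : Fin d → (Fin d → ℕ)) (he : ∀ r, e r = fun i => if i = r then 1 else 0)
    (Q : Fin n → ((Fin d → ℕ) → ℝ)) (hQ : ∀ j, Q j = ∑ r, q j r • delta (e r))
    (F : (Fin d → ℕ) → ℝ)
    (hF : F = convProd Finset.univ (fun j => delta 0 + p j • (Q j - delta 0)))
    (G : (Fin d → ℕ) → ℝ)
    (hG : G = convExp (∑ r, lam r • (delta (e r) - delta 0)))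
    (β₁ : ℝ)
    (hβ₁ : β₁ = ∑ j, (p j) ^ 2 * ∑ r, q j r * min (q j r / lam r) 1) :
    l1norm (F - G) ≤ 15.6 * β₁ := by
  have hee : ∀ r, e r = er r := fun r => he r
  have hF' : F = fun x => ev x (∏ j, ((1 : L1 d) + gen (fun r => p j * q j r))) := by
    rw [hF]
    refine convProd_eq _ _ (fun j => ?_)
    have h1 : (fun x => ev x ((1 : L1 d) + gen (fun r => p j * q j r))) =
        delta 0 + fun x => ev x (gen (fun r => p j * q j r)) := by
      funext x
      rw [map_add]
      rfl
    rw [h1, ev_gen, hQ]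
    congr 1
    simp only [hee, mul_smul, ← Finset.smul_sum, smul_sub, Finset.sum_sub_distrib]
    rw [← Finset.sum_smul, hq1, one_smul]
  have hG' : G = fun x => ev x (NormedSpace.exp (gen lam : L1 d)) := by
    rw [hG, ← convExp_eq, ev_gen]
    simp only [hee]
  have := algebra_bound p q hp hq hq1 lam hlam hlampos β₁ hβ₁
  refine le_trans (le_of_eq ?_) this
  rw [norm_L1, l1norm]
  refine tsum_congr (fun x => ?_)
  rw [map_sub, hF', hG']
  rfl
end
end

section
/- Let d, n ≥ 1 be integers. For j ∈ {1,…,n} and r ∈ {1,…,d}, let p_j, q_{j,r} ∈ [0,1] satisfy Σ_{r=1}^d q_{j,r} = 1 and λ_r := Σ_{j=1}^n p_j q_{j,r} > 0. In ℓ¹(ℕ^d), let F = ∏_{j=1}^n (δ₀ + p_j(Q_j − δ₀)) with Q_j = Σ_{r=1}^d q_{j,r} δ_{e_r}, and G = exp(Σ_{r=1}^d λ_r(δ_{e_r} − δ₀)). Let J ⊆ {1,…,d}, and set p̃_j = p_j Σ_{r∈J} q_{j,r} for j ∈ {1,…,n} and λ̃ = Σ_{j=1}^n p̃_j. Then ‖F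 − G‖ ≥ ‖ ∏_{j=1}^n (δ₀ + p̃_j(δ₁ − δ₀)) − Po(λ̃) ‖ (the latter norm taken in ℓ¹(ℕ)), and this in turn is ≥ (1/7) · min{1/λ̃, 1} · Σ_{j=1}^n p̃_j². -/
open scoped Classical BigOperators

noncomputable section

open PaperL1


lemma push_aux {A B : Type*} (π : A → B) (h : A → ℝ) (hs : Summable h) (g : B → ℝ)
    (hg : g = fun b => ∑' a : {a // π a = b}, h a.1) :
    Summable g ∧ ∑' b, |g b| ≤ ∑' a, |h a| ∧
      ∀ (χ : B → ℂ), (∀ b, ‖χ b‖ ≤ 1) → ∀ c : ℂ,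
        HasSum (fun a => (h a : ℂ) * χ (π a)) c → HasSum (fun b => (g b : ℂ) * χ b) c := by
  have ha : Summable (fun a => |h a|) := hs.abs
  have ha' : Summable (fun s : (Σ b, {a // π a = b}) => |h s.2.1|) :=
    ((Equiv.sigmaFiberEquiv π).summable_iff (f := fun a => |h a|)).2 ha
  have hfib : ∀ b, Summable (fun a : {a // π a = b} => |h a.1|) := fun b => ha'.sigma_factor b
  have hle : ∀ b, |g b| ≤ ∑' a : {a // π a = b}, |h a.1| := by
    intro b
    rw [hg]
    have := norm_tsum_le_tsum_norm (f := fun a : {a // π a = b} => h a.1) (hfib b)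
    simpa [Real.norm_eq_abs] using this
  have hsig : Summable (fun b => ∑' a : {a // π a = b}, |h a.1|) := ha'.sigma
  have hgs : Summable (fun b => |g b|) :=
    Summable.of_nonneg_of_le (fun b => abs_nonneg _) hle hsig
  refine ⟨hgs.of_abs, ?_, ?_⟩
  · calc ∑' b, |g b| ≤ ∑' b, ∑' a : {a // π a = b}, |h a.1| := hgs.tsum_le_tsum hle hsig
      _ = ∑' s : (Σ b, {a // π a = b}), |h s.2.1| := (ha'.tsum_sigma).symm
      _ = ∑' a, |h a| := (Equiv.sigmaFiberEquiv π).tsum_eq (fun a => |h a|)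
  · intro χ hχ c hc
    have hc' : HasSum (fun s : (Σ b, {a // π a = b}) => (h s.2.1 : ℂ) * χ (π s.2.1)) c :=
      ((Equiv.sigmaFiberEquiv π).hasSum_iff (f := fun a => (h a : ℂ) * χ (π a))).2 hc
    refine hc'.sigma ?_
    intro b
    have h1 : HasSum (fun a : {a // π a = b} => h a.1) (g b) := by
      rw [hg]; exact (hfib b).of_abs.hasSum
    have h2 : HasSum (fun a : {a // π a = b} => (h a.1 : ℂ)) (g b : ℂ) := by
      exact_mod_cast h1
    have h3 := h2.mul_right (χ b)
    refine h3.congr_fun ?_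
    rintro ⟨a, rfl⟩
    rfl

/-- `f` is summable with norm at most `N` and transform `a` under `χ`. -/
structure Good {X : Type*} (χ : X → ℂ) (f : X → ℝ) (a : ℂ) (N : ℝ) : Prop where
  summ : Summable f
  norm : ∑' x, |f x| ≤ N
  tr : HasSum (fun x => (f x : ℂ) * χ x) a

structure IsChar {X : Type*} [AddCommMonoid X] (χ : X → ℂ) : Prop where
  zero : χ 0 = 1
  add : ∀ x y, χ (x + y) = χ x * χ y
  bd : ∀ x, ‖χ x‖ ≤ 1

section
variable {X : Type*} {χ : X → ℂ} {f g : X → ℝ} {a b : ℂ} {N M : ℝ}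

lemma Good.delta (x : X) [AddCommMonoid X] : Good χ (delta x) (χ x) 1 := by
  have h0 : ∀ y, y ≠ x → PaperL1.delta x y = 0 := fun y hy => by simp [PaperL1.delta, hy]
  have h1 : PaperL1.delta x x = 1 := by simp [PaperL1.delta]
  refine ⟨?_, ?_, ?_⟩
  · exact (hasSum_single x h0).summable
  · rw [tsum_eq_single x (fun y hy => by simp [h0 y hy]), h1]; simp
  · have := hasSum_single (f := fun y => (PaperL1.delta x y : ℂ) * χ y) x
      (fun y hy => by simp [h0 y hy])
    simpa [h1] using this

lemma Good.add (hf : Good χ f a N) (hg : Good χ g b M) : Good χ (f + g) (a + b) (N + M) := by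
  refine ⟨hf.summ.add hg.summ, ?_, ?_⟩
  · have h := (hf.summ.add hg.summ).abs.tsum_le_tsum (fun x => abs_add_le (f x) (g x))
      (hf.summ.abs.add hg.summ.abs)
    rw [hf.summ.abs.tsum_add hg.summ.abs] at h
    exact h.trans (add_le_add hf.norm hg.norm)
  · have := hf.tr.add hg.tr
    simpa [add_mul] using this

lemma Good.smul (c : ℝ) (hf : Good χ f a N) : Good χ (c • f) (c * a) (|c| * N) := by
  refine ⟨hf.summ.mul_left c, ?_, ?_⟩
  · simp only [Pi.smul_apply, smul_eq_mul, abs_mul, tsum_mul_left]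
    exact mul_le_mul_of_nonneg_left hf.norm (abs_nonneg _)
  · have := hf.tr.mul_left (c : ℂ)
    simpa [mul_assoc] using this

lemma Good.sub (hf : Good χ f a N) (hg : Good χ g b M) : Good χ (f - g) (a - b) (N + M) := by
  have := hf.add (hg.smul (-1))
  simpa [sub_eq_add_neg] using this

lemma Good.sum {ι : Type*} (s : Finset ι) (f : ι → X → ℝ) (a : ι → ℂ) (N : ι → ℝ)
    (h : ∀ i, Good χ (f i) (a i) (N i)) : Good χ (∑ i ∈ s, f i) (∑ i ∈ s, a i) (∑ i ∈ s, N i) := by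
  induction s using Finset.induction_on with
  | empty =>
    simp only [Finset.sum_empty]
    refine ⟨summable_zero, by simp, ?_⟩
    simpa using (hasSum_zero : HasSum (fun _ : X => (0 : ℂ)) 0)
  | insert i s hi ih =>
    simp only [Finset.sum_insert hi]
    exact (h i).add ih

variable [AddCommMonoid X]

lemma Good.conv (hχ : IsChar χ) (hf : Good χ f a N) (hg : Good χ g b M) :
    Good χ (conv f g) (a * b) (N * M) := by
  have hN : 0 ≤ N := (tsum_nonneg (fun x => abs_nonneg (f x))).trans hf.norm
  have hs : Summable (fun p : X × X => f p.1 * g p.2) :=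
    summable_mul_of_summable_norm (f := f) (g := g) hf.summ.abs hg.summ.abs
  obtain ⟨h1, h2, h3⟩ := push_aux (fun p : X × X => p.1 + p.2) (fun p => f p.1 * g p.2) hs
    (PaperL1.conv f g) rfl
  refine ⟨h1, h2.trans ?_, h3 χ hχ.bd _ ?_⟩
  · have := tsum_mul_tsum_of_summable_norm (f := fun x => |f x|) (g := fun x => |g x|)
      (by simpa using hf.summ.abs) (by simpa using hg.summ.abs)
    simp only [abs_mul]
    rw [← this]
    exact mul_le_mul hf.norm hg.norm (tsum_nonneg (fun x => abs_nonneg (g x))) hN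
  · have bnd : ∀ {h : X → ℝ}, Summable h → Summable (fun x => ‖(h x : ℂ) * χ x‖) := by
      intro h hh
      refine Summable.of_nonneg_of_le (fun x => norm_nonneg _) (fun x => ?_) hh.abs
      rw [norm_mul, Complex.norm_real, Real.norm_eq_abs]
      exact mul_le_of_le_one_right (abs_nonneg _) (hχ.bd x)
    have hs2 := summable_mul_of_summable_norm (bnd hf.summ) (bnd hg.summ)
    have := hf.tr.mul hg.tr hs2
    refine this.congr_fun ?_
    intro p
    simp only [hχ.add]
    push_cast
    ring

lemma Good.convPow (hχ : IsChar χ) (hf : Good χ f a N) (m : ℕ) :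
    Good χ (convPow f m) (a ^ m) (N ^ m) := by
  induction m with
  | zero =>
    have := Good.delta (χ := χ) (0 : X)
    rw [hχ.zero] at this
    simpa [PaperL1.convPow] using this
  | succ m ih =>
    rw [pow_succ', pow_succ']
    exact hf.conv hχ ih

lemma Good.convExp (hχ : IsChar χ) (hf : Good χ f a N) :
    Good χ (convExp f) (Complex.exp a) (Real.exp N) := by
  have hpw := fun m => hf.convPow hχ m
  have hexp : HasSum (fun m : ℕ => ((m.factorial : ℝ))⁻¹ * N ^ m) (Real.exp N) := by
    have := NormedSpace.expSeries_div_hasSum_exp (𝔸 := ℝ) N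
    rw [← Real.exp_eq_exp_ℝ] at this
    simpa [div_eq_inv_mul] using this
  have hexpC : HasSum (fun m : ℕ => ((m.factorial : ℂ))⁻¹ * a ^ m) (Complex.exp a) := by
    have := NormedSpace.expSeries_div_hasSum_exp (𝔸 := ℂ) a
    rw [← Complex.exp_eq_exp_ℂ] at this
    simpa [div_eq_inv_mul] using this
  have hfac : ∀ m : ℕ, (0:ℝ) ≤ ((m.factorial : ℝ))⁻¹ := fun m => by positivity
  -- summability on the product
  obtain ⟨u, hu_def⟩ : ∃ u : (Σ _ : ℕ, X) → ℝ, ∀ m x, u ⟨m, x⟩ =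
      ((m.factorial : ℝ))⁻¹ * PaperL1.convPow f m x :=
    ⟨fun s => ((s.1.factorial : ℝ))⁻¹ * PaperL1.convPow f s.1 s.2, fun _ _ => rfl⟩
  have hle : ∀ m : ℕ, ∑' x, |u ⟨m, x⟩| ≤ ((m.factorial : ℝ))⁻¹ * N ^ m := by
    intro m
    have e : (fun x => |u ⟨m, x⟩|) =
        fun x => ((m.factorial : ℝ))⁻¹ * |PaperL1.convPow f m x| := by
      funext x
      rw [hu_def, abs_mul, abs_of_nonneg (hfac m)]
    rw [e, tsum_mul_left]
    exact mul_le_mul_of_nonneg_left (hpw m).norm (hfac m)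
  have hu : Summable (fun s => |u s|) := by
    rw [summable_sigma_of_nonneg (fun s => abs_nonneg _)]
    refine ⟨fun m => ?_, ?_⟩
    · have := ((hpw m).summ.mul_left (((m.factorial : ℝ))⁻¹)).abs
      simpa only [hu_def] using this
    exact Summable.of_nonneg_of_le (fun m => tsum_nonneg (fun x => abs_nonneg _)) hle hexp.summable
  obtain ⟨v, hv_def⟩ : ∃ v : ℕ × X → ℝ, v = u ∘ (Equiv.sigmaEquivProd ℕ X).symm := ⟨_, rfl⟩
  have hvu : ∀ m x, v (m, x) = u ⟨m, x⟩ := fun m x => by rw [hv_def]; rfl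
  have hv : Summable v := by
    rw [hv_def]
    exact ((Equiv.sigmaEquivProd ℕ X).symm.summable_iff (f := u)).2 hu.of_abs
  have hcx : ∀ x, PaperL1.convExp f x = ∑' m, v (m, x) := by
    intro x
    simp only [hvu, hu_def]
    rfl
  have hva : Summable (fun s => |v s|) := hv.abs
  have hvs : Summable (fun s : X × ℕ => |v s.swap|) :=
    ((Equiv.prodComm X ℕ).summable_iff (f := fun s => |v s|)).2 hva
  have hfx : ∀ x, Summable (fun m => |v (m, x)|) := fun x => hvs.prod_factor x
  have hle2 : ∀ x, |PaperL1.convExp f x| ≤ ∑' m, |v (m, x)| := by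
    intro x
    rw [hcx]
    have := norm_tsum_le_tsum_norm (f := fun m => v (m, x)) (hfx x)
    simpa [Real.norm_eq_abs] using this
  have hsx : Summable (fun x => ∑' m, |v (m, x)|) := hvs.prod
  have habs : Summable (fun x => |PaperL1.convExp f x|) :=
    Summable.of_nonneg_of_le (fun _ => abs_nonneg _) hle2 hsx
  refine ⟨habs.of_abs, ?_, ?_⟩
  · calc ∑' x, |PaperL1.convExp f x| ≤ ∑' x, ∑' m, |v (m, x)| := habs.tsum_le_tsum hle2 hsx
      _ = ∑' m, ∑' x, |v (m, x)| := Summable.tsum_comm (f := fun m x => |v (m, x)|) hva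
      _ ≤ ∑' m : ℕ, ((m.factorial : ℝ))⁻¹ * N ^ m := by
        refine hva.prod.tsum_le_tsum (fun m => ?_) hexp.summable
        simp only [hvu]
        exact hle m
      _ = Real.exp N := hexp.tsum_eq
  · have hw : Summable (fun s : ℕ × X => (v s : ℂ) * χ s.2) := by
      refine Summable.of_norm (Summable.of_nonneg_of_le (fun x => norm_nonneg _) (fun s => ?_) hva)
      rw [norm_mul, Complex.norm_real, Real.norm_eq_abs]
      exact mul_le_of_le_one_right (abs_nonneg _) (hχ.bd _)
    have hm : ∀ m, HasSum (fun x => (v (m, x) : ℂ) * χ x) (((m.factorial : ℂ))⁻¹ * a ^ m) := by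
      intro m
      have := (hpw m).tr.mul_left (((m.factorial : ℂ))⁻¹)
      refine this.congr_fun ?_
      intro x
      simp only [hvu, hu_def]
      push_cast
      ring
    have htot : ∑' s : ℕ × X, (v s : ℂ) * χ s.2 = Complex.exp a :=
      ((hw.hasSum.prod_fiberwise hm).unique hexpC)
    have hws : HasSum (fun s : X × ℕ => (v s.swap : ℂ) * χ s.1) (Complex.exp a) := by
      have := hw.hasSum
      rw [htot] at this
      exact ((Equiv.prodComm X ℕ).hasSum_iff (f := fun s : ℕ × X => (v s : ℂ) * χ s.2)).2 this
    refine hws.prod_fiberwise ?_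
    intro x
    have h1 : HasSum (fun m => v (m, x)) (PaperL1.convExp f x) := by
      rw [hcx]; exact (hfx x).of_abs.hasSum
    have h2 : HasSum (fun m => (v (m, x) : ℂ)) (PaperL1.convExp f x : ℂ) := by exact_mod_cast h1
    exact h2.mul_right (χ x)

lemma Good.convProd (hχ : IsChar χ) {ι : Type*} [LinearOrder ι] (s : Finset ι) (f : ι → X → ℝ)
    (a : ι → ℂ) (N : ι → ℝ) (h : ∀ i, Good χ (f i) (a i) (N i)) :
    ∃ K, Good χ (convProd s f) (∏ i ∈ s, a i) K := by
  have key : ∀ l : List ι, ∃ K,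
      Good χ (l.foldr (fun i acc => PaperL1.conv (f i) acc) (PaperL1.delta 0)) ((l.map a).prod) K := by
    intro l
    induction l with
    | nil =>
      have := Good.delta (χ := χ) (0 : X)
      rw [hχ.zero] at this
      exact ⟨1, by simpa using this⟩
    | cons i l ih =>
      obtain ⟨K, hK⟩ := ih
      exact ⟨N i * K, by simpa using (h i).conv hχ hK⟩
  obtain ⟨K, hK⟩ := key (s.sort (· ≤ ·))
  refine ⟨K, ?_⟩
  have e : ((s.sort (· ≤ ·)).map a).prod = ∏ i ∈ s, a i := by
    rw [← Multiset.prod_coe, ← Multiset.map_coe, Finset.sort_eq]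
    rfl
  rw [← e]
  exact hK
end

/-- Uniqueness of power series. -/
lemma ps_unique (h : ℕ → ℝ) (hs : Summable h)
    (hz : ∀ z : ℂ, ‖z‖ ≤ 1 → HasSum (fun k => (h k : ℂ) * z ^ k) 0) : h = 0 := by
  have hp : HasFPowerSeriesOnBall (fun _ : ℂ => (0 : ℂ))
      (FormalMultilinearSeries.ofScalars ℂ (fun k => (h k : ℂ))) 0 1 := by
    refine ⟨?_, by simp, ?_⟩
    · have := FormalMultilinearSeries.le_radius_of_summable_norm
        (FormalMultilinearSeries.ofScalars ℂ (fun k => (h k : ℂ))) (r := 1) (by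
          simpa [FormalMultilinearSeries.ofScalars_norm] using hs.abs)
      simpa using this
    · intro y hy
      have hy' : ‖y‖ ≤ 1 := by
        have : ‖y‖ < 1 := by simpa [← ofReal_norm] using hy
        exact this.le
      simpa [FormalMultilinearSeries.ofScalars_apply_eq, smul_eq_mul, mul_comm] using hz y hy'
  have h0 := hp.hasFPowerSeriesAt.eq_zero
  funext k
  have := congrArg (fun q => q.coeff k) h0
  have h2 : FormalMultilinearSeries.coeff (0 : FormalMultilinearSeries ℂ ℂ ℂ) k = 0 := rfl
  simpa [FormalMultilinearSeries.coeff_ofScalars, h2] using this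

lemma key_factor (p u : ℝ) (hp0 : 0 ≤ p) (hp1 : p ≤ 1) (hu0 : 0 ≤ u) (hu1 : u ≤ 1) :
    Real.exp (-(2 * p * u) + 2 * u * (1 - u) * p ^ 2) ≤ 1 - 2 * p * (1 - p) * u := by
  have hA0 : 0 ≤ 1 - (1 - u) * p := by nlinarith
  have hA1 : 1 - (1 - u) * p ≤ 1 := by nlinarith
  set A := 1 - (1 - u) * p with hA
  have hy : 0 ≤ 2 * p * u * A := by positivity
  have hq := Real.quadratic_le_exp_of_nonneg hy
  have e : -(2 * p * u) + 2 * u * (1 - u) * p ^ 2 = -(2 * p * u * A) := by rw [hA]; ring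
  rw [e, Real.exp_neg]
  set y := 2 * p * u * A with hyd
  have h1 : 1 - y + y ^ 2 / 2 ≤ 1 - 2 * p * (1 - p) * u := by
    have : A ^ 2 ≤ 1 := by nlinarith
    have h2 : 0 ≤ 2 * p ^ 2 * u ^ 2 * (1 - A ^ 2) := by
      have : 0 ≤ 1 - A ^ 2 := by linarith
      positivity
    have e3 : (1 - 2 * p * (1 - p) * u) - (1 - y + y ^ 2 / 2) = 2 * p ^ 2 * u ^ 2 * (1 - A ^ 2) := by
      have : p * A = p - (1 - u) * p ^ 2 := by rw [hA]; ring
      have e4 : y = 2 * u * (p - (1 - u) * p ^ 2) := by rw [hyd, ← this]; ring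
      have e5 : y ^ 2 = 4 * p ^ 2 * u ^ 2 * A ^ 2 := by rw [hyd]; ring
      rw [e5, e4]; ring
    linarith
  refine le_trans ?_ h1
  have hpos : 0 < 1 - y + y ^ 2 / 2 := by nlinarith [sq_nonneg (y - 1)]
  rw [inv_le_comm₀ (Real.exp_pos _) hpos]
  refine le_trans ?_ hq
  rw [inv_le_iff_one_le_mul₀ hpos]
  nlinarith [sq_nonneg (y ^ 2)]

lemma lower_analytic {n : ℕ} (p : Fin n → ℝ) (hp0 : ∀ j, 0 ≤ p j) (hp1 : ∀ j, p j ≤ 1)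
    (lam : ℝ) (hlam : lam = ∑ j, p j) :
    ∃ z : ℂ, ‖z‖ = 1 ∧ (1 / 7) * min (1 / lam) 1 * ∑ j, (p j) ^ 2 ≤
      ‖(∏ j, (1 + (p j : ℂ) * (z - 1))) - Complex.exp (lam * (z - 1))‖ := by
  have hl0 : 0 ≤ lam := by rw [hlam]; exact Finset.sum_nonneg (fun j _ => hp0 j)
  have hS : 0 ≤ ∑ j, (p j) ^ 2 := Finset.sum_nonneg (fun j _ => sq_nonneg _)
  set S := ∑ j, (p j) ^ 2 with hSd
  obtain ⟨m, hm0, hm1, hml, hmm⟩ : ∃ m : ℝ, 0 ≤ m ∧ m ≤ 1 ∧ lam * m ≤ 1 ∧ min (1 / lam) 1 ≤ m := by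
    rcases hl0.eq_or_lt with h | h
    · exact ⟨0, le_rfl, by norm_num, by simp, by simp [← h]⟩
    · refine ⟨min (1 / lam) 1, by positivity, min_le_right _ _, ?_, le_rfl⟩
      calc lam * min (1 / lam) 1 ≤ lam * (1 / lam) :=
            mul_le_mul_of_nonneg_left (min_le_left _ _) hl0
        _ = 1 := by field_simp
  set u := 2 / 5 * m with hu
  have hu0 : 0 ≤ u := by positivity
  have hu1 : u ≤ 2 / 5 := by rw [hu]; linarith
  have hlu : lam * u ≤ 2 / 5 := by rw [hu]; linarith
  set s := Real.sqrt (1 - (1 - u) ^ 2) with hs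
  have hs2 : s ^ 2 = 1 - (1 - u) ^ 2 := Real.sq_sqrt (by nlinarith)
  refine ⟨⟨1 - u, s⟩, ?_, ?_⟩
  · rw [Complex.norm_def, Complex.normSq_mk]
    rw [show (1 - u) * (1 - u) + s * s = 1 by nlinarith]; simp
  set z : ℂ := ⟨1 - u, s⟩ with hz
  have hG : ‖Complex.exp (lam * (z - 1))‖ = Real.exp (-(lam * u)) := by
    rw [Complex.norm_exp]; congr 1; simp [hz]
  have hfac : ∀ j, Real.exp (-(p j * u) + u * (1 - u) * (p j) ^ 2) ≤ ‖1 + (p j : ℂ) * (z - 1)‖ := by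
    intro j
    have hk := key_factor (p j) u (hp0 j) (hp1 j) hu0 (by linarith)
    have hsq : ‖1 + (p j : ℂ) * (z - 1)‖ ^ 2 = 1 - 2 * p j * (1 - p j) * u := by
      rw [← Complex.normSq_eq_norm_sq, Complex.normSq_apply]
      simp [hz]
      linear_combination (p j) ^ 2 * hs2
    rw [← hsq] at hk
    refine le_of_sq_le_sq ?_ (norm_nonneg _)
    refine le_trans (le_of_eq ?_) hk
    rw [← Real.exp_nat_mul]; congr 1; push_cast; ring
  have hF : Real.exp (-(lam * u) + u * (1 - u) * S) ≤ ‖∏ j, (1 + (p j : ℂ) * (z - 1))‖ := by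
    rw [norm_prod]
    refine le_trans (le_of_eq ?_) (Finset.prod_le_prod (fun j _ => (Real.exp_pos _).le)
      (fun j _ => hfac j))
    rw [← Real.exp_sum]
    congr 1
    rw [Finset.sum_add_distrib, Finset.sum_neg_distrib, ← Finset.sum_mul, ← Finset.mul_sum, hlam]
  have h1 := norm_sub_norm_le (∏ j, (1 + (p j : ℂ) * (z - 1))) (Complex.exp (lam * (z - 1)))
  refine le_trans ?_ h1
  rw [hG]
  rw [Real.exp_add] at hF
  have hE1 : u * (1 - u) * S + 1 ≤ Real.exp (u * (1 - u) * S) := Real.add_one_le_exp _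
  have hE2 : 3 / 5 ≤ Real.exp (-(lam * u)) := by
    have := Real.add_one_le_exp (-(lam * u)); linarith
  have hw : 6 / 25 * m * S ≤ u * (1 - u) * S := by
    refine mul_le_mul_of_nonneg_right ?_ hS
    rw [hu]; nlinarith
  have hw0 : 0 ≤ 6 / 25 * m * S := by positivity
  have hmS : min (1 / lam) 1 * S ≤ m * S := mul_le_mul_of_nonneg_right hmm hS
  have hmS0 : 0 ≤ m * S := by positivity
  have : 3 / 5 * (6 / 25 * m * S) ≤ Real.exp (-(lam * u)) * (Real.exp (u * (1 - u) * S) - 1) :=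
    mul_le_mul hE2 (by linarith) hw0 (by positivity)
  nlinarith

lemma isChar_pow (z : ℂ) (hz : ‖z‖ ≤ 1) : IsChar (fun k : ℕ => z ^ k) :=
  ⟨by simp, fun x y => pow_add z x y, fun x => by
    rw [norm_pow]; exact pow_le_one₀ (norm_nonneg _) hz⟩

lemma good_Po (l : ℝ) (z : ℂ) (hz : ‖z‖ ≤ 1) :
    ∃ K, Good (fun k : ℕ => z ^ k) (fun m => Real.exp (-l) * l ^ m / (m.factorial : ℝ))
      (Complex.exp (l * (z - 1))) K := by
  refine ⟨_, ?_, le_rfl, ?_⟩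
  · have := (NormedSpace.expSeries_div_hasSum_exp (𝔸 := ℝ) l).mul_left (Real.exp (-l))
    simpa [mul_div_assoc] using this.summable
  · have := (NormedSpace.expSeries_div_hasSum_exp (𝔸 := ℂ) (l * z)).mul_left (Complex.exp (-l))
    rw [← Complex.exp_eq_exp_ℂ, ← Complex.exp_add] at this
    have e : -(l:ℂ) + l * z = l * (z - 1) := by ring
    rw [e] at this
    refine this.congr_fun ?_
    intro m
    push_cast
    rw [mul_pow]
    ring

/-- Proposition (lower bounds) of Roos, inequality (13): for any subset
`J ⊆ {1,…,d}`, with `p̃_j = p_j Σ_{r∈J} q_{j,r}` and `λ̃ = Σ_j p̃_j`,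
`‖F - G‖ ≥ ‖Π_j(δ₀ + p̃_j(δ₁ - δ₀)) - Po(λ̃)‖ ≥ (1/7) min{1/λ̃, 1} Σ_j p̃_j²`. -/
theorem multinomial_poisson_lower_bound
    (d n : ℕ) (hd : 1 ≤ d) (hn : 1 ≤ n)
    (p : Fin n → ℝ) (q : Fin n → Fin d → ℝ)
    (hp : ∀ j, p j ∈ Set.Icc (0:ℝ) 1)
    (hq : ∀ j r, q j r ∈ Set.Icc (0:ℝ) 1)
    (hq1 : ∀ j, ∑ r, q j r = 1)
    (lam : Fin d → ℝ) (hlam : ∀ r, lam r = ∑ j, p j * q j r)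
    (hlampos : ∀ r, 0 < lam r)
    (e : Fin d → (Fin d → ℕ)) (he : ∀ r, e r = fun i => if i = r then 1 else 0)
    (Q : Fin n → ((Fin d → ℕ) → ℝ)) (hQ : ∀ j, Q j = ∑ r, q j r • delta (e r))
    (F : (Fin d → ℕ) → ℝ)
    (hF : F = convProd Finset.univ (fun j => delta 0 + p j • (Q j - delta 0)))
    (G : (Fin d → ℕ) → ℝ)
    (hG : G = convExp (∑ r, lam r • (delta (e r) - delta 0)))
    (J : Finset (Fin d))
    (pt : Fin n → ℝ) (hpt : ∀ j, pt j = p j * ∑ r ∈ J, q j r)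
    (lamT : ℝ) (hlamT : lamT = ∑ j, pt j)
    (FJ : ℕ → ℝ)
    (hFJ : FJ = convProd Finset.univ (fun j => delta 0 + pt j • (delta 1 - delta 0)))
    (Po : ℕ → ℝ)
    (hPo : Po = fun m => Real.exp (-lamT) * lamT ^ m / (m.factorial : ℝ)) :
    l1norm (FJ - Po) ≤ l1norm (F - G) ∧
      (1 / 7) * min (1 / lamT) 1 * ∑ j, (pt j) ^ 2 ≤ l1norm (FJ - Po) := by
  subst hF hG hFJ hPo
  have hpt0 : ∀ j, 0 ≤ pt j := fun j => by
    rw [hpt]; exact mul_nonneg (hp j).1 (Finset.sum_nonneg (fun r _ => (hq j r).1))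
  have hpt1 : ∀ j, pt j ≤ 1 := fun j => by
    rw [hpt]
    have : ∑ r ∈ J, q j r ≤ 1 := by
      rw [← hq1 j]
      exact Finset.sum_le_sum_of_subset_of_nonneg (Finset.subset_univ _) (fun r _ _ => (hq j r).1)
    exact mul_le_one₀ (hp j).2 (Finset.sum_nonneg (fun r _ => (hq j r).1)) this
  -- transforms on ℕ
  have hN : ∀ z : ℂ, ‖z‖ ≤ 1 → ∃ K, Good (fun k : ℕ => z ^ k)
      (convProd Finset.univ (fun j => delta 0 + pt j • (delta 1 - delta 0)) -
        fun m => Real.exp (-lamT) * lamT ^ m / (m.factorial : ℝ))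
      ((∏ j, (1 + (pt j : ℂ) * (z - 1))) - Complex.exp (lamT * (z - 1))) K := by
    intro z hz
    have hχ := isChar_pow z hz
    obtain ⟨K, hK⟩ := Good.convProd hχ Finset.univ
      (fun j => delta 0 + pt j • (delta 1 - delta 0)) _ _
      (fun j => (Good.delta 0).add (((Good.delta 1).sub (Good.delta 0)).smul (pt j)))
    obtain ⟨K', hK'⟩ := good_Po lamT z hz
    exact ⟨K + K', by simpa using hK.sub hK'⟩
  constructor
  · let φ : (Fin d → ℕ) → ℕ := fun x => ∑ r ∈ J, x r
    have hφe : ∀ r, φ (e r) = if r ∈ J then 1 else 0 := by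
      intro r; simp [φ, he]
    have hX : ∀ z : ℂ, ‖z‖ ≤ 1 → ∃ K, Good (fun x => z ^ (φ x))
        (convProd Finset.univ (fun j => delta 0 + p j • (Q j - delta 0)) -
          convExp (∑ r, lam r • (delta (e r) - delta 0)))
        ((∏ j, (1 + (pt j : ℂ) * (z - 1))) - Complex.exp (lamT * (z - 1))) K := by
      intro z hz
      have hχ : IsChar (fun x => z ^ (φ x)) := by
        refine ⟨by simp [φ], fun x y => ?_, fun x => (isChar_pow z hz).bd _⟩
        rw [← pow_add]; simp [φ, Finset.sum_add_distrib]
      have hQg : ∀ j, Good (fun x => z ^ (φ x)) (Q j) (∑ r, (q j r : ℂ) * z ^ (φ (e r)))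
          (∑ r, |q j r| * 1) := by
        intro j
        rw [hQ]
        exact Good.sum _ _ _ _ (fun r => (Good.delta (e r)).smul (q j r))
      obtain ⟨K, hK⟩ := Good.convProd hχ Finset.univ
        (fun j => delta 0 + p j • (Q j - delta 0)) _ _
        (fun j => (Good.delta 0).add (((hQg j).sub (Good.delta 0)).smul (p j)))
      have hK' := (Good.sum (χ := fun x => z ^ (φ x)) Finset.univ
        (fun r => lam r • (delta (e r) - delta 0)) _ _
        (fun r => ((Good.delta (e r)).sub (Good.delta 0)).smul (lam r))).convExp hχ
      have hz0 : z ^ (φ 0) = 1 := hχ.zero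
      have hze : ∀ r, z ^ (φ (e r)) = 1 + (if r ∈ J then (z - 1) else 0) := by
        intro r; rw [hφe]; split_ifs <;> simp
      have e1 : ∀ j, (p j : ℂ) * (∑ r, (q j r : ℂ) * z ^ (φ (e r)) - z ^ (φ 0)) =
          pt j * (z - 1) := by
        intro j
        have h1 : (∑ r, (q j r : ℂ)) = 1 := by exact_mod_cast hq1 j
        simp only [hze, hz0, mul_add, mul_one, Finset.sum_add_distrib, h1, hpt, mul_ite, mul_zero]
        rw [Finset.sum_ite_mem, Finset.univ_inter, ← Finset.sum_mul]
        push_cast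
        ring
      have e2 : ∑ r, (lam r : ℂ) * (z ^ (φ (e r)) - z ^ (φ 0)) = lamT * (z - 1) := by
        have hl : lamT = ∑ r ∈ J, lam r := by
          rw [hlamT]
          simp only [hpt, hlam, Finset.mul_sum]
          exact Finset.sum_comm
        simp only [hze, hz0, add_sub_cancel_left, mul_ite, mul_zero]
        rw [Finset.sum_ite_mem, Finset.univ_inter, ← Finset.sum_mul, hl]
        push_cast
        rfl
      have hfin := hK.sub hK'
      simp only [e1, e2] at hfin
      rw [hz0] at hfin
      exact ⟨_, hfin⟩
    obtain ⟨K0, hX0⟩ := hX 0 (by simp)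
    obtain ⟨h1, h2, h3⟩ := push_aux φ _ hX0.summ _ rfl
    have heq := ps_unique _ ((hN 0 (by simp)).choose_spec.summ.sub h1) (by
      intro z hz
      obtain ⟨K, hK⟩ := hN z hz
      obtain ⟨K', hK'⟩ := hX z hz
      have := hK.tr.sub (h3 (fun k => z ^ k) (isChar_pow z hz).bd _ hK'.tr)
      rw [sub_self] at this
      refine this.congr_fun ?_
      intro k
      push_cast
      ring)
    refine le_trans (le_of_eq ?_) h2
    unfold l1norm
    refine tsum_congr (fun k => ?_)
    have := congrFun heq k
    simp only [Pi.zero_apply] at this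
    rw [sub_eq_zero] at this
    rw [this]
  · obtain ⟨z, hz, hb⟩ := lower_analytic pt hpt0 hpt1 lamT hlamT
    refine hb.trans ?_
    obtain ⟨K, hK⟩ := hN z hz.le
    rw [← hK.tr.tsum_eq]
    have hnorm : ∀ (h : ℕ → ℝ) k, ‖(h k : ℂ) * z ^ k‖ = |h k| := by
      intro h k; simp [hz]
    refine (norm_tsum_le_tsum_norm ?_).trans (le_of_eq ?_)
    · simp only [hnorm]; exact hK.summ.abs
    · simp only [hnorm]; rfl
end
end

section
/- Let d, n ≥ 1 be integers. For j ∈ {1,…,n} and r ∈ {1,…,d}, let p_j, q_{j,r} ∈ [0,1] satisfy Σ_{r=1}^d q_{j,r} = 1 and λ_r := Σ_{j=1}^n p_j q_{j,r} > 0. In ℓ¹(ℕ^d), let F = ∏_{j=1}^n (δ₀ + p_j(Q_j − δ₀)) with Q_j = Σ_{r=1}^d q_{j,r} δ_{e_r}, and G = exp(Σ_{r=1}^d λ_r(δ_{e_r} − δ₀)). Then ‖F − G‖ ≥ (1/7) · max_{r∈{1,…,d}} ( min{1/λ_r, 1} · Σ_{j=1}^n p_j² q_{j,r}² ). -/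
open scoped Classical BigOperators

noncomputable section

open PaperL1

namespace MPLB

variable {X : Type*} [AddCommMonoid X]

/-- `f` is absolutely summable with transform `t` against `χ`. -/
def Tr (χ : X → ℂ) (f : X → ℝ) (t : ℂ) : Prop :=
  Summable (fun x => |f x|) ∧ HasSum (fun x => (f x : ℂ) * χ x) t

lemma summable_mul_char (χ : X → ℂ) (hχ : ∀ x, ‖χ x‖ ≤ 1) {f : X → ℝ}
    (hf : Summable (fun x => |f x|)) : Summable (fun x => ‖(f x : ℂ) * χ x‖) := by
  refine Summable.of_nonneg_of_le (fun x => norm_nonneg _) (fun x => ?_) hf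
  rw [norm_mul, Complex.norm_real, Real.norm_eq_abs]
  exact mul_le_of_le_one_right (abs_nonneg _) (hχ x)

lemma conv_abs {f g : X → ℝ}
    (hf : Summable (fun x => |f x|)) (hg : Summable (fun x => |g x|)) :
    Summable (fun x => |conv f g x|) ∧
      ∑' x, |conv f g x| ≤ (∑' x, |f x|) * ∑' x, |g x| := by
  have hs : Summable (fun y : X × X => |f y.1| * |g y.2|) :=
    hf.mul_of_nonneg hg (fun _ => abs_nonneg _) (fun _ => abs_nonneg _)
  have hH : HasSum (fun y : X × X => |f y.1| * |g y.2|) ((∑' x, |f x|) * ∑' x, |g x|) :=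
    hf.hasSum.mul hg.hasSum hs
  have hH2 := (Equiv.sigmaFiberEquiv (fun y : X × X => y.1 + y.2)).hasSum_iff.mpr hH
  have hS2 := hH2.summable
  have hfib := hS2.sigma_factor
  have hH3 := hH2.sigma (fun x => (hfib x).hasSum)
  have hle : ∀ x, |conv f g x| ≤ ∑' c : {y : X × X // y.1 + y.2 = x},
      ((fun y : X × X => |f y.1| * |g y.2|) ∘
        (Equiv.sigmaFiberEquiv (fun y : X × X => y.1 + y.2))) ⟨x, c⟩ := by
    intro x
    have h1 : Summable (fun c : {y : X × X // y.1 + y.2 = x} => ‖f c.1.1 * g c.1.2‖) := by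
      refine (hfib x).congr (fun c => ?_)
      simp [Equiv.sigmaFiberEquiv, abs_mul]
    have h2 := norm_tsum_le_tsum_norm h1
    rw [Real.norm_eq_abs] at h2
    refine h2.trans (le_of_eq (tsum_congr fun c => ?_))
    simp [Equiv.sigmaFiberEquiv, abs_mul]
  have hs3 : Summable (fun x => |conv f g x|) :=
    Summable.of_nonneg_of_le (fun _ => abs_nonneg _) hle hH3.summable
  exact ⟨hs3, (hs3.tsum_le_tsum hle hH3.summable).trans hH3.tsum_eq.le⟩

lemma Tr.conv {χ : X → ℂ} (hχ : ∀ x, ‖χ x‖ ≤ 1) (hm : ∀ x y, χ (x + y) = χ x * χ y)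
    {f g : X → ℝ} {s t : ℂ} (hf : Tr χ f s) (hg : Tr χ g t) :
    Tr χ (conv f g) (s * t) := by
  refine ⟨(conv_abs hf.1 hg.1).1, ?_⟩
  have hs : Summable (fun y : X × X => ((f y.1 : ℂ) * χ y.1) * ((g y.2 : ℂ) * χ y.2)) :=
    summable_mul_of_summable_norm (f := fun x => (f x : ℂ) * χ x) (g := fun x => (g x : ℂ) * χ x)
      (summable_mul_char χ hχ hf.1) (summable_mul_char χ hχ hg.1)
  have hH := hf.2.mul hg.2 hs
  have hH2 := (Equiv.sigmaFiberEquiv (fun y : X × X => y.1 + y.2)).hasSum_iff.mpr hH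
  have hfib := hH2.summable.sigma_factor
  have hH3 := hH2.sigma (fun x => (hfib x).hasSum)
  refine hH3.congr_fun ?_
  intro x
  unfold PaperL1.conv
  rw [Complex.ofReal_tsum, ← tsum_mul_right]
  refine tsum_congr fun c => ?_
  obtain ⟨⟨y, z⟩, h⟩ := c
  simp only [Equiv.sigmaFiberEquiv, Function.comp, Equiv.coe_fn_mk]
  simp only at h
  rw [← h, hm]
  push_cast
  ring

lemma Tr.delta (χ : X → ℂ) (a : X) : Tr χ (delta a) (χ a) := by
  constructor
  · refine summable_of_ne_finset_zero (s := {a}) (fun x hx => ?_)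
    simp at hx
    simp [PaperL1.delta, hx]
  · convert hasSum_ite_eq a (χ a) using 2 with x
    by_cases h : x = a <;> simp [PaperL1.delta, h]

lemma Tr.add {χ : X → ℂ} {f g : X → ℝ} {s t : ℂ} (hf : Tr χ f s) (hg : Tr χ g t) :
    Tr χ (f + g) (s + t) := by
  constructor
  · exact (hf.1.of_abs.add hg.1.of_abs).abs
  · refine (hf.2.add hg.2).congr_fun fun x => ?_
    simp [add_mul]

lemma Tr.smul {χ : X → ℂ} {f : X → ℝ} {s : ℂ} (c : ℝ) (hf : Tr χ f s) :
    Tr χ (c • f) (c * s) := by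
  constructor
  · exact (hf.1.of_abs.mul_left c).abs
  · refine (hf.2.mul_left (c : ℂ)).congr_fun fun x => ?_
    simp [mul_assoc]

lemma Tr.sub {χ : X → ℂ} {f g : X → ℝ} {s t : ℂ} (hf : Tr χ f s) (hg : Tr χ g t) :
    Tr χ (f - g) (s - t) := by
  constructor
  · exact (hf.1.of_abs.sub hg.1.of_abs).abs
  · refine (hf.2.sub hg.2).congr_fun fun x => ?_
    simp [sub_mul]

lemma Tr.sum {χ : X → ℂ} {ι : Type*} (s : Finset ι) (f : ι → X → ℝ) (t : ι → ℂ)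
    (h : ∀ i, Tr χ (f i) (t i)) : Tr χ (∑ i ∈ s, f i) (∑ i ∈ s, t i) := by
  induction s using Finset.induction_on with
  | empty =>
    constructor
    · simpa using (summable_zero : Summable (fun _ : X => (0 : ℝ)))
    · simpa using (hasSum_zero : HasSum (fun _ : X => (0 : ℂ)) 0)
  | insert a s ha ih =>
    rw [Finset.sum_insert ha, Finset.sum_insert ha]
    exact (h a).add ih

lemma Tr.pow {χ : X → ℂ} (hχ : ∀ x, ‖χ x‖ ≤ 1) (hm : ∀ x y, χ (x + y) = χ x * χ y)
    (h0 : χ 0 = 1) {f : X → ℝ} {s : ℂ} (hf : Tr χ f s) (m : ℕ) :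
    Tr χ (convPow f m) (s ^ m) ∧ ∑' x, |convPow f m x| ≤ (∑' x, |f x|) ^ m := by
  induction m with
  | zero =>
    have h := Tr.delta χ (0 : X)
    rw [h0] at h
    refine ⟨by simpa [convPow] using h, ?_⟩
    have : ∀ x : X, |convPow f 0 x| = if x = 0 then 1 else 0 := by
      intro x
      by_cases h : x = 0 <;> simp [convPow, PaperL1.delta, h]
    simp only [this, tsum_ite_eq, pow_zero, le_refl]
  | succ m ih =>
    refine ⟨?_, ?_⟩
    · rw [pow_succ']
      exact hf.conv hχ hm ih.1
    · rw [pow_succ']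
      exact (conv_abs hf.1 ih.1.1).2.trans
        (mul_le_mul_of_nonneg_left ih.2 (tsum_nonneg fun _ => abs_nonneg _))

lemma Tr.exp {χ : X → ℂ} (hχ : ∀ x, ‖χ x‖ ≤ 1) (hm : ∀ x y, χ (x + y) = χ x * χ y)
    (h0 : χ 0 = 1) {f : X → ℝ} {s : ℂ} (hf : Tr χ f s) :
    Tr χ (convExp f) (Complex.exp s) := by
  have hP := fun m => hf.pow hχ hm h0 m
  have hS : Summable (fun y : ℕ × X => |((y.1.factorial : ℝ))⁻¹ * convPow f y.1 y.2|) := by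
    rw [summable_prod_of_nonneg (fun _ => abs_nonneg _)]
    simp only [abs_mul]
    refine ⟨fun m => (hP m).1.1.mul_left _, ?_⟩
    refine Summable.of_nonneg_of_le (fun m => tsum_nonneg fun _ => by positivity) (fun m => ?_)
      (Real.summable_pow_div_factorial (∑' x, |f x|))
    rw [tsum_mul_left, abs_of_nonneg (by positivity), div_eq_inv_mul]
    exact mul_le_mul_of_nonneg_left (hP m).2 (by positivity)
  have hS' : Summable (fun y : X × ℕ => |((y.2.factorial : ℝ))⁻¹ * convPow f y.2 y.1|) :=
    (Equiv.prodComm X ℕ).summable_iff.mpr hS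
  have hx : ∀ x, Summable (fun m : ℕ => |((m.factorial : ℝ))⁻¹ * convPow f m x|) := fun x =>
    hS'.prod_factor x
  constructor
  · refine Summable.of_nonneg_of_le (fun _ => abs_nonneg _) (fun x => ?_) hS'.prod
    exact norm_tsum_le_tsum_norm (f := fun m : ℕ => ((m.factorial : ℝ))⁻¹ * convPow f m x) (hx x)
  · have hC : Summable (fun y : ℕ × X =>
        ((((y.1.factorial : ℝ))⁻¹ * convPow f y.1 y.2 : ℝ) : ℂ) * χ y.2) := by
      refine Summable.of_norm (Summable.of_nonneg_of_le (fun _ => norm_nonneg _) (fun y => ?_) hS)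
      rw [norm_mul, Complex.norm_real, Real.norm_eq_abs]
      exact mul_le_of_le_one_right (abs_nonneg _) (hχ _)
    have hexp : HasSum (fun m : ℕ => ((m.factorial : ℝ) : ℂ)⁻¹ * s ^ m) (Complex.exp s) := by
      have := NormedSpace.expSeries_div_hasSum_exp (𝔸 := ℂ) s
      rw [← Complex.exp_eq_exp_ℂ] at this
      refine this.congr_fun fun m => ?_
      rw [div_eq_inv_mul]
      simp
    have hrow : ∀ m : ℕ, HasSum (fun x => ((((m.factorial : ℝ))⁻¹ * convPow f m x : ℝ) : ℂ) * χ x)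
        (((m.factorial : ℝ) : ℂ)⁻¹ * s ^ m) := by
      intro m
      refine ((hP m).1.2.mul_left (((m.factorial : ℝ) : ℂ)⁻¹)).congr_fun fun x => ?_
      push_cast
      ring
    have hval := (hC.hasSum.prod_fiberwise hrow).unique hexp
    have hC2 := (Equiv.prodComm X ℕ).hasSum_iff.mpr hC.hasSum
    rw [hval] at hC2
    refine (hC2.prod_fiberwise (fun x => (hC2.summable.prod_factor x).hasSum)).congr_fun
      fun x => ?_
    unfold convExp
    rw [Complex.ofReal_tsum, ← tsum_mul_right]
    rfl

lemma Tr.prod {χ : X → ℂ} (hχ : ∀ x, ‖χ x‖ ≤ 1) (hm : ∀ x y, χ (x + y) = χ x * χ y)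
    (h0 : χ 0 = 1) {ι : Type*} [LinearOrder ι] (S : Finset ι) (f : ι → X → ℝ) (t : ι → ℂ)
    (h : ∀ i, Tr χ (f i) (t i)) : Tr χ (convProd S f) (∏ i ∈ S, t i) := by
  have key : ∀ l : List ι, Tr χ (l.foldr (fun i acc => PaperL1.conv (f i) acc) (PaperL1.delta 0))
      (l.map t).prod := by
    intro l
    induction l with
    | nil => simpa [h0] using Tr.delta χ (0 : X)
    | cons a l ih => simpa using (h a).conv hχ hm ih
  have := key (S.sort (· ≤ ·))
  have e : ((S.sort (· ≤ ·)).map t).prod = ∏ i ∈ S, t i := by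
    rw [Finset.prod, ← Multiset.prod_coe, ← Multiset.map_coe, Finset.sort_eq]
  rw [e] at this
  exact this

lemma Tr.norm_le {χ : X → ℂ} (hχ : ∀ x, ‖χ x‖ ≤ 1) {f : X → ℝ} {s : ℂ} (hf : Tr χ f s) :
    ‖s‖ ≤ l1norm f := by
  rw [← hf.2.tsum_eq]
  have h := summable_mul_char χ hχ hf.1
  refine (norm_tsum_le_tsum_norm h).trans (h.tsum_le_tsum (fun x => ?_) hf.1)
  rw [norm_mul, Complex.norm_real, Real.norm_eq_abs]
  exact mul_le_of_le_one_right (abs_nonneg _) (hχ x)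

/-- `exp (-w) ≤ 1 - w + w²/2` for `w ≥ 0`. -/
lemma exp_neg_le {w : ℝ} (hw : 0 ≤ w) : Real.exp (-w) ≤ 1 - w + w ^ 2 / 2 := by
  have h := Real.quadratic_le_exp_of_nonneg hw
  have hp : 0 < 1 + w + w ^ 2 / 2 := by positivity
  rw [Real.exp_neg]
  refine (inv_anti₀ hp h).trans ?_
  rw [inv_le_iff_one_le_mul₀ hp]
  nlinarith [sq_nonneg (w ^ 2)]

lemma factor_bound {a u : ℝ} (ha : 0 ≤ a) (ha1 : a ≤ 1) (hu : 0 ≤ u) (hu1 : u ≤ 2 / 5) :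
    Real.exp (-(a * u * (2 - 6 / 5 * a))) ≤ 1 - 2 * a * (1 - a) * u := by
  have hw : 0 ≤ a * u * (2 - 6 / 5 * a) := by
    apply mul_nonneg (mul_nonneg ha hu); linarith
  refine (exp_neg_le hw).trans ?_
  have h1 : (2 - 6 / 5 * a) ^ 2 ≤ 4 := by nlinarith
  have h2 : u * (2 - 6 / 5 * a) ^ 2 ≤ 8 / 5 := by nlinarith [sq_nonneg (2 - 6 / 5 * a)]
  have h3 : 0 ≤ a ^ 2 * u := by positivity
  nlinarith [mul_le_mul_of_nonneg_left h2 h3]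

lemma core {n : ℕ} (a : Fin n → ℝ) (ha : ∀ j, 0 ≤ a j) (ha1 : ∀ j, a j ≤ 1) (L u : ℝ)
    (hL : L = ∑ j, a j) (hu : 0 ≤ u) (hu1 : u ≤ 2 / 5) (hLu : L * u ≤ 2 / 5)
    (z : ℂ) (hre : z.re = 1 - u) (hz : z.re ^ 2 + z.im ^ 2 = 1) :
    (5 / 14) * u * ∑ j, a j ^ 2 ≤
      ‖∏ j, (1 + (a j : ℂ) * (z - 1)) - Complex.exp ((L : ℂ) * (z - 1))‖ := by
  refine le_trans ?_ (norm_sub_norm_le _ _)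
  have hG : ‖Complex.exp ((L : ℂ) * (z - 1))‖ = Real.exp (-(L * u)) := by
    rw [Complex.norm_exp]
    congr 1
    simp [hre]
  have hfac : ∀ j, Real.exp (-(a j * u) + 3 / 5 * u * a j ^ 2) ≤ ‖1 + (a j : ℂ) * (z - 1)‖ := by
    intro j
    refine (pow_le_pow_iff_left₀ (Real.exp_pos _).le (norm_nonneg _) two_ne_zero).mp ?_
    have e1 : ‖1 + (a j : ℂ) * (z - 1)‖ ^ 2 = 1 - 2 * a j * (1 - a j) * u := by
      rw [Complex.sq_norm, Complex.normSq_apply]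
      simp [hre]
      rw [hre] at hz
      linear_combination (a j) ^ 2 * hz
    rw [e1, ← Real.exp_nat_mul]
    refine le_trans (le_of_eq ?_) (factor_bound (ha j) (ha1 j) hu hu1)
    congr 1
    push_cast
    ring
  have hF : Real.exp (-(L * u) + 3 / 5 * u * ∑ j, a j ^ 2) ≤ ‖∏ j, (1 + (a j : ℂ) * (z - 1))‖ := by
    rw [norm_prod]
    refine le_trans (le_of_eq ?_)
      (Finset.prod_le_prod (fun j _ => (Real.exp_pos _).le) (fun j _ => hfac j))
    rw [← Real.exp_sum]
    congr 1
    rw [Finset.sum_add_distrib, ← Finset.mul_sum, Finset.sum_neg_distrib, ← Finset.sum_mul, hL]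
  rw [hG]
  rw [Real.exp_add] at hF
  have hS : 0 ≤ u * ∑ j, a j ^ 2 := mul_nonneg hu (Finset.sum_nonneg fun j _ => sq_nonneg _)
  have h1 := Real.add_one_le_exp (3 / 5 * u * ∑ j, a j ^ 2)
  have h2 : (3 / 5 : ℝ) ≤ Real.exp (-(L * u)) := by
    have := Real.add_one_le_exp (-(L * u))
    linarith
  nlinarith [mul_le_mul_of_nonneg_left h1 (Real.exp_pos (-(L * u))).le,
    mul_le_mul_of_nonneg_right h2 hS]

end MPLB

open PaperL1

/-- Proposition (lower bounds) of Roos, inequality (15):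
`‖F - G‖ ≥ (1/7) max_r (min{1/λ_r, 1} Σ_j p_j² q_{j,r}²)`. -/
theorem multinomial_poisson_lower_bound_max
    (d n : ℕ) (hd : 1 ≤ d) (hn : 1 ≤ n)
    (p : Fin n → ℝ) (q : Fin n → Fin d → ℝ)
    (hp : ∀ j, p j ∈ Set.Icc (0:ℝ) 1)
    (hq : ∀ j r, q j r ∈ Set.Icc (0:ℝ) 1)
    (hq1 : ∀ j, ∑ r, q j r = 1)
    (lam : Fin d → ℝ) (hlam : ∀ r, lam r = ∑ j, p j * q j r)
    (hlampos : ∀ r, 0 < lam r)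
    (e : Fin d → (Fin d → ℕ)) (he : ∀ r, e r = fun i => if i = r then 1 else 0)
    (Q : Fin n → ((Fin d → ℕ) → ℝ)) (hQ : ∀ j, Q j = ∑ r, q j r • delta (e r))
    (F : (Fin d → ℕ) → ℝ)
    (hF : F = convProd Finset.univ (fun j => delta 0 + p j • (Q j - delta 0)))
    (G : (Fin d → ℕ) → ℝ)
    (hG : G = convExp (∑ r, lam r • (delta (e r) - delta 0))) :
    (1 / 7) * Finset.univ.sup' ⟨(⟨0, hd⟩ : Fin d), Finset.mem_univ _⟩
        (fun r => min (1 / lam r) 1 * ∑ j, (p j) ^ 2 * (q j r) ^ 2)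
      ≤ l1norm (F - G) := by
  have main : ∀ r, min (1 / lam r) 1 * ∑ j, (p j) ^ 2 * (q j r) ^ 2 ≤ 7 * l1norm (F - G) := by
    intro r
    set u : ℝ := 2 / 5 * min (1 / lam r) 1 with hu_def
    have hm0 : 0 ≤ min (1 / lam r) 1 := le_min (by have := hlampos r; positivity) zero_le_one
    have hu : 0 ≤ u := by positivity
    have hu1 : u ≤ 2 / 5 := by
      have := min_le_right (1 / lam r) 1
      linarith
    have hLu : lam r * u ≤ 2 / 5 := by
      have h1 := mul_le_mul_of_nonneg_left (min_le_left (1 / lam r) 1) (hlampos r).le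
      rw [mul_one_div_cancel (hlampos r).ne'] at h1
      rw [hu_def]
      linarith
    set z : ℂ := ⟨1 - u, Real.sqrt (1 - (1 - u) ^ 2)⟩ with hz_def
    have hz : z.re ^ 2 + z.im ^ 2 = 1 := by
      simp only [hz_def]
      rw [Real.sq_sqrt (by nlinarith)]
      ring
    have hzn : ‖z‖ = 1 := by
      have : ‖z‖ ^ 2 = 1 := by
        rw [Complex.sq_norm, Complex.normSq_apply, ← hz]; ring
      exact (pow_eq_one_iff_of_nonneg (norm_nonneg z) two_ne_zero).mp this
    set χ : (Fin d → ℕ) → ℂ := fun x => z ^ (x r) with hχ_def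
    have hχ : ∀ x, ‖χ x‖ ≤ 1 := fun x => by simp [hχ_def, hzn]
    have hm : ∀ x y, χ (x + y) = χ x * χ y := fun x y => by simp [hχ_def, pow_add]
    have h0 : χ 0 = 1 := by simp [hχ_def]
    have hχe : ∀ i, χ (e i) = 1 + (if i = r then (z - 1) else 0) := by
      intro i
      by_cases h : i = r
      · simp [hχ_def, he, h]
      · simp [hχ_def, he, h, Ne.symm h]
    have hd0 : MPLB.Tr χ (delta 0) 1 := h0 ▸ MPLB.Tr.delta χ 0
    have hTF : MPLB.Tr χ F (∏ j, (1 + ((p j * q j r : ℝ) : ℂ) * (z - 1))) := by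
      rw [hF]
      refine MPLB.Tr.prod hχ hm h0 _ _ _ (fun j => ?_)
      have hTQ : MPLB.Tr χ (Q j) (∑ i, (q j i : ℂ) * χ (e i)) := by
        rw [hQ]
        exact MPLB.Tr.sum _ _ _ (fun i => (MPLB.Tr.delta χ (e i)).smul _)
      have hv : (∑ i, (q j i : ℂ) * χ (e i)) = 1 + (q j r : ℂ) * (z - 1) := by
        have h1 : (∑ i, (q j i : ℂ)) = 1 := by exact_mod_cast hq1 j
        simp only [hχe, mul_add, mul_one, Finset.sum_add_distrib, h1]
        simp
      rw [hv] at hTQ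
      have := hd0.add ((hTQ.sub hd0).smul (p j))
      convert this using 1
      push_cast
      ring
    have hTG : MPLB.Tr χ G (Complex.exp ((lam r : ℂ) * (z - 1))) := by
      rw [hG]
      refine MPLB.Tr.exp hχ hm h0 ?_
      have := MPLB.Tr.sum Finset.univ _ _
        (fun i => ((MPLB.Tr.delta χ (e i)).sub hd0).smul (lam i))
      convert this using 1
      simp [hχe]
    have hnorm := (hTF.sub hTG).norm_le hχ
    have hcore := MPLB.core (fun j => p j * q j r) (fun j => mul_nonneg (hp j).1 (hq j r).1)
      (fun j => mul_le_one₀ (hp j).2 (hq j r).1 (hq j r).2) (lam r) u (hlam r) hu hu1 hLu z rfl hz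
    have := hcore.trans hnorm
    simp only [mul_pow] at this
    rw [hu_def] at this
    linarith
  have : Finset.univ.sup' ⟨(⟨0, hd⟩ : Fin d), Finset.mem_univ _⟩
        (fun r => min (1 / lam r) 1 * ∑ j, (p j) ^ 2 * (q j r) ^ 2) ≤ 7 * l1norm (F - G) :=
    Finset.sup'_le _ _ (fun r _ => main r)
  linarith
end
end
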